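/- arXiv:1107.1502 — 2 statements merged into one kernel-verified Lean document; each statement's English description precedes it below -/
import Mathlib

section
/- For an arbitrary AR X with a basepoint * ∈ X, the weak product W(X,*) is homeomorphic to a real pre-Hilbert space E (a real inner product space with its norm topology) such that E is homeomorphic to ΣE. -/
/-- A metrizable space `X` is an absolute retract (AR) for metrizable spaces: every
continuous map into `X` from a closed subset of a metrizable space extends continuously
to the whole space. -/
def IsAbsoluteRetract (X : Type u) [TopologicalSpace X] : Prop :=
  TopologicalSpace.MetrizableSpace X ∧
  ∀ (Z : Type u) (_ : TopologicalSpace Z), TopologicalSpace.MetrizableSpace Z →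
    ∀ B : Set Z, IsClosed B → ∀ f : B → X, Continuous f →
      ∃ g : Z → X, Continuous g ∧ ∀ b : B, g b = f b

/-- The weak product `W(X,*)`: sequences in `X` equal to the basepoint for almost all
indices, as a subspace of the countable Tychonoff product `X^ω`. -/
def WeakProd (X : Type*) [TopologicalSpace X] (x₀ : X) : Set (ℕ → X) :=
  {f | {n | f n ≠ x₀}.Finite}

/-- `ΣE`: the sequences in `E` vanishing almost everywhere, as a subspace of `E^ω`. -/
def SigmaSub (E : Type*) [Zero E] : Set (ℕ → E) := {f | {n | f n ≠ 0}.Finite}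

open Set Filter Topology

/-- The basepoint of the weak product. -/
def weakBase {X : Type} [TopologicalSpace X] (x₀ : X) : WeakProd X x₀ :=
  ⟨fun _ => x₀, by simp [WeakProd]⟩

/-- A pointed homeomorphism induces a homeomorphism of weak products. -/
def weakProdCongr {X Y : Type} [TopologicalSpace X] [TopologicalSpace Y] {x₀ : X} {y₀ : Y}
    (h : X ≃ₜ Y) (h0 : h x₀ = y₀) : WeakProd X x₀ ≃ₜ WeakProd Y y₀ where
  toFun f := ⟨fun n => h (f.1 n), by
    have := f.2
    simp only [WeakProd, mem_ofPred_eq] at this ⊢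
    refine this.subset fun n hn => ?_
    simp only [mem_ofPred_eq] at hn ⊢
    rintro h1; exact hn (by rw [h1, h0])⟩
  invFun f := ⟨fun n => h.symm (f.1 n), by
    have := f.2
    simp only [WeakProd, mem_ofPred_eq] at this ⊢
    refine this.subset fun n hn => ?_
    simp only [mem_ofPred_eq] at hn ⊢
    rintro h1; exact hn (by rw [h1, ← h0, h.symm_apply_apply])⟩
  left_inv f := by ext n; simp
  right_inv f := by ext n; simp
  continuous_toFun := Continuous.subtype_mk (continuous_pi fun n =>
    h.continuous.comp ((continuous_apply n).comp continuous_subtype_val)) _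
  continuous_invFun := Continuous.subtype_mk (continuous_pi fun n =>
    h.symm.continuous.comp ((continuous_apply n).comp continuous_subtype_val)) _

/-- The weak product of a weak product is the weak product. -/
def weakProdFlatten {X : Type} [TopologicalSpace X] (x₀ : X) :
    WeakProd (WeakProd X x₀) (weakBase x₀) ≃ₜ WeakProd X x₀ where
  toFun f := ⟨fun k => (f.1 k.unpair.1).1 k.unpair.2, by
    have hf := f.2
    simp only [WeakProd, mem_ofPred_eq] at hf ⊢
    refine ((hf.biUnion (t := fun n => {k | k.unpair.1 = n ∧ (f.1 n).1 k.unpair.2 ≠ x₀})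
      fun n _ => ?_)).subset ?_
    · refine ((f.1 n).2.image (fun m => Nat.pair n m)).subset ?_
      rintro k ⟨h1, h2⟩
      exact ⟨k.unpair.2, h2, by simp [← h1]⟩
    · intro k hk
      simp only [mem_iUnion, mem_ofPred_eq]
      refine ⟨k.unpair.1, fun h => hk ?_, rfl, hk⟩
      rw [h]; rfl⟩
  invFun g := ⟨fun n => ⟨fun m => g.1 (Nat.pair n m), by
      have := g.2
      simp only [WeakProd, mem_ofPred_eq] at this ⊢
      refine (this.preimage (f := fun m => Nat.pair n m) ?_)
      intro a _ c _ h
      exact (Nat.pair_eq_pair.1 h).2⟩, by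
    have := g.2
    simp only [WeakProd, mem_ofPred_eq] at this ⊢
    refine (this.image (fun k => k.unpair.1)).subset ?_
    intro n hn
    by_contra hc
    apply hn
    ext m
    by_contra hm
    exact hc ⟨Nat.pair n m, hm, by simp⟩⟩
  left_inv f := by ext n m; simp
  right_inv g := by ext n; simp
  continuous_toFun := by
    refine Continuous.subtype_mk (continuous_pi fun k => ?_) _
    have h1 : Continuous fun f : WeakProd (WeakProd X x₀) (weakBase x₀) => f.1 k.unpair.1 :=
      (continuous_apply _).comp continuous_subtype_val
    exact (continuous_apply _).comp (continuous_subtype_val.comp h1)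
  continuous_invFun := by
    refine Continuous.subtype_mk (continuous_pi fun n => ?_) _
    refine Continuous.subtype_mk (continuous_pi fun m => ?_) _
    exact (continuous_apply _).comp continuous_subtype_val

theorem weakProdFlatten_base {X : Type} [TopologicalSpace X] (x₀ : X) :
    weakProdFlatten x₀ (weakBase (weakBase x₀)) = weakBase x₀ := by
  ext n; rfl

/-- An absolute retract contracts to any of its points. -/
theorem IsAbsoluteRetract.exists_contraction {X : Type} [TopologicalSpace X]
    (hX : IsAbsoluteRetract X) (x₀ : X) :
    ∃ c : ℝ × X → X, Continuous c ∧ (∀ x, c (0, x) = x₀) ∧ ∀ x, c (1, x) = x := by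
  have := hX.1
  let B : Set (ℝ × X) := {p | p.1 = 0 ∨ p.1 = 1}
  have hB : IsClosed B :=
    (isClosed_eq continuous_fst continuous_const).union
      (isClosed_eq continuous_fst continuous_const)
  classical
  let f : B → X := fun p => if p.1.1 = 0 then x₀ else p.1.2
  have hf : Continuous f := by
    have hlc : IsLocallyConstant (fun p : B => if p.1.1 = 0 then true else false) := by
      rw [IsLocallyConstant.iff_continuous]
      have : (fun p : B => if p.1.1 = 0 then true else false) =
          fun p : B => if p.1.1 < 1/2 then true else false := by
        funext p
        rcases p.2 with h | h <;> rw [h] <;> norm_num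
      rw [this]
      refine continuous_if ?_ continuous_const.continuousOn continuous_const.continuousOn
      intro a ha
      have := frontier_lt_subset_eq (f := fun p : B => p.1.1) (g := fun _ => (1/2 : ℝ))
        (continuous_fst.comp continuous_subtype_val) continuous_const ha
      simp only [mem_ofPred_eq] at this
      rcases a.2 with h | h <;> rw [h] at this <;> norm_num at this
    rw [continuous_iff_continuousAt]
    intro p
    have h1 := (IsLocallyConstant.iff_eventually_eq _).1 hlc p
    by_cases hp : p.1.1 = 0
    · refine (continuousAt_const (y := x₀)).congr ?_
      filter_upwards [h1] with q hq
      simp only [hp, if_true] at hq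
      have : q.1.1 = 0 := by by_contra h; simp [h] at hq
      simp [f, this]
    · refine ContinuousAt.congr (f := fun p : B => p.1.2) (by fun_prop) ?_
      filter_upwards [h1] with q hq
      simp only [hp, if_false] at hq
      have : ¬ q.1.1 = 0 := by intro h; simp [h] at hq
      simp [f, this]
  obtain ⟨g, hg, hgf⟩ := hX.2 (ℝ × X) _ inferInstance B hB f hf
  refine ⟨g, hg, fun x => ?_, fun x => ?_⟩
  · have := hgf ⟨(0, x), Or.inl rfl⟩
    simpa [f] using this
  · have := hgf ⟨(1, x), Or.inr rfl⟩
    simpa [f] using this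

theorem metrizableSpace_nat_pi (X : Type) [TopologicalSpace X]
    [TopologicalSpace.MetrizableSpace X] : TopologicalSpace.MetrizableSpace (ℕ → X) := by
  let _ := TopologicalSpace.metrizableSpaceMetric X
  let M : MetricSpace (ℕ → X) := PiCountable.metricSpace
  infer_instance

/-- The weak product of an absolute retract is an absolute retract. -/
theorem IsAbsoluteRetract.weakProd {X : Type} [TopologicalSpace X]
    (hX : IsAbsoluteRetract X) (x₀ : X) : IsAbsoluteRetract (WeakProd X x₀) := by
  have hm := hX.1
  have := metrizableSpace_nat_pi X
  classical
  refine ⟨Topology.IsEmbedding.subtypeVal.metrizableSpace, fun Z _ hZ B hB f hf => ?_⟩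
  obtain ⟨c, hc, hc0, hc1⟩ := hX.exists_contraction x₀
  let _ := TopologicalSpace.metrizableSpaceMetric Z
  rcases B.eq_empty_or_nonempty with rfl | hne
  · exact ⟨fun _ => weakBase x₀, continuous_const, fun b => b.2.elim⟩
  have : ∀ n, ∃ g : Z → X, Continuous g ∧ ∀ b : B, g b = (f b).1 n := fun n =>
    hX.2 Z _ inferInstance B hB (fun b => (f b).1 n)
      ((continuous_apply n).comp (continuous_subtype_val.comp hf))
  choose g hg hgf using this
  let τ : ℕ → Z → ℝ := fun n z => max 0 (min 1 (2 - n * Metric.infDist z B))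
  have hτ : ∀ n, Continuous (τ n) := fun n =>
    continuous_const.max (continuous_const.min (continuous_const.sub
      (continuous_const.mul (Metric.continuous_infDist_pt B))))
  refine ⟨fun z => if h : z ∈ B then f ⟨z, h⟩ else ⟨fun n => c (τ n z, g n z), ?_⟩, ?_, ?_⟩
  · have hpos : 0 < Metric.infDist z B := (hB.notMem_iff_infDist_pos hne).1 h
    obtain ⟨N, hN⟩ := exists_nat_gt (2 / Metric.infDist z B)
    refine (finite_lt_nat N).subset fun n hn => ?_
    by_contra hlt
    simp only [mem_ofPred_eq, not_lt] at hlt hn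
    apply hn
    have : τ n z = 0 := by
      have : 2 ≤ n * Metric.infDist z B := by
        rw [div_lt_iff₀ hpos] at hN
        have : (N:ℝ) ≤ n := by exact_mod_cast hlt
        nlinarith
      simp only [τ]
      rw [max_eq_left]
      exact (min_le_right _ _).trans (by linarith)
    rw [this, hc0]
  · rw [continuous_induced_rng]
    refine continuous_pi fun n => ?_
    refine (hc.comp ((hτ n).prodMk (hg n))).congr fun z => ?_
    by_cases h : z ∈ B
    · simp only [Function.comp, h, dif_pos]
      have : τ n z = 1 := by simp [τ, Metric.infDist_zero_of_mem h]
      rw [this, hc1, hgf n ⟨z, h⟩]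
    · simp [h]
  · intro b
    simp

/-- `A ⊆ [0,1]` is closed, contains the endpoints and `γ` agrees at the endpoints of the
complementary gaps. -/
def IsShortcut {Y : Type} (γ : ℝ → Y) (A : Set ℝ) : Prop :=
  IsClosed A ∧ A ⊆ Icc 0 1 ∧ 0 ∈ A ∧ 1 ∈ A ∧
    ∀ s ∈ A, ∀ t ∈ A, s < t → Disjoint (Ioo s t) A → γ s = γ t

theorem IsClosed.exists_greatest_le {A : Set ℝ} (hA : IsClosed A) {a s : ℝ} (ha : a ∈ A)
    (has : a ≤ s) : ∃ p ∈ A, p ≤ s ∧ ∀ q ∈ A, q ≤ s → q ≤ p := by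
  have hc : IsClosed (A ∩ Iic s) := hA.inter isClosed_Iic
  have hb : BddAbove (A ∩ Iic s) := ⟨s, fun q hq => hq.2⟩
  have := hc.csSup_mem ⟨a, ha, has⟩ hb
  exact ⟨_, this.1, this.2, fun q hq hqs => le_csSup hb ⟨hq, hqs⟩⟩

theorem IsClosed.exists_least_ge {A : Set ℝ} (hA : IsClosed A) {a s : ℝ} (ha : a ∈ A)
    (has : s ≤ a) : ∃ p ∈ A, s ≤ p ∧ ∀ q ∈ A, s ≤ q → p ≤ q := by
  have hc : IsClosed (A ∩ Ici s) := hA.inter isClosed_Ici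
  have hb : BddBelow (A ∩ Ici s) := ⟨s, fun q hq => hq.2⟩
  have := hc.csInf_mem ⟨a, ha, has⟩ hb
  exact ⟨_, this.1, this.2, fun q hq hqs => csInf_le hb ⟨hq, hqs⟩⟩

theorem IsShortcut.sInter {Y : Type} [MetricSpace Y] {γ : ℝ → Y} (hγ : Continuous γ)
    {c : Set (Set ℝ)} (hc : ∀ A ∈ c, IsShortcut γ A) (hch : IsChain (· ⊆ ·) c)
    (hne : c.Nonempty) : IsShortcut γ (⋂₀ c) := by
  obtain ⟨A₀, hA₀⟩ := hne
  refine ⟨isClosed_sInter fun A hA => (hc A hA).1,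
    (sInter_subset_of_mem hA₀).trans (hc _ hA₀).2.1, fun A hA => (hc A hA).2.2.1,
    fun A hA => (hc A hA).2.2.2.1, fun s hs t ht hst hd => ?_⟩
  have key : ∀ δ > 0, s + δ ≤ t - δ → ∃ s' t', s ≤ s' ∧ s' ≤ s + δ ∧ t - δ ≤ t' ∧ t' ≤ t ∧
      γ s' = γ t' := by
    intro δ hδ hle
    have hex : ∃ A ∈ c, Disjoint (Icc (s + δ) (t - δ)) A := by
      by_contra hcon
      push Not at hcon
      have : Nonempty c := ⟨⟨A₀, hA₀⟩⟩
      have := IsCompact.nonempty_iInter_of_directed_nonempty_isCompact_isClosed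
        (fun A : c => Icc (s + δ) (t - δ) ∩ A.1) ?_ ?_ ?_ ?_
      · obtain ⟨x, hx⟩ := this
        rw [mem_iInter] at hx
        have h1 := (hx ⟨A₀, hA₀⟩).1
        refine hd.notMem_of_mem_left (a := x) ⟨by linarith [h1.1], by linarith [h1.2]⟩ ?_
        exact fun A hA => (hx ⟨A, hA⟩).2
      · intro A B
        rcases hch.total A.2 B.2 with h | h
        · exact ⟨A, subset_rfl, inter_subset_inter_right _ h⟩
        · exact ⟨B, inter_subset_inter_right _ h, subset_rfl⟩
      · intro A
        exact not_disjoint_iff_nonempty_inter.1 (hcon A.1 A.2)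
      · intro A
        exact isCompact_Icc.inter_right (hc _ A.2).1
      · intro A
        exact isClosed_Icc.inter (hc _ A.2).1
    obtain ⟨A, hA, hdis⟩ := hex
    obtain ⟨p, hpA, hps, hp⟩ := (hc A hA).1.exists_greatest_le (hs A hA)
      (le_add_of_nonneg_right hδ.le)
    obtain ⟨q, hqA, hqs, hq⟩ := (hc A hA).1.exists_least_ge (ht A hA)
      (sub_le_self t hδ.le)
    have hsp := hp s (hs A hA) (by linarith)
    have htq := hq t (ht A hA) (by linarith)
    refine ⟨p, q, hsp, hps, hqs, htq, ?_⟩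
    rcases (hps.trans (hle.trans hqs)).eq_or_lt with h | h
    · rw [h]
    refine (hc A hA).2.2.2.2 p hpA q hqA h ?_
    rw [Set.disjoint_left]
    rintro x hx hxA
    rcases le_total x (s + δ) with h1 | h1
    · exact absurd (hp x hxA h1) (not_le.2 hx.1)
    rcases le_total (t - δ) x with h2 | h2
    · exact absurd (hq x hxA h2) (not_le.2 hx.2)
    exact Set.disjoint_left.1 hdis ⟨h1, h2⟩ hxA
  by_contra hne'
  have hd0 : 0 < dist (γ s) (γ t) := dist_pos.2 hne'
  obtain ⟨δ₁, hδ₁, h₁⟩ := Metric.continuousAt_iff.1 (hγ.continuousAt (x := s)) _ (half_pos hd0)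
  obtain ⟨δ₂, hδ₂, h₂⟩ := Metric.continuousAt_iff.1 (hγ.continuousAt (x := t)) _ (half_pos hd0)
  let δ := min (min (δ₁ / 2) (δ₂ / 2)) ((t - s) / 2)
  have hδ : 0 < δ := by
    simp only [δ, lt_min_iff]; exact ⟨⟨by linarith, by linarith⟩, by linarith⟩
  have a1 : δ ≤ δ₁ / 2 := (min_le_left _ _).trans (min_le_left _ _)
  have a2 : δ ≤ δ₂ / 2 := (min_le_left _ _).trans (min_le_right _ _)
  have a3 : δ ≤ (t - s) / 2 := min_le_right _ _
  obtain ⟨s', t', b1, b2, b3, b4, b5⟩ := key δ hδ (by linarith)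
  have c1 := h₁ (x := s') (by rw [Real.dist_eq, abs_lt]; constructor <;> linarith)
  have c2 := h₂ (x := t') (by rw [Real.dist_eq, abs_lt]; constructor <;> linarith)
  have := dist_triangle_left (γ s) (γ t) (γ s')
  rw [b5] at this c1
  linarith

theorem exists_minimal_shortcut {Y : Type} [MetricSpace Y] {γ : ℝ → Y} (hγ : Continuous γ) :
    ∃ A, IsShortcut γ A ∧ ∀ s ∈ A, ∀ t ∈ A, s < t → γ s = γ t → Disjoint (Ioo s t) A := by
  have h0 : IsShortcut γ (Icc 0 1) := by
    refine ⟨isClosed_Icc, subset_rfl, by simp, by simp, fun s hs t ht hst hd => ?_⟩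
    exact absurd (hd.notMem_of_mem_left (a := (s + t) / 2) ⟨by linarith, by linarith⟩)
      (not_not.2 ⟨by linarith [hs.1], by linarith [ht.2]⟩)
  obtain ⟨A, -, hA⟩ := zorn_superset_nonempty {A | IsShortcut γ A} (fun c hc hch hne =>
    ⟨⋂₀ c, IsShortcut.sInter hγ (fun A hA => hc hA) hch hne,
      fun s hs => sInter_subset_of_mem hs⟩) _ h0
  refine ⟨A, hA.prop, fun s hs t ht hst hγst => ?_⟩
  obtain ⟨ac, ai, a0, a1, ag⟩ := hA.prop
  have hB : IsShortcut γ (A \ Ioo s t) := by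
    refine ⟨ac.sdiff isOpen_Ioo, sdiff_subset.trans ai,
      ⟨a0, fun h => absurd h.1 (not_lt.2 (ai hs).1)⟩,
      ⟨a1, fun h => absurd h.2 (not_lt.2 (ai ht).2)⟩, fun s' hs' t' ht' hst' hd => ?_⟩
    by_cases hdA : Disjoint (Ioo s' t') A
    · exact ag s' hs'.1 t' ht'.1 hst' hdA
    obtain ⟨a, ha, haA⟩ := Set.not_disjoint_iff.1 hdA
    have ha2 : a ∈ Ioo s t := by
      by_contra h
      exact Set.disjoint_left.1 hd ha ⟨haA, h⟩
    have e1 : s' ≤ s := by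
      by_contra h
      exact hs'.2 ⟨not_le.1 h, ha.1.trans ha2.2⟩
    have e2 : t ≤ t' := by
      by_contra h
      exact ht'.2 ⟨ha2.1.trans ha.2, not_le.1 h⟩
    have e3 : s' = s := by
      by_contra h
      exact hd.notMem_of_mem_left (a := s) ⟨lt_of_le_of_ne e1 h, hst.trans_le e2⟩
        ⟨hs, fun h => lt_irrefl _ h.1⟩
    have e4 : t = t' := by
      by_contra h
      exact hd.notMem_of_mem_left (a := t) ⟨e1.trans_lt hst, lt_of_le_of_ne e2 h⟩
        ⟨ht, fun h => lt_irrefl _ h.2⟩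
    rw [e3, ← e4, hγst]
  have := hA.le_of_le hB sdiff_subset
  rw [Set.disjoint_left]
  exact fun x hx hxA => (this hxA).2 hx

/-- A path can be reparametrised so that its fibres on `[0,1]` are intervals. -/
theorem exists_monotone_path {Y : Type} [MetricSpace Y] {γ : ℝ → Y} (hγ : Continuous γ) :
    ∃ η : ℝ → Y, ContinuousOn η (Icc 0 1) ∧ η 0 = γ 0 ∧ η 1 = γ 1 ∧
      ∀ s ∈ Icc (0:ℝ) 1, ∀ t ∈ Icc (0:ℝ) 1, s ≤ t → η s = η t → ∀ u ∈ Icc s t, η u = η s := by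
  obtain ⟨A, ⟨ac, ai, a0, a1, ag⟩, hmin⟩ := exists_minimal_shortcut hγ
  have hp : ∀ s : ℝ, ∃ p, s ∈ Icc (0:ℝ) 1 → p ∈ A ∧ p ≤ s ∧ ∀ q ∈ A, q ≤ s → q ≤ p := by
    intro s
    by_cases hs : s ∈ Icc (0:ℝ) 1
    · obtain ⟨p, h⟩ := ac.exists_greatest_le a0 hs.1
      exact ⟨p, fun _ => h⟩
    · exact ⟨0, fun h => absurd h hs⟩
  choose p hp using hp
  have hn : ∀ s ∈ Icc (0:ℝ) 1, ∃ q ∈ A, s ≤ q ∧ (∀ r ∈ A, s ≤ r → q ≤ r) ∧ γ (p s) = γ q := by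
    intro s hs
    obtain ⟨q, h1, h2, h3⟩ := ac.exists_least_ge a1 hs.2
    refine ⟨q, h1, h2, h3, ?_⟩
    rcases ((hp s hs).2.1.trans h2).eq_or_lt with h | h
    · rw [h]
    refine ag _ (hp s hs).1 _ h1 h (Set.disjoint_left.2 fun x hx hxA => ?_)
    rcases le_total x s with h4 | h4
    · exact absurd ((hp s hs).2.2 x hxA h4) (not_le.2 hx.1)
    · exact absurd (h3 x hxA h4) (not_le.2 hx.2)
  have pfix : ∀ s ∈ A, p s = s := fun s hs =>
    le_antisymm (hp s (ai hs)).2.1 ((hp s (ai hs)).2.2 s hs le_rfl)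
  have pmono : ∀ s ∈ Icc (0:ℝ) 1, ∀ t ∈ Icc (0:ℝ) 1, s ≤ t → p s ≤ p t := fun s hs t ht hst =>
    (hp t ht).2.2 _ (hp s hs).1 ((hp s hs).2.1.trans hst)
  refine ⟨fun s => γ (p s), ?_, by simp only [pfix 0 a0], by simp only [pfix 1 a1], ?_⟩
  · have huc := isCompact_Icc.uniformContinuousOn_of_continuous (hγ.continuousOn (s := Icc (0:ℝ) 1))
    apply UniformContinuousOn.continuousOn
    rw [Metric.uniformContinuousOn_iff] at huc ⊢
    intro ε hε
    obtain ⟨δ, hδ, H⟩ := huc ε hε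
    refine ⟨δ, hδ, ?_⟩
    have main : ∀ s ∈ Icc (0:ℝ) 1, ∀ t ∈ Icc (0:ℝ) 1, s ≤ t → dist s t < δ →
        dist (γ (p s)) (γ (p t)) < ε := by
      intro s hs t ht hst hd
      obtain ⟨q, q1, q2, q3, q4⟩ := hn s hs
      rcases le_or_gt q t with hqt | hqt
      · have h1 := (hp t ht).2.2 q q1 hqt
        rw [q4]
        refine H q (ai q1) _ (ai (hp t ht).1) (lt_of_le_of_lt ?_ hd)
        rw [Real.dist_eq, Real.dist_eq, abs_sub_comm, abs_sub_comm s, abs_of_nonneg (by linarith),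
          abs_of_nonneg (by linarith)]
        linarith [(hp t ht).2.1]
      · have : p t = p s := by
          refine le_antisymm ?_ (pmono s hs t ht hst)
          refine (hp s hs).2.2 _ (hp t ht).1 ?_
          by_contra h
          have := q3 _ (hp t ht).1 (not_le.1 h).le
          linarith [(hp t ht).2.1]
        rw [this, dist_self]; exact hε
    intro s hs t ht hd
    rcases le_total s t with h | h
    · exact main s hs t ht h hd
    · rw [dist_comm]; rw [dist_comm] at hd; exact main t ht s hs h hd
  · intro s hs t ht hst he u hu
    have hu' : u ∈ Icc (0:ℝ) 1 := ⟨hs.1.trans hu.1, hu.2.trans ht.2⟩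
    have m1 := pmono s hs u hu' hu.1
    have m2 := pmono u hu' t ht hu.2
    simp only at he ⊢
    rcases m1.eq_or_lt with h | h
    · rw [h]
    rcases m2.eq_or_lt with h' | h'
    · rw [h', he]
    exact absurd (hp u hu').1 (Set.disjoint_left.1 (hmin _ (hp s hs).1 _ (hp t ht).1
      (h.trans h') he) ⟨h, h'⟩)

/-- A monotone reparametrisation function for a path whose fibres are intervals. -/
theorem exists_monotone_height {Y : Type} [MetricSpace Y] {η : ℝ → Y}
    (hη : ContinuousOn η (Icc 0 1))
    (hfib : ∀ s ∈ Icc (0:ℝ) 1, ∀ t ∈ Icc (0:ℝ) 1, s ≤ t → η s = η t →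
      ∀ u ∈ Icc s t, η u = η s) :
    ∃ μ : ℝ → ℝ, ContinuousOn μ (Icc 0 1) ∧ ∀ s ∈ Icc (0:ℝ) 1, ∀ t ∈ Icc (0:ℝ) 1, s ≤ t →
      (η s = η t ↔ μ s = μ t) ∧ μ s ≤ μ t := by
  -- replace η by a globally continuous function
  obtain ⟨θ, hθ, hθη⟩ : ∃ θ : ℝ → Y, Continuous θ ∧ ∀ s ∈ Icc (0:ℝ) 1, θ s = η s :=
    ⟨fun s => η (projIcc 0 1 zero_le_one s),
      hη.comp_continuous (continuous_subtype_val.comp (continuous_projIcc (h := zero_le_one)))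
          fun s => Subtype.prop _,
      fun s hs => by simp [projIcc_of_mem _ hs]⟩
  obtain ⟨q, hq⟩ := TopologicalSpace.exists_dense_seq ℝ
  let G : ℕ → Y → ℝ := fun k y => min 1 (Metric.infDist y (η '' (Icc 0 1 ∩ Iic (q k))))
  have hG : ∀ k, Continuous (G k) := fun k => continuous_const.min (Metric.continuous_infDist_pt _)
  have hG0 : ∀ k y, 0 ≤ G k y := fun k y => le_min zero_le_one Metric.infDist_nonneg
  have hG1 : ∀ k y, G k y ≤ 1 := fun k y => min_le_left _ _
  let m : ℕ → ℝ → ℝ := fun k s => sSup ((fun u => G k (θ (min s u))) '' Icc 0 1)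
  have hmc : ∀ k, Continuous (m k) := fun k => by
    refine isCompact_Icc.continuous_sSup (f := fun s u => G k (θ (min s u))) ?_
    exact (hG k).comp (hθ.comp (continuous_fst.min continuous_snd))
  have hbdd : ∀ k s, BddAbove ((fun u => G k (θ (min s u))) '' Icc 0 1) := by
    rintro k s
    exact ⟨1, by rintro _ ⟨u, -, rfl⟩; exact hG1 _ _⟩
  have hm0 : ∀ k s, 0 ≤ m k s := fun k s => Real.sSup_nonneg (by
    rintro _ ⟨u, -, rfl⟩; exact hG0 _ _)
  have hm1 : ∀ k s, m k s ≤ 1 := fun k s => Real.sSup_le (by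
    rintro _ ⟨u, -, rfl⟩; exact hG1 _ _) zero_le_one
  have himg : ∀ k, ∀ s ∈ Icc (0:ℝ) 1, (fun u => G k (θ (min s u))) '' Icc 0 1 =
      G k '' (η '' Icc 0 s) := by
    intro k s hs
    ext z; constructor
    · rintro ⟨u, hu, rfl⟩
      refine ⟨_, ⟨min s u, ⟨le_min hs.1 hu.1, min_le_left _ _⟩, rfl⟩, ?_⟩
      simp only
      rw [hθη]
      exact ⟨le_min hs.1 hu.1, (min_le_left _ _).trans hs.2⟩
    · rintro ⟨_, ⟨u, hu, rfl⟩, rfl⟩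
      refine ⟨u, ⟨hu.1, hu.2.trans hs.2⟩, ?_⟩
      simp only [min_eq_right hu.2]
      rw [hθη _ ⟨hu.1, hu.2.trans hs.2⟩]
  have hmono : ∀ k, ∀ s ∈ Icc (0:ℝ) 1, ∀ t ∈ Icc (0:ℝ) 1, s ≤ t → m k s ≤ m k t := by
    intro k s hs t ht hst
    refine csSup_le_csSup (hbdd k t) ⟨_, ⟨0, by simp, rfl⟩⟩ ?_
    rw [himg k s hs, himg k t ht]
    exact image_mono (image_mono (Icc_subset_Icc_right hst))
  have hsum : ∀ s, Summable fun k => (1/2 : ℝ) ^ k * m k s := fun s =>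
    Summable.of_nonneg_of_le (fun k => mul_nonneg (by positivity) (hm0 k s))
      (fun k => mul_le_of_le_one_right (by positivity) (hm1 k s)) summable_geometric_two
  refine ⟨fun s => ∑' k, (1/2 : ℝ) ^ k * m k s, ?_, fun s hs t ht hst =>
    ⟨⟨fun h => ?_, fun h => ?_⟩,
    ?_⟩⟩
  · refine Continuous.continuousOn ?_
    refine continuous_tsum (fun k => continuous_const.mul (hmc k)) summable_geometric_two ?_
    intro k s
    rw [Real.norm_of_nonneg (mul_nonneg (by positivity) (hm0 k s))]
    exact mul_le_of_le_one_right (by positivity) (hm1 k s)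
  · refine tsum_congr fun k => ?_
    congr 1
    simp only [m]
    rw [himg k s hs, himg k t ht]
    congr 2
    refine (image_mono (Icc_subset_Icc_right hst)).antisymm ?_
    rintro _ ⟨u, hu, rfl⟩
    rcases le_total u s with hus | hus
    · exact ⟨u, ⟨hu.1, hus⟩, rfl⟩
    · exact ⟨s, ⟨hs.1, le_rfl⟩, (hfib s hs t ht hst h u ⟨hus, hu.2⟩).symm⟩
  · by_contra hne
    rcases hst.eq_or_lt with rfl | hlt
    · exact hne rfl
    have hopen : IsOpen {r : ℝ | θ r ≠ θ t} := isOpen_ne_fun hθ continuous_const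
    have hsm : s ∈ {r : ℝ | θ r ≠ θ t} := by
      show θ s ≠ θ t
      rwa [hθη s hs, hθη t ht]
    obtain ⟨δ, hδ, hball⟩ := Metric.isOpen_iff.1 hopen s hsm
    obtain ⟨r, ⟨k, rfl⟩, hr1, hr2⟩ := hq.exists_between (x := s) (y := min t (s + δ))
      (lt_min hlt (by linarith))
    have hqt : q k < t := hr2.trans_le (min_le_left _ _)
    have hqs : q k < s + δ := hr2.trans_le (min_le_right _ _)
    have hqi : q k ∈ Icc (0:ℝ) 1 := ⟨hs.1.trans hr1.le, hqt.le.trans ht.2⟩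
    have hqne : η (q k) ≠ η t := by
      have : q k ∈ {r : ℝ | θ r ≠ θ t} := hball (by
        rw [Metric.mem_ball, Real.dist_eq, abs_lt]; constructor <;> linarith)
      rw [← hθη _ hqi, ← hθη t ht]; exact this
    have h1 : m k s ≤ 0 := by
      simp only [m]
      rw [himg k s hs]
      refine Real.sSup_le ?_ le_rfl
      rintro _ ⟨_, ⟨u, hu, rfl⟩, rfl⟩
      refine (min_le_right _ _).trans (le_of_eq ?_)
      exact Metric.infDist_zero_of_mem ⟨u, ⟨⟨hu.1, hu.2.trans hs.2⟩, hu.2.trans hr1.le⟩, rfl⟩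
    have h2 : 0 < m k t := by
      refine lt_of_lt_of_le ?_ (le_csSup (hbdd k t) ⟨t, ht, rfl⟩)
      simp only [min_self]
      rw [hθη t ht]
      refine lt_min one_pos ?_
      have hcpt : IsCompact (η '' (Icc 0 1 ∩ Iic (q k))) :=
        (isCompact_Icc.inter_right isClosed_Iic).image_of_continuousOn
          (hη.mono inter_subset_left)
      refine (hcpt.isClosed.notMem_iff_infDist_pos ⟨_, q k, ⟨hqi, self_mem_Iic⟩, rfl⟩).1 ?_
      rintro ⟨u, ⟨hu, huq⟩, hut⟩
      exact hqne ((hfib u hu t ht (le_trans huq hqt.le) hut (q k) ⟨huq, hqt.le⟩).trans hut)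
    have h3 : (∑' k, (1/2 : ℝ) ^ k * m k s) < ∑' k, (1/2 : ℝ) ^ k * m k t := by
      refine Summable.tsum_lt_tsum (i := k) (fun j => ?_) ?_ (hsum s) (hsum t)
      · exact mul_le_mul_of_nonneg_left (hmono j s hs t ht hst) (by positivity)
      · exact mul_lt_mul_of_pos_left (by linarith) (by positivity)
    exact h3.ne h
  · exact Summable.tsum_le_tsum (fun j =>
      mul_le_mul_of_nonneg_left (hmono j s hs t ht hst) (by positivity)) (hsum s) (hsum t)

/-- Distinct points joined by a path are the endpoints of an arc that is a retract. -/
theorem exists_arc {Y : Type} [MetricSpace Y] {γ : ℝ → Y} (hγ : Continuous γ) (hne : γ 0 ≠ γ 1) :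
    ∃ (σ : ℝ → Y) (f : Y → ℝ), Continuous σ ∧ Continuous f ∧ ∀ t ∈ Icc (0:ℝ) 1, f (σ t) = t := by
  obtain ⟨η, hη, h0, h1, hfib⟩ := exists_monotone_path hγ
  obtain ⟨μ, hμ, hμη⟩ := exists_monotone_height hη hfib
  have hμ01 : μ 0 < μ 1 := by
    have := hμη 0 (by simp) 1 (by simp) zero_le_one
    refine lt_of_le_of_ne this.2 fun h => ?_
    rw [← this.1, h0, h1] at h
    exact hne h
  have hiff : ∀ s ∈ Icc (0:ℝ) 1, ∀ t ∈ Icc (0:ℝ) 1, (η s = η t ↔ μ s = μ t) := by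
    intro s hs t ht
    rcases le_total s t with h | h
    · exact (hμη s hs t ht h).1
    · rw [eq_comm, (hμη t ht s hs h).1, eq_comm]
  -- the map `(η, μ)` has compact graph
  let K : Set (Y × ℝ) := (fun s => (η s, μ s)) '' Icc 0 1
  have hK : IsCompact K := isCompact_Icc.image_of_continuousOn (hη.prodMk hμ)
  have : CompactSpace K := isCompact_iff_compactSpace.1 hK
  have hce1 : IsClosedEmbedding (fun p : K => p.1.1) := by
    refine (continuous_fst.comp continuous_subtype_val).isClosedEmbedding ?_
    rintro ⟨_, s, hs, rfl⟩ ⟨_, t, ht, rfl⟩ h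
    simp only at h
    refine Subtype.ext (Prod.ext ?_ ?_)
    exacts [h, (hiff s hs t ht).1 h]
  have hce2 : IsClosedEmbedding (fun p : K => p.1.2) := by
    refine (continuous_snd.comp continuous_subtype_val).isClosedEmbedding ?_
    rintro ⟨_, s, hs, rfl⟩ ⟨_, t, ht, rfl⟩ h
    simp only at h
    refine Subtype.ext (Prod.ext ?_ ?_)
    exacts [(hiff s hs t ht).2 h, h]
  obtain ⟨f, hf⟩ := ContinuousMap.exists_extension hce1
    (⟨fun p : K => p.1.2, continuous_snd.comp continuous_subtype_val⟩ : C(K, ℝ))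
  have hf' : ∀ s ∈ Icc (0:ℝ) 1, f (η s) = μ s := fun s hs =>
    DFunLike.congr_fun hf ⟨_, s, hs, rfl⟩
  have hsurj : ∀ t ∈ Icc (μ 0) (μ 1), t ∈ range (fun p : K => p.1.2) := by
    intro t ht
    obtain ⟨s, hs, rfl⟩ := intermediate_value_Icc zero_le_one hμ ht
    exact ⟨⟨_, s, hs, rfl⟩, rfl⟩
  let e := hce2.isEmbedding.toHomeomorph
  let lin : ℝ → ℝ := fun t => μ 0 + projIcc (0:ℝ) 1 zero_le_one t * (μ 1 - μ 0)
  have hlin : ∀ t, lin t ∈ Icc (μ 0) (μ 1) := by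
    intro t
    have := (projIcc (0:ℝ) 1 zero_le_one t).2
    constructor <;> simp only [lin] <;> nlinarith [this.1, this.2]
  refine ⟨fun t => (e.symm ⟨lin t, hsurj _ (hlin t)⟩).1.1, fun y => (f y - μ 0) / (μ 1 - μ 0),
    ?_, ?_, ?_⟩
  · refine (continuous_fst.comp continuous_subtype_val).comp (e.symm.continuous.comp ?_)
    refine Continuous.subtype_mk ?_ _
    exact continuous_const.add
      ((continuous_subtype_val.comp continuous_projIcc).mul continuous_const)
  · exact (f.continuous.sub continuous_const).div_const _
  · intro t ht
    have key : ∀ p : K, f p.1.1 = p.1.2 := fun p => DFunLike.congr_fun hf p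
    simp only
    rw [key]
    have : (e.symm ⟨lin t, hsurj _ (hlin t)⟩).1.2 = lin t :=
      congrArg Subtype.val (e.apply_symm_apply ⟨lin t, hsurj _ (hlin t)⟩)
    rw [this]
    simp only [lin, projIcc_of_mem _ ht]
    have : μ 1 - μ 0 ≠ 0 := by linarith
    field_simp
    ring

/-- The Kuratowski embedding into bounded continuous functions. -/
noncomputable def kuratowskiMap {Y : Type} [MetricSpace Y] (x : Y) :
    BoundedContinuousFunction Y ℝ :=
  BoundedContinuousFunction.ofNormedAddCommGroup (fun y => min 1 (dist x y))
    (by fun_prop) 1 (fun y => by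
      rw [Real.norm_of_nonneg (le_min zero_le_one dist_nonneg)]
      exact min_le_left _ _)

theorem kuratowskiMap_apply {Y : Type} [MetricSpace Y] (x y : Y) :
    kuratowskiMap x y = min 1 (dist x y) := rfl

theorem dist_kuratowskiMap_le {Y : Type} [MetricSpace Y] (x y : Y) :
    dist (kuratowskiMap x) (kuratowskiMap y) ≤ dist x y := by
  refine (BoundedContinuousFunction.dist_le dist_nonneg).2 fun z => ?_
  rw [kuratowskiMap_apply, kuratowskiMap_apply, Real.dist_eq]
  refine (abs_min_sub_min_le_max _ _ _ _).trans ?_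
  simp only [sub_self, abs_zero]
  exact max_le dist_nonneg (abs_dist_sub_le x y z)

theorem continuous_kuratowskiMap {Y : Type} [MetricSpace Y] :
    Continuous (kuratowskiMap : Y → _) :=
  (LipschitzWith.of_dist_le_mul (K := 1) fun x y => by
    simpa using dist_kuratowskiMap_le x y).continuous

theorem convexHull_kuratowski {Y : Type} [MetricSpace Y]
    {m : BoundedContinuousFunction Y ℝ} (hm : m ∈ convexHull ℝ (range (kuratowskiMap (Y := Y)))) :
    ∃ (y : Y) (w : ℝ), 0 < w ∧ ∀ x, w * min 1 (dist y x) ≤ m x := by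
  have hsub : convexHull ℝ (range (kuratowskiMap (Y := Y))) ⊆
      {m | (∀ x, 0 ≤ m x) ∧ ∃ (y : Y) (w : ℝ), 0 < w ∧ ∀ x, w * min 1 (dist y x) ≤ m x} := by
    refine convexHull_min ?_ ?_
    · rintro _ ⟨y, rfl⟩
      exact ⟨fun x => le_min zero_le_one dist_nonneg, y, 1, one_pos, fun x => by
        rw [kuratowskiMap_apply, one_mul]⟩
    · rintro m ⟨hm0, y, w, hw, hm⟩ m' ⟨hm0', y', w', hw', hm'⟩ a b ha hb hab
      refine ⟨fun x => ?_, ?_⟩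
      · simp only [BoundedContinuousFunction.coe_add, BoundedContinuousFunction.coe_smul,
          Pi.add_apply, smul_eq_mul]
        exact add_nonneg (mul_nonneg ha (hm0 x)) (mul_nonneg hb (hm0' x))
      rcases ha.eq_or_lt with rfl | ha
      · refine ⟨y', w', hw', fun x => ?_⟩
        have : b = 1 := by linarith
        simpa [this] using hm' x
      · refine ⟨y, a * w, mul_pos ha hw, fun x => ?_⟩
        simp only [BoundedContinuousFunction.coe_add, BoundedContinuousFunction.coe_smul,
          Pi.add_apply, smul_eq_mul]
        nlinarith [mul_nonneg hb (hm0' x), mul_le_mul_of_nonneg_left (hm x) ha.le]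
  exact (hsub hm).2

/-- An absolute retract is a retract of the convex hull of its Kuratowski image. -/
theorem IsAbsoluteRetract.exists_kuratowski_retraction {Y : Type} [MetricSpace Y]
    (hY : IsAbsoluteRetract Y) [Nonempty Y] :
    ∃ r : BoundedContinuousFunction Y ℝ → Y,
      ContinuousOn r (convexHull ℝ (range (kuratowskiMap (Y := Y)))) ∧
      ∀ x, r (kuratowskiMap x) = x := by
  let K := convexHull ℝ (range (kuratowskiMap (Y := Y)))
  let B : Set K := {m | m.1 ∈ range (kuratowskiMap (Y := Y))}
  have hlow : ∀ x y : Y, min 1 (dist x y) ≤ dist (kuratowskiMap x) (kuratowskiMap y) := by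
    intro x y
    have := BoundedContinuousFunction.dist_coe_le_dist (f := kuratowskiMap x)
      (g := kuratowskiMap y) y
    rw [kuratowskiMap_apply, kuratowskiMap_apply, dist_self, Real.dist_eq,
      min_eq_right zero_le_one, sub_zero, abs_of_nonneg (le_min zero_le_one dist_nonneg)] at this
    exact this
  have hB : IsClosed B := by
    rw [← isSeqClosed_iff_isClosed]
    intro u m hu hum
    choose x hx using hu
    obtain ⟨y, w, hw, hy⟩ := convexHull_kuratowski m.2
    have h1 : Tendsto (fun n => dist (u n).1 m.1) atTop (𝓝 0) :=
      tendsto_iff_dist_tendsto_zero.1 ((continuous_subtype_val.tendsto m).comp hum)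
    have h2 : ∀ n, min 1 (dist y (x n)) ≤ w⁻¹ * dist (u n).1 m.1 := by
      intro n
      have h3 := BoundedContinuousFunction.dist_coe_le_dist (f := (u n).1) (g := m.1) (x n)
      rw [← hx n, kuratowskiMap_apply, dist_self, min_eq_right zero_le_one, Real.dist_eq,
        zero_sub, abs_neg, hx n] at h3
      rw [inv_mul_eq_div, le_div_iff₀ hw, mul_comm]
      exact (hy _).trans ((le_abs_self _).trans h3)
    have h4 : Tendsto (fun n => min 1 (dist y (x n))) atTop (𝓝 0) := by
      refine squeeze_zero (fun n => le_min zero_le_one dist_nonneg) h2 ?_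
      simpa using h1.const_mul w⁻¹
    have h5 : Tendsto (fun n => dist (x n) y) atTop (𝓝 0) := by
      refine h4.congr' ?_
      filter_upwards [h4.eventually (gt_mem_nhds one_pos)] with n hn
      rcases min_lt_iff.1 hn with h | h
      · exact absurd h (lt_irrefl _)
      · rw [dist_comm y] at h ⊢; exact min_eq_right h.le
    have h6 : Tendsto (fun n => (u n).1) atTop (𝓝 (kuratowskiMap y)) := by
      have := (continuous_kuratowskiMap.tendsto y).comp (tendsto_iff_dist_tendsto_zero.2 h5)
      exact this.congr hx
    refine ⟨y, ?_⟩
    exact tendsto_nhds_unique h6 ((continuous_subtype_val.tendsto m).comp hum)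
  have hex : ∀ m : B, ∃ x, kuratowskiMap x = m.1.1 := fun m => m.2
  choose f hf using hex
  have hfc : Continuous f := by
    rw [Metric.continuous_iff]
    intro m ε hε
    refine ⟨min 1 ε, lt_min one_pos hε, fun m' hm' => ?_⟩
    have h1 := hlow (f m') (f m)
    rw [hf, hf] at h1
    have h2 : min 1 (dist (f m') (f m)) < min 1 ε := h1.trans_lt hm'
    rcases min_lt_iff.1 h2 with h | h
    · exact absurd (h.trans_le (min_le_left _ _)) (lt_irrefl _)
    · exact h.trans_le (min_le_right _ _)
  obtain ⟨g, hg, hgf⟩ := hY.2 K _ inferInstance B hB f hfc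
  classical
  refine ⟨fun m => if h : m ∈ K then g ⟨m, h⟩ else Classical.arbitrary Y, ?_, fun x => ?_⟩
  · rw [continuousOn_iff_continuous_domRestrict]
    refine hg.congr fun m => ?_
    simp only [domRestrict_apply]
    rw [dif_pos m.2]
  · have hx : kuratowskiMap x ∈ K := subset_convexHull _ _ ⟨x, rfl⟩
    simp only [hx, dif_pos]
    have := hgf ⟨⟨_, hx⟩, ⟨x, rfl⟩⟩
    rw [this]
    have h1 := hlow (f ⟨⟨_, hx⟩, ⟨x, rfl⟩⟩) x
    rw [hf, dist_self] at h1
    rcases min_le_iff.1 h1 with h | h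
    · norm_num at h
    · exact dist_le_zero.1 h

/-- A continuous scale on which the composition of `J` with `r` is almost constant on convex
hulls of images of balls. -/
theorem exists_continuous_scale {Y V H : Type} [MetricSpace Y] [NormedAddCommGroup V]
    [NormedSpace ℝ V] [NormedAddCommGroup H] {j₀ : Y → V} (hj : Continuous j₀) {r : V → Y}
    (hr : ContinuousOn r (convexHull ℝ (range j₀))) (hrj : ∀ x, r (j₀ x) = x) {J : Y → H}
    (hJ : Continuous J) {η : ℝ} (hη : 0 < η) :
    ∃ ε : C(Y, ℝ), ∀ x, 0 < ε x ∧ ε x ≤ η ∧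
      ∀ m ∈ convexHull ℝ (j₀ '' Metric.ball x (ε x)), ‖J (r m) - J x‖ ≤ η := by
  let t : Y → Set ℝ := fun x => {e | 0 < e ∧ e ≤ η ∧
      ∀ m ∈ convexHull ℝ (j₀ '' Metric.ball x e), ‖J (r m) - J x‖ ≤ η}
  suffices h : ∃ ε : C(Y, ℝ), ∀ x, ε x ∈ t x from h
  refine exists_continuous_forall_mem_convex_of_local_const (fun x => ?_) fun x₀ => ?_
  · refine OrdConnected.convex ⟨fun a ha b hb c hc => ?_⟩
    refine ⟨ha.1.trans_le hc.1, hc.2.trans hb.2.1, fun m hm => hb.2.2 m ?_⟩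
    exact convexHull_mono (image_mono (Metric.ball_subset_ball hc.2)) hm
  · have h1 : ContinuousWithinAt (fun m => J (r m)) (convexHull ℝ (range j₀)) (j₀ x₀) :=
      hJ.continuousAt.comp_continuousWithinAt (hr _ (subset_convexHull _ _ ⟨x₀, rfl⟩))
    obtain ⟨δ, hδ, H1⟩ := Metric.continuousWithinAt_iff.1 h1 (η / 2) (half_pos hη)
    obtain ⟨ρ₁, hρ₁, H2⟩ := Metric.continuousAt_iff.1 (hj.continuousAt (x := x₀)) δ hδ
    obtain ⟨ρ₂, hρ₂, H3⟩ := Metric.continuousAt_iff.1 (hJ.continuousAt (x := x₀)) (η / 2)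
      (half_pos hη)
    let ρ := min ρ₁ ρ₂
    have hρ : 0 < ρ := lt_min hρ₁ hρ₂
    refine ⟨min (ρ / 2) η, ?_⟩
    filter_upwards [Metric.ball_mem_nhds x₀ (half_pos hρ)] with x hx
    refine ⟨lt_min (half_pos hρ) hη, min_le_right _ _, fun m hm => ?_⟩
    rw [Metric.mem_ball] at hx
    have hsub : j₀ '' Metric.ball x (min (ρ / 2) η) ⊆ Metric.ball (j₀ x₀) δ := by
      rintro _ ⟨y, hy, rfl⟩
      rw [Metric.mem_ball] at hy ⊢
      refine H2 ?_
      have := dist_triangle y x x₀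
      have h4 := hy.trans_le (min_le_left _ _)
      have h5 : ρ ≤ ρ₁ := min_le_left _ _
      linarith
    have hm1 : m ∈ Metric.ball (j₀ x₀) δ :=
      convexHull_min hsub (convex_ball _ _) hm
    have hm2 : m ∈ convexHull ℝ (range j₀) := convexHull_mono (image_subset_range _ _) hm
    have h6 := H1 hm2 hm1
    have h7 := H3 (x := x) (by
      have h5 : ρ ≤ ρ₂ := min_le_right _ _
      linarith)
    rw [hrj] at h6
    rw [← dist_eq_norm]
    have := dist_triangle_right (J (r m)) (J x) (J x₀)
    linarith

/-- Unit vectors in a Hilbert space, depending continuously on the points of a metric space,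
that are orthogonal at points further apart than a given scale. -/
theorem exists_unit_vectors {Y : Type} [MetricSpace Y] (ε : C(Y, ℝ)) (hε : ∀ x, 0 < ε x) :
    ∃ u : C(Y, lp (fun _ : Y => ℝ) 2), (∀ x, ‖u x‖ = 1) ∧
      ∀ x y, ε x ≤ dist x y → inner ℝ (u x) (u y) = 0 := by
  classical
  let U : Y → Set Y := fun z => Metric.ball z (ε z / 4) ∩ {x | ε z < 2 * ε x}
  obtain ⟨f, hf⟩ := PartitionOfUnity.exists_isSubordinate (isClosed_univ (X := Y)) U
    (fun z => Metric.isOpen_ball.inter (isOpen_lt continuous_const (by fun_prop)))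
    (fun z _ => mem_iUnion.2 ⟨z, Metric.mem_ball_self (by linarith [hε z]), by
      show ε z < 2 * ε z
      linarith [hε z]⟩)
  have hfU : ∀ z x, f z x ≠ 0 → x ∈ U z := fun z x h => hf z (subset_closure h)
  have hfin : ∀ x, {z | f z x ≠ 0}.Finite := fun x => f.locallyFinite.point_finite x
  have hmem : ∀ x, Memℓp (fun z => Real.sqrt (f z x)) 2 := fun x =>
    (memℓp_zero ((hfin x).subset fun z hz h => hz (by
      show Real.sqrt (f z x) = 0
      rw [h, Real.sqrt_zero]))).of_exponent_ge (by simp)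
  have hsum : ∀ x, ∑' z, f z x = 1 := fun x => by
    rw [tsum_eq_finsum (by exact hfin x)]
    exact f.sum_eq_one (mem_univ x)
  let u : Y → lp (fun _ : Y => ℝ) 2 := fun x => ⟨_, hmem x⟩
  have hcont : Continuous u := by
    rw [continuous_iff_continuousAt]
    intro x₀
    obtain ⟨s, hs, hsf⟩ := f.locallyFinite x₀
    have : ∀ᶠ x in 𝓝 x₀, (∑ z ∈ hsf.toFinset, Real.sqrt (f z x) •
        (lp.single 2 z (1:ℝ) : lp (fun _ : Y => ℝ) 2)) = u x := by
      filter_upwards [hs] with x hx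
      ext z
      simp only [lp.coeFn_sum, Finset.sum_apply, lp.coeFn_smul, Pi.smul_apply, smul_eq_mul]
      by_cases hz : z ∈ hsf.toFinset
      · rw [Finset.sum_eq_single z]
        · simp [u]
        · intro w _ hw
          rw [lp.single_apply_ne _ _ _ hw.symm, mul_zero]
        · exact fun h => absurd hz h
      · have h0 : f z x = 0 := by
          by_contra h
          exact hz (hsf.mem_toFinset.2 ⟨x, h, hx⟩)
        rw [Finset.sum_eq_zero]
        · simp [u, h0]
        · intro w hw
          rw [lp.single_apply_ne, mul_zero]
          rintro rfl; exact hz hw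
    refine ContinuousAt.congr ?_ this
    fun_prop
  refine ⟨⟨u, hcont⟩, fun x => ?_, fun x y hxy => ?_⟩
  · have h1 : ‖u x‖ ^ 2 = 1 := by
      rw [← real_inner_self_eq_norm_sq, lp.inner_eq_tsum, ← hsum x]
      refine tsum_congr fun z => ?_
      simp [u, Real.sq_sqrt (f.nonneg z x)]
    exact (pow_eq_one_iff_of_nonneg (norm_nonneg _) two_ne_zero).1 h1
  · show inner ℝ (u x) (u y) = 0
    rw [lp.inner_eq_tsum]
    convert tsum_zero with z
    by_cases h1 : f z x = 0
    · simp [u, h1]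
    by_cases h2 : f z y = 0
    · simp [u, h2]
    exfalso
    obtain ⟨a1, a2⟩ := hfU z x h1
    obtain ⟨b1, b2⟩ := hfU z y h2
    rw [Metric.mem_ball] at a1 b1
    have := dist_triangle_right x y z
    have a3 : ε z < 2 * ε x := a2
    linarith

/-- The Hilbert space of square summable families indexed by `Y`. -/
noncomputable abbrev HilbertOn (Y : Type) := lp (fun _ : Y => ℝ) 2

/-- The Hilbert sum of countably many copies of `HilbertOn Y`. -/
noncomputable abbrev HilbertSeq (Y : Type) := lp (fun _ : ℕ => HilbertOn Y) 2

theorem continuous_lp_single {M : Type} [NormedAddCommGroup M] [NormedSpace ℝ M] (n : ℕ) :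
    Continuous fun u : M => (lp.single 2 n u : lp (fun _ : ℕ => M) 2) :=
  (lp.isometry_single (E := fun _ : ℕ => M) (p := 2) n).continuous

theorem exists_embedding_sequence {Y V : Type} [MetricSpace Y] [NormedAddCommGroup V]
    [NormedSpace ℝ V] {j₀ : Y → V} (hj : Continuous j₀) {r : V → Y}
    (hr : ContinuousOn r (convexHull ℝ (range j₀))) (hrj : ∀ x, r (j₀ x) = x) :
    ∃ u : ℕ → C(Y, HilbertOn Y), (∀ n x, ‖u n x‖ = 1) ∧ ∀ n, ∃ ε : C(Y, ℝ),
      (∀ x, 0 < ε x ∧ ε x ≤ (1/2) ^ n ∧ ∀ m ∈ convexHull ℝ (j₀ '' Metric.ball x (ε x)),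
        ‖(∑ i ∈ Finset.range n,
            (lp.single 2 i (((1/2) ^ i : ℝ) • u i (r m)) : HilbertSeq Y)) -
          ∑ i ∈ Finset.range n,
            (lp.single 2 i (((1/2) ^ i : ℝ) • u i x) : HilbertSeq Y)‖ ≤ (1/2) ^ n) ∧
      ∀ x y, ε x ≤ dist x y → inner ℝ (u n x) (u n y) = 0 := by
  have step : ∀ (n : ℕ) (J : C(Y, HilbertSeq Y)), ∃ u : C(Y, HilbertOn Y), (∀ x, ‖u x‖ = 1) ∧
      ∃ ε : C(Y, ℝ), (∀ x, 0 < ε x ∧ ε x ≤ (1/2) ^ n ∧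
        ∀ m ∈ convexHull ℝ (j₀ '' Metric.ball x (ε x)), ‖J (r m) - J x‖ ≤ (1/2) ^ n) ∧
      ∀ x y, ε x ≤ dist x y → inner ℝ (u x) (u y) = 0 := by
    intro n J
    obtain ⟨ε, hε⟩ := exists_continuous_scale hj hr hrj J.continuous
      (η := (1/2) ^ n) (by positivity)
    obtain ⟨u, hu, huo⟩ := exists_unit_vectors ε fun x => (hε x).1
    exact ⟨u, hu, ε, hε, huo⟩
  choose st hst1 hst2 using step
  let Js : ℕ → C(Y, HilbertSeq Y) := fun n => Nat.rec 0 (fun n J => J +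
    ⟨fun x => (lp.single 2 n (((1/2) ^ n : ℝ) • st n J x) : HilbertSeq Y),
      (continuous_lp_single n).comp ((st n J).continuous.fun_const_smul _)⟩) n
  have hJ0 : Js 0 = 0 := rfl
  have hJs : ∀ n x, Js (n + 1) x = Js n x +
      (lp.single 2 n (((1/2) ^ n : ℝ) • st n (Js n) x) : HilbertSeq Y) := fun n x => rfl
  have hJ : ∀ n x, Js n x = ∑ i ∈ Finset.range n,
      (lp.single 2 i (((1/2) ^ i : ℝ) • st i (Js i) x) : HilbertSeq Y) := by
    intro n x
    induction n with
    | zero => simp [hJ0]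
    | succ n ih => rw [Finset.sum_range_succ, ← ih, hJs]
  refine ⟨fun n => st n (Js n), fun n x => hst1 _ _ _, fun n => ?_⟩
  simp only [← hJ]
  exact hst2 n (Js n)

/-- The first form of the embedding: a map into a Hilbert space, biorthogonal functionals, and
control of convex hulls. -/
theorem exists_hilbert_embedding {Y V : Type} [MetricSpace Y] [NormedAddCommGroup V]
    [NormedSpace ℝ V] {j₀ : Y → V} (hj : Continuous j₀) {r : V → Y}
    (hr : ContinuousOn r (convexHull ℝ (range j₀))) (hrj : ∀ x, r (j₀ x) = x) :
    ∃ (j : Y → HilbertSeq Y) (Φ : ℕ → Y → HilbertSeq Y →L[ℝ] ℝ), Continuous j ∧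
      (∀ n x z, |Φ n x z| ≤ ‖z‖) ∧ (∀ n x, Φ n x (j x) = (1/2) ^ n) ∧
      (∀ n x y, (1/2) ^ n ≤ dist x y → Φ n x (j y) = 0) ∧
      ∀ x, ∀ ε > 0, ∀ m ∈ convexHull ℝ (j₀ '' {y | ‖j y - j x‖ ≤ ε}),
        ‖j (r m) - j x‖ ≤ 10 * ε := by
  obtain ⟨u, hu, hε⟩ := exists_embedding_sequence hj hr hrj
  choose ε hε1 hε2 using hε
  let s : ℕ → Y → HilbertSeq Y := fun i x => lp.single 2 i (((1/2) ^ i : ℝ) • u i x)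
  have hs : ∀ i x, ‖s i x‖ = (1/2) ^ i := fun i x => by
    simp only [s]
    rw [lp.norm_single (by norm_num), norm_smul, hu, mul_one]
    simp
  have hsum : ∀ x, Summable fun i => s i x := fun x =>
    Summable.of_norm (by simpa only [hs] using summable_geometric_two)
  let j : Y → HilbertSeq Y := fun x => ∑' i, s i x
  have hjc : Continuous j := continuous_tsum
    (fun i => (continuous_lp_single i).comp ((u i).continuous.fun_const_smul _))
    summable_geometric_two (fun i x => (hs i x).le)
  have hcoord : ∀ n x, (j x) n = ((1/2) ^ n : ℝ) • u n x := by
    intro n x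
    have h1 : HasSum (fun i => s i x) (j x) := (hsum x).hasSum
    have h2 := h1.mapL (lp.evalCLM ℝ (fun _ : ℕ => HilbertOn Y) n (p := 2))
    have h3 : HasSum (fun i => (s i x) n) (((1/2) ^ n : ℝ) • u n x) := by
      have := hasSum_single (f := fun i => (s i x) n) n (fun i hi => by
        simp only [s]
        rw [lp.single_apply_ne _ _ _ hi.symm])
      simpa [s] using this
    exact h2.unique h3
  have htail : ∀ n x, ‖j x - ∑ i ∈ Finset.range n, s i x‖ ≤ 2 * (1/2) ^ n := by
    intro n x
    have hj' : j x = _ := ((hsum x).sum_add_tsum_nat_add n).symm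
    rw [hj', add_sub_cancel_left]
    refine tsum_of_norm_bounded (g := fun i => (1/2 : ℝ) ^ (i + n)) ?_
      (fun i => (hs _ _).le)
    simp only [pow_add]
    exact hasSum_geometric_two.mul_right _
  have hjn : ∀ x, ‖j x‖ ≤ 2 := fun x => by simpa using htail 0 x
  have hclose : ∀ n x y, ‖j y - j x‖ < (1/2) ^ n → dist x y < ε n x := by
    intro n x y h
    by_contra hcon
    have h0 := hε2 n x y (not_lt.1 hcon)
    have h1 : ‖(j y - j x) n‖ ≤ ‖j y - j x‖ := lp.norm_apply_le_norm (by norm_num) _ _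
    rw [lp.coeFn_sub, Pi.sub_apply, hcoord, hcoord, ← smul_sub, norm_smul] at h1
    have h2 : ‖u n y - u n x‖ ^ 2 = 2 := by
      rw [norm_sub_sq_real, real_inner_comm, h0, hu, hu]; norm_num
    have h3 : 1 ≤ ‖u n y - u n x‖ := by
      by_contra h'
      nlinarith [norm_nonneg (u n y - u n x)]
    have h4 : ‖((1/2) ^ n : ℝ)‖ = (1/2) ^ n := by simp
    rw [h4] at h1
    have h5 : (0:ℝ) < (1/2) ^ n := by positivity
    nlinarith
  refine ⟨j, fun n x => (innerSL ℝ (u n x)).comp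
      (lp.evalCLM ℝ (fun _ : ℕ => HilbertOn Y) (p := 2) n),
    hjc, fun n x z => ?_, fun n x => ?_, fun n x y hxy => ?_, fun x e he m hm => ?_⟩
  · show |inner ℝ (u n x) (z n)| ≤ _
    refine (abs_real_inner_le_norm _ _).trans ?_
    rw [hu, one_mul]
    exact lp.norm_apply_le_norm (by norm_num) _ _
  · show inner ℝ (u n x) ((j x) n) = _
    rw [hcoord, inner_smul_right, real_inner_self_eq_norm_sq, hu]; simp
  · show inner ℝ (u n x) ((j y) n) = _
    rw [hcoord, inner_smul_right, hε2 n x y ((hε1 n x).2.1.trans hxy), mul_zero]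
  · rcases le_or_gt 1 e with h | h
    · have := norm_sub_le (j (r m)) (j x)
      linarith [hjn (r m), hjn x]
    have main : ∀ n, e < (1/2) ^ n → ‖j (r m) - j x‖ ≤ 5 * (1/2) ^ n := by
      intro n hn2
      have hsub : {y | ‖j y - j x‖ ≤ e} ⊆ Metric.ball x (ε n x) := by
        intro y hy
        rw [Metric.mem_ball, dist_comm]
        exact hclose n x y (lt_of_le_of_lt hy hn2)
      have h1 := (hε1 n x).2.2 m (convexHull_mono (image_mono hsub) hm)
      have h2 := htail n (r m)
      have h3 := htail n x
      have h4 := norm_add₃_le (a := j (r m) - ∑ i ∈ Finset.range n, s i (r m))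
        (b := (∑ i ∈ Finset.range n, s i (r m)) - ∑ i ∈ Finset.range n, s i x)
        (c := (∑ i ∈ Finset.range n, s i x) - j x)
      rw [norm_sub_rev _ (j x)] at h4
      have h5 : j (r m) - ∑ i ∈ Finset.range n, s i (r m) +
        ((∑ i ∈ Finset.range n, s i (r m)) - ∑ i ∈ Finset.range n, s i x) +
        ((∑ i ∈ Finset.range n, s i x) - j x) = j (r m) - j x := by abel
      rw [h5] at h4
      have h1' : ‖(∑ i ∈ Finset.range n, s i (r m)) - ∑ i ∈ Finset.range n, s i x‖ ≤ (1/2) ^ n := h1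
      linarith
    obtain ⟨n, hn1, hn2⟩ := exists_nat_pow_near_of_lt_one he h.le
      (by norm_num : (0:ℝ) < 1/2) (by norm_num)
    rcases hn2.eq_or_lt with hn2 | hn2
    · cases n with
      | zero => norm_num at hn2; linarith
      | succ n =>
        have h6 : (1/2 : ℝ) ^ (n + 1) = (1/2) ^ n / 2 := by rw [pow_succ]; ring
        have := main n (by rw [hn2, h6]; linarith [show (0:ℝ) < (1/2) ^ n by positivity])
        linarith
    · have h6 : (1/2 : ℝ) ^ (n + 1) = (1/2) ^ n / 2 := by rw [pow_succ]; ring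
      have := main n hn2
      linarith

/-- A Dugundji type extension: on the complement of a closed set `range j`, a continuous choice
of points in the convex hulls of the images of the almost nearest points. -/
theorem exists_dugundji {Y L V : Type} [NormedAddCommGroup L] [Nonempty Y]
    [NormedAddCommGroup V] [NormedSpace ℝ V] {j : Y → L} (hcl : IsClosed (range j)) (j₀ : Y → V) :
    ∃ g : L → V, ContinuousOn g (range j)ᶜ ∧ ∀ z ∉ range j,
      g z ∈ convexHull ℝ (j₀ '' {y | ‖j y - z‖ < 2 * Metric.infDist z (range j)}) := by
  let O := {z : L // z ∉ range j}
  obtain ⟨g, hg⟩ := exists_continuous_forall_mem_convex_of_local_const (X := O)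
    (t := fun z => convexHull ℝ (j₀ '' {y | ‖j y - z.1‖ < 2 * Metric.infDist z.1 (range j)}))
    (fun z => convex_convexHull _ _) (fun z => by
      have hpos : 0 < Metric.infDist z.1 (range j) :=
        (hcl.notMem_iff_infDist_pos (range_nonempty j)).1 z.2
      obtain ⟨_, ⟨y, rfl⟩, hy⟩ := (Metric.infDist_lt_iff (range_nonempty j)
        (r := 2 * Metric.infDist z.1 (range j)) (x := z.1)).1 (by linarith)
      refine ⟨j₀ y, ?_⟩
      have h1 : Continuous fun w : O => ‖j y - w.1‖ := by fun_prop
      have h2 : Continuous fun w : O => 2 * Metric.infDist w.1 (range j) :=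
        continuous_const.mul ((Metric.continuous_infDist_pt _).comp continuous_subtype_val)
      have h3 : ∀ᶠ w in 𝓝 z, ‖j y - w.1‖ < 2 * Metric.infDist w.1 (range j) :=
        (isOpen_lt h1 h2).mem_nhds (by
          show ‖j y - z.1‖ < _
          rwa [← dist_eq_norm, dist_comm])
      filter_upwards [h3] with w hw
      exact subset_convexHull _ _ ⟨y, hw, rfl⟩)
  classical
  refine ⟨fun z => if h : z ∉ range j then g ⟨z, h⟩ else 0, ?_, fun z hz => ?_⟩
  · rw [continuousOn_iff_continuous_domRestrict]
    refine g.continuous.congr fun z => ?_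
    simp only [domRestrict_apply]
    rw [dif_pos (show z.1 ∉ range j from z.2)]
  · simp only
    rw [dif_pos hz]
    exact hg ⟨z, hz⟩

/-- An embedding of `Y` as a linearly independent spanning subset of the pre-Hilbert space `L`
together with a retraction that is Lipschitz at the points of `Y`. -/
structure HilbertFrame (Y L : Type) [MetricSpace Y] [NormedAddCommGroup L]
    [InnerProductSpace ℝ L] where
  j : Y → L
  r : L → Y
  Φ : ℕ → Y → L →L[ℝ] ℝ
  continuous_j : Continuous j
  continuous_r : Continuous r
  r_j : ∀ x, r (j x) = x
  control : ∀ x z, ‖j (r z) - j x‖ ≤ 30 * ‖z - j x‖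
  span_j : Submodule.span ℝ (range j) = ⊤
  Φ_le : ∀ n x z, |Φ n x z| ≤ ‖z‖
  Φ_self : ∀ n x, Φ n x (j x) = (1/2) ^ n
  Φ_far : ∀ n x y, (1/2) ^ n ≤ dist x y → Φ n x (j y) = 0

theorem dist_lt_of_norm_sub_lt {Y L : Type} [MetricSpace Y] [NormedAddCommGroup L]
    [InnerProductSpace ℝ L] {j : Y → L} {Φ : ℕ → Y → L →L[ℝ] ℝ}
    (hΦ : ∀ n x z, |Φ n x z| ≤ ‖z‖) (hs : ∀ n x, Φ n x (j x) = (1/2) ^ n)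
    (hf : ∀ n x y, (1/2) ^ n ≤ dist x y → Φ n x (j y) = 0) {n : ℕ} {x y : Y}
    (h : ‖j x - j y‖ < (1/2) ^ n) : dist x y < (1/2) ^ n := by
  by_contra hc
  have h1 := hΦ n x (j x - j y)
  rw [map_sub, hs, hf n x y (not_lt.1 hc), sub_zero, abs_of_nonneg (by positivity)] at h1
  linarith

theorem isClosed_range_of_biorthogonal {Y L : Type} [MetricSpace Y] [NormedAddCommGroup L]
    [InnerProductSpace ℝ L] {j : Y → L} (hj : Continuous j) {Φ : ℕ → Y → L →L[ℝ] ℝ}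
    (hΦ : ∀ n x z, |Φ n x z| ≤ ‖z‖) (hs : ∀ n x, Φ n x (j x) = (1/2) ^ n)
    (hf : ∀ n x y, (1/2) ^ n ≤ dist x y → Φ n x (j y) = 0)
    (hspan : Submodule.span ℝ (range j) = ⊤) : IsClosed (range j) := by
  rw [← isOpen_compl_iff, Metric.isOpen_iff]
  intro z hz
  have hzs : z ∈ Submodule.span ℝ (range j) := by rw [hspan]; trivial
  obtain ⟨c, rfl⟩ := (Finsupp.mem_span_range_iff_exists_finsupp).1 hzs
  set z := c.sum fun i a => a • j i with hzdef
  have h1 : ∀ y, ∃ n : ℕ, ∀ x, dist x y < (1/2) ^ n → (1/2) ^ n ≤ ‖z - j x‖ := by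
    intro y
    have hne : 0 < ‖z - j y‖ := norm_pos_iff.2 (sub_ne_zero.2 fun h => hz ⟨y, h.symm⟩)
    have hc : Continuous fun x => ‖z - j x‖ := by fun_prop
    obtain ⟨δ, hδ, H⟩ := Metric.isOpen_iff.1 (isOpen_lt (continuous_const (y := ‖z - j y‖ / 2)) hc)
      y (by show ‖z - j y‖ / 2 < _; linarith)
    obtain ⟨n, hn⟩ := exists_pow_lt_of_lt_one (lt_min hδ (half_pos hne))
      (by norm_num : (1/2 : ℝ) < 1)
    refine ⟨n, fun x hx => ?_⟩
    have h2 : ‖z - j y‖ / 2 < ‖z - j x‖ := H (hx.trans (hn.trans_le (min_le_left _ _)))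
    exact ((hn.trans_le (min_le_right _ _)).trans h2).le
  choose N hN using h1
  let n := c.support.sup N
  have hpow : ∀ m ≤ n, (1/2 : ℝ) ^ n ≤ (1/2) ^ m := fun m hm =>
    pow_le_pow_of_le_one (by norm_num) (by norm_num) hm
  refine ⟨(1/2) ^ n, by positivity, ?_⟩
  rintro _ hx ⟨x, rfl⟩
  rw [Metric.mem_ball, dist_comm, dist_eq_norm] at hx
  by_cases hex : ∃ y ∈ c.support, dist x y < (1/2) ^ n
  · obtain ⟨y, hy, hd⟩ := hex
    have hle := hpow _ (Finset.le_sup (f := N) hy)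
    have := hN y x (hd.trans_le hle)
    linarith
  · push Not at hex
    have h2 : Φ n x z = 0 := by
      rw [hzdef, Finsupp.sum, map_sum]
      refine Finset.sum_eq_zero fun y hy => ?_
      rw [map_smul, hf n x y (hex y hy), smul_zero]
    have h3 := hΦ n x (z - j x)
    rw [map_sub, h2, hs, zero_sub, abs_neg, abs_of_nonneg (by positivity)] at h3
    linarith

theorem exists_hilbertFrame {Y : Type} [MetricSpace Y] [Nonempty Y] (hY : IsAbsoluteRetract Y) :
    ∃ (L : Type) (_ : NormedAddCommGroup L) (_ : InnerProductSpace ℝ L),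
      Nonempty (HilbertFrame Y L) := by
  obtain ⟨r₀, hr₀, hr₀j⟩ := hY.exists_kuratowski_retraction
  obtain ⟨j', Φ', hj', h1, h2, h3, h4⟩ :=
    exists_hilbert_embedding continuous_kuratowskiMap hr₀ hr₀j
  let L := Submodule.span ℝ (range j')
  let j : Y → L := fun x => ⟨j' x, Submodule.subset_span ⟨x, rfl⟩⟩
  have hj : Continuous j := hj'.subtype_mk _
  let Φ : ℕ → Y → L →L[ℝ] ℝ := fun n x => (Φ' n x).comp L.subtypeL
  have hspan : Submodule.span ℝ (range j) = ⊤ := by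
    have : range j = ((↑) : L → HilbertSeq Y) ⁻¹' (range j') := by
      ext z; constructor
      · rintro ⟨x, rfl⟩; exact ⟨x, rfl⟩
      · rintro ⟨x, hx⟩; exact ⟨x, Subtype.ext hx⟩
    rw [this]; exact Submodule.span_span_coe_preimage
  have hΦ : ∀ n x z, |Φ n x z| ≤ ‖z‖ := fun n x z => h1 n x z
  have hs : ∀ n x, Φ n x (j x) = (1/2) ^ n := fun n x => h2 n x
  have hf : ∀ n x y, (1/2) ^ n ≤ dist x y → Φ n x (j y) = 0 := fun n x y h => h3 n x y h
  have hcl := isClosed_range_of_biorthogonal hj hΦ hs hf hspan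
  obtain ⟨g, hg, hgc⟩ := exists_dugundji hcl (kuratowskiMap (Y := Y))
  classical
  have hinj : Function.Injective j := by
    intro x y hxy
    by_contra hne
    obtain ⟨n, hn⟩ := exists_pow_lt_of_lt_one (dist_pos.2 hne) (by norm_num : (1/2 : ℝ) < 1)
    have := dist_lt_of_norm_sub_lt hΦ hs hf (n := n) (x := x) (y := y) (by
      rw [hxy, sub_self, norm_zero]; positivity)
    linarith
  let r : L → Y := fun z => if h : z ∈ range j then h.choose else r₀ (g z)
  have hrj : ∀ x, r (j x) = x := fun x => by
    have h : j x ∈ range j := ⟨x, rfl⟩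
    simp only [r, dif_pos h]
    exact hinj h.choose_spec
  have hctrl : ∀ x z, ‖j (r z) - j x‖ ≤ 30 * ‖z - j x‖ := by
    intro x z
    by_cases hz : z ∈ range j
    · obtain ⟨y, rfl⟩ := hz
      rw [hrj]; linarith [norm_nonneg (j y - j x)]
    · have hpos : 0 < ‖z - j x‖ := norm_pos_iff.2 (sub_ne_zero.2 fun h => hz ⟨x, h.symm⟩)
      have h5 : Metric.infDist z (range j) ≤ ‖z - j x‖ := by
        rw [← dist_eq_norm]; exact Metric.infDist_le_dist_of_mem ⟨x, rfl⟩
      have h6 := h4 x (3 * ‖z - j x‖) (by linarith) (g z) (convexHull_mono (image_mono ?_)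
        (hgc z hz))
      · have h7 : r z = r₀ (g z) := by simp only [r, dif_neg hz]
        rw [h7]
        refine le_trans h6 (by linarith)
      · intro y hy
        have h8 : ‖j y - z‖ < 2 * Metric.infDist z (range j) := hy
        show ‖j y - j x‖ ≤ _
        have := norm_sub_le_norm_sub_add_norm_sub (j y) z (j x)
        linarith
  have hrc : Continuous r := by
    rw [continuous_iff_continuousAt]
    intro z
    by_cases hz : z ∈ range j
    · obtain ⟨x, rfl⟩ := hz
      rw [Metric.continuousAt_iff]
      intro ε hε
      obtain ⟨n, hn⟩ := exists_pow_lt_of_lt_one hε (by norm_num : (1/2 : ℝ) < 1)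
      refine ⟨(1/2) ^ n / 30, by positivity, fun {w} hw => ?_⟩
      rw [hrj]
      refine (dist_lt_of_norm_sub_lt hΦ hs hf (n := n) ?_).trans hn
      have := hctrl x w
      rw [dist_eq_norm] at hw
      linarith
    · have hO : (range j)ᶜ ∈ 𝓝 z := hcl.isOpen_compl.mem_nhds hz
      have h5 : ContinuousOn (fun w => r₀ (g w)) (range j)ᶜ :=
        hr₀.comp hg fun w hw => convexHull_mono (image_subset_range _ _) (hgc w hw)
      refine (h5.continuousAt hO).congr ?_
      filter_upwards [hO] with w hw
      simp only [r, dif_neg (show w ∉ range j from hw)]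
  exact ⟨L, inferInstance, inferInstance, ⟨⟨j, r, Φ, hj, hrc, hrj, hctrl, hspan, hΦ, hs, hf⟩⟩⟩

/-- The subspace of finitely supported sequences in the Hilbert sum of copies of `M`. -/
def finSupp (M : Type) [NormedAddCommGroup M] [InnerProductSpace ℝ M] :
    Submodule ℝ (lp (fun _ : ℕ => M) 2) where
  carrier := {s | ∃ N, ∀ i ≥ N, s i = 0}
  zero_mem' := ⟨0, fun _ _ => rfl⟩
  add_mem' := by
    rintro s t ⟨N, hN⟩ ⟨N', hN'⟩
    refine ⟨max N N', fun i hi => ?_⟩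
    rw [lp.coeFn_add, Pi.add_apply, hN i (le_of_max_le_left hi), hN' i (le_of_max_le_right hi),
      add_zero]
  smul_mem' := by
    rintro c s ⟨N, hN⟩
    refine ⟨N, fun i hi => ?_⟩
    rw [lp.coeFn_smul, Pi.smul_apply, hN i hi, smul_zero]

/-- The pre-Hilbert space of finitely supported sequences in `M`. -/
noncomputable abbrev FS (M : Type) [NormedAddCommGroup M] [InnerProductSpace ℝ M] : Type :=
  finSupp M

namespace FS

variable {M : Type} [NormedAddCommGroup M] [InnerProductSpace ℝ M]
  {M' : Type} [NormedAddCommGroup M'] [InnerProductSpace ℝ M']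

theorem exists_bound (s : FS M) : ∃ N, ∀ i ≥ N, s.1 i = 0 := s.2

theorem ext' {s t : FS M} (h : ∀ i, s.1 i = t.1 i) : s = t :=
  Subtype.ext (lp.ext (funext h))

/-- The element of `FS M` with given coordinates. -/
def mk (f : ℕ → M) (hf : ∃ N, ∀ i ≥ N, f i = 0) : FS M :=
  ⟨⟨f, (memℓp_zero (by
    obtain ⟨N, hN⟩ := hf
    refine (finite_lt_nat N).subset fun i hi => ?_
    by_contra h
    exact hi (hN i (not_lt.1 h)))).of_exponent_ge (by simp)⟩, hf⟩

@[simp] theorem mk_apply (f : ℕ → M) (hf : ∃ N, ∀ i ≥ N, f i = 0) (i : ℕ) :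
    (mk f hf).1 i = f i := rfl

@[simp] theorem zero_apply (i : ℕ) : (0 : FS M).1 i = 0 := rfl

@[simp] theorem add_apply (s t : FS M) (i : ℕ) : (s + t).1 i = s.1 i + t.1 i := rfl

@[simp] theorem sub_apply (s t : FS M) (i : ℕ) : (s - t).1 i = s.1 i - t.1 i := rfl

@[simp] theorem neg_apply (s : FS M) (i : ℕ) : (-s).1 i = -s.1 i := rfl

@[simp] theorem smul_apply (c : ℝ) (s : FS M) (i : ℕ) : (c • s).1 i = c • s.1 i := rfl

theorem norm_apply_le (s : FS M) (i : ℕ) : ‖s.1 i‖ ≤ ‖s‖ :=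
  lp.norm_apply_le_norm (by norm_num) s.1 i

theorem norm_sq (s : FS M) {N : ℕ} (hN : ∀ i ≥ N, s.1 i = 0) :
    ‖s‖ ^ 2 = ∑ i ∈ Finset.range N, ‖s.1 i‖ ^ 2 := by
  have h : ‖s‖ ^ 2 = inner ℝ s.1 s.1 := (real_inner_self_eq_norm_sq (s.1)).symm
  rw [h, lp.inner_eq_tsum, tsum_eq_sum (s := Finset.range N)]
  · exact Finset.sum_congr rfl fun i _ => real_inner_self_eq_norm_sq _
  · intro i hi
    rw [hN i (by simpa using hi), inner_zero_left]

theorem sum_le (s : FS M) (N : ℕ) : ∑ i ∈ Finset.range N, ‖s.1 i‖ ^ 2 ≤ ‖s‖ ^ 2 := by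
  obtain ⟨K, hK⟩ := s.exists_bound
  rw [norm_sq s (N := max N K) fun i hi => hK i (le_of_max_le_right hi)]
  exact Finset.sum_le_sum_of_subset_of_nonneg (Finset.range_mono (le_max_left _ _))
    fun _ _ _ => by positivity

/-- The `i`-th coordinate as a continuous linear map. -/
noncomputable def coord (i : ℕ) : FS M →L[ℝ] M :=
  (lp.evalCLM ℝ (fun _ : ℕ => M) (p := 2) i).comp (finSupp M).subtypeL

@[simp] theorem coord_apply (i : ℕ) (s : FS M) : coord i s = s.1 i := rfl

theorem continuous_coord (i : ℕ) : Continuous fun s : FS M => s.1 i := (coord i).continuous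

/-- The embedding of `M` as the `n`-th coordinate. -/
def single (n : ℕ) (m : M) : FS M :=
  mk (fun i => if i = n then m else 0) ⟨n + 1, fun i hi => if_neg (by omega)⟩

theorem single_apply (n : ℕ) (m : M) (i : ℕ) : (single n m).1 i = if i = n then m else 0 := rfl

@[simp] theorem single_same (n : ℕ) (m : M) : (single n m).1 n = m := if_pos rfl

theorem single_ne {n i : ℕ} (h : i ≠ n) (m : M) : (single n m).1 i = 0 := if_neg h

@[simp] theorem single_zero (n : ℕ) : single n (0 : M) = 0 := ext' fun i => by
  simp [single_apply]

theorem norm_single (n : ℕ) (m : M) : ‖single n m‖ = ‖m‖ := by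
  have h := norm_sq (single n m) (N := n + 1) fun i hi => single_ne (by omega) m
  rw [Finset.sum_eq_single n (fun i _ hi => by rw [single_ne hi]; simp) (fun h => by simp at h),
    single_same] at h
  exact (sq_eq_sq₀ (norm_nonneg _) (norm_nonneg _)).1 h

theorem single_sub (n : ℕ) (a b : M) : single n (a - b) = single n a - single n b :=
  ext' fun i => by
    by_cases h : i = n
    · subst h; simp
    · simp [single_ne h]

theorem single_add (n : ℕ) (a b : M) : single n (a + b) = single n a + single n b :=
  ext' fun i => by
    by_cases h : i = n
    · subst h; simp
    · simp [single_ne h]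

theorem continuous_single (n : ℕ) : Continuous fun m : M => single n m :=
  (Isometry.of_dist_eq fun a b => by
    rw [dist_eq_norm, dist_eq_norm, ← single_sub, norm_single]).continuous

/-- The truncation to the first `n` coordinates. -/
noncomputable def trunc (n : ℕ) (s : FS M) : FS M := ∑ i ∈ Finset.range n, single i (s.1 i)

theorem continuous_trunc (n : ℕ) : Continuous fun s : FS M => trunc n s :=
  continuous_finsetSum _ fun i _ => (continuous_single i).comp (continuous_coord i)

theorem trunc_apply (n : ℕ) (s : FS M) (i : ℕ) :
    (trunc n s).1 i = if i < n then s.1 i else 0 := by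
  have h : (trunc n s).1 i = ∑ k ∈ Finset.range n, (single k (s.1 k)).1 i := by
    rw [← coord_apply, trunc, map_sum]; rfl
  rw [h]
  simp only [single_apply]
  rw [Finset.sum_ite_eq]
  simp

theorem norm_le_of_neighbors (h : FS M) (d : FS M') {C : ℝ} (hC : 0 ≤ C)
    (H : ∀ i, ‖h.1 i‖ ≤ C * (‖d.1 (i - 1)‖ + ‖d.1 i‖ + ‖d.1 (i + 1)‖)) :
    ‖h‖ ≤ 4 * C * ‖d‖ := by
  obtain ⟨N, hN⟩ := h.exists_bound
  have h1 := norm_sq h hN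
  have h2 : ∀ i, ‖h.1 i‖ ^ 2 ≤
      3 * C ^ 2 * (‖d.1 (i - 1)‖ ^ 2 + ‖d.1 i‖ ^ 2 + ‖d.1 (i + 1)‖ ^ 2) := by
    intro i
    have h3 := pow_le_pow_left₀ (norm_nonneg _) (H i) 2
    rw [mul_pow] at h3
    refine h3.trans ?_
    rw [mul_comm 3, mul_assoc]
    refine mul_le_mul_of_nonneg_left ?_ (sq_nonneg C)
    nlinarith [sq_nonneg (‖d.1 (i - 1)‖ - ‖d.1 i‖), sq_nonneg (‖d.1 (i - 1)‖ - ‖d.1 (i + 1)‖),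
      sq_nonneg (‖d.1 i‖ - ‖d.1 (i + 1)‖)]
  have h4 : ∑ i ∈ Finset.range N, ‖d.1 (i - 1)‖ ^ 2 ≤ 2 * ‖d‖ ^ 2 := by
    cases N with
    | zero => simp
    | succ N =>
      rw [Finset.sum_range_succ']
      have h5 := sum_le d N
      have h6 := pow_le_pow_left₀ (norm_nonneg _) (norm_apply_le d 0) 2
      simp only [Nat.add_sub_cancel, Nat.zero_sub]
      linarith
  have h5 := sum_le d N
  have h6 : ∑ i ∈ Finset.range N, ‖d.1 (i + 1)‖ ^ 2 ≤ ‖d‖ ^ 2 := by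
    have := sum_le d (N + 1)
    rw [Finset.sum_range_succ'] at this
    have h7 := sq_nonneg ‖d.1 0‖
    linarith
  have h7 : ‖h‖ ^ 2 ≤ 3 * C ^ 2 * (4 * ‖d‖ ^ 2) := by
    rw [h1]
    refine (Finset.sum_le_sum fun i _ => h2 i).trans ?_
    rw [← Finset.mul_sum, Finset.sum_add_distrib, Finset.sum_add_distrib]
    refine mul_le_mul_of_nonneg_left (by linarith) (by positivity)
  refine abs_le_of_sq_le_sq' ?_ (by positivity) |>.2
  nlinarith [mul_nonneg (sq_nonneg C) (sq_nonneg ‖d‖)]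

/-- A map into finitely supported sequences is continuous if it is coordinatewise continuous and
its coordinates are controlled by those of a continuous map. -/
theorem continuousAt_of_neighbors {A : Type*} [TopologicalSpace A] {f : A → FS M} {g : A → FS M'}
    {a₀ : A} {C : ℝ} (hC : 0 ≤ C) (hf : ∀ i, ContinuousAt (fun a => (f a).1 i) a₀)
    (hg : ContinuousAt g a₀)
    (H : ∀ a, ∀ i ≥ 1,
      ‖(f a).1 i‖ ≤ C * (‖(g a).1 (i - 1)‖ + ‖(g a).1 i‖ + ‖(g a).1 (i + 1)‖)) :
    ContinuousAt f a₀ := by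
  obtain ⟨N₁, hN₁⟩ := (f a₀).exists_bound
  obtain ⟨N₂, hN₂⟩ := (g a₀).exists_bound
  let N := max N₁ N₂ + 1
  have hb : ∀ a, ‖f a - f a₀‖ ≤ ‖trunc N (f a - f a₀)‖ + 4 * C * ‖g a - g a₀‖ := by
    intro a
    have h1 : f a - f a₀ = trunc N (f a - f a₀) + (f a - f a₀ - trunc N (f a - f a₀)) := by abel
    have h2 := norm_add_le (trunc N (f a - f a₀)) (f a - f a₀ - trunc N (f a - f a₀))
    rw [← h1] at h2
    refine h2.trans (add_le_add_right ?_ _)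
    refine norm_le_of_neighbors _ _ hC fun i => ?_
    rw [sub_apply, trunc_apply]
    split_ifs with hi
    · rw [sub_self, norm_zero]; positivity
    · have e1 : N₁ ≤ i := by omega
      have e2 : N₂ ≤ i - 1 := by omega
      rw [sub_apply, hN₁ i e1, sub_zero, sub_zero]
      simp only [sub_apply]
      rw [hN₂ _ e2, hN₂ i (by omega), hN₂ (i + 1) (by omega)]
      simp only [sub_zero]
      exact H a i (by omega)
  have ht : Tendsto (fun a => ‖trunc N (f a - f a₀)‖ + 4 * C * ‖g a - g a₀‖) (𝓝 a₀) (𝓝 0) := by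
    have h1 : Tendsto (fun a => trunc N (f a - f a₀)) (𝓝 a₀) (𝓝 0) := by
      have : Tendsto (fun a => trunc N (f a - f a₀)) (𝓝 a₀)
          (𝓝 (∑ i ∈ Finset.range N, (0 : FS M))) := by
        refine tendsto_finsetSum _ fun i _ => ?_
        have h3 : Tendsto (fun a => (f a - f a₀).1 i) (𝓝 a₀) (𝓝 0) := by
          have := (hf i).tendsto.sub_const ((f a₀).1 i)
          rwa [sub_self] at this
        have h4 := ((continuous_single (M := M) i).tendsto 0).comp h3
        rwa [single_zero] at h4
      simpa using this
    have h2 : Tendsto (fun a => g a - g a₀) (𝓝 a₀) (𝓝 0) := by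
      have := hg.tendsto.sub_const (g a₀)
      rwa [sub_self] at this
    simpa using h1.norm.add (h2.norm.const_mul (4 * C))
  exact tendsto_iff_norm_sub_tendsto_zero.2 (squeeze_zero (fun _ => norm_nonneg _) hb ht)

end FS

theorem two_pow_mul_half_pow (i : ℕ) : (2:ℝ) ^ i * (1/2) ^ i = 1 := by
  rw [← mul_pow]; norm_num

namespace HilbertFrame

variable {Y L : Type} [MetricSpace Y] [NormedAddCommGroup L] [InnerProductSpace ℝ L]
  (fr : HilbertFrame Y L)

theorem tendsto_of_tendsto_j {A : Type*} {l : Filter A} {f : A → Y} {y : Y}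
    (h : Tendsto (fun a => fr.j (f a)) l (𝓝 (fr.j y))) : Tendsto f l (𝓝 y) := by
  have := (fr.continuous_r.tendsto (fr.j y)).comp h
  rw [fr.r_j] at this
  exact this.congr fun a => fr.r_j _

/-- The orbit obtained from a sequence by successive retractions and small corrections. -/
noncomputable def fwdY (s : FS L) : ℕ → L
  | 0 => s.1 0
  | i + 1 => fr.j (fr.r (fwdY s i)) + (1/2 : ℝ) ^ (i + 1) • s.1 (i + 1)

theorem continuous_fwdY (i : ℕ) : Continuous fun s => fr.fwdY s i := by
  induction i with
  | zero => exact FS.continuous_coord 0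
  | succ i ih =>
    exact (fr.continuous_j.comp (fr.continuous_r.comp ih)).add
      ((FS.continuous_coord (i + 1)).fun_const_smul _)

theorem r_fwdY_eq {s : FS L} {N : ℕ} (hN : ∀ i ≥ N, s.1 i = 0) {i : ℕ} (hi : N ≤ i) :
    fr.r (fr.fwdY s i) = fr.r (fr.fwdY s N) := by
  induction i, hi using Nat.le_induction with
  | base => rfl
  | succ i hi ih => rw [fwdY, hN _ (by omega), smul_zero, add_zero, fr.r_j, ih]

/-- The eventual value of the orbit. -/
noncomputable def fwdX (s : FS L) : Y := fr.r (fr.fwdY s s.exists_bound.choose)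

theorem fwdX_eq {s : FS L} {N : ℕ} (hN : ∀ i ≥ N, s.1 i = 0) {i : ℕ} (hi : N ≤ i) :
    fr.fwdX s = fr.r (fr.fwdY s i) := by
  rw [fwdX, ← fr.r_fwdY_eq s.exists_bound.choose_spec (le_max_left _ i),
    fr.r_fwdY_eq hN (hi.trans (le_max_right _ i)), fr.r_fwdY_eq hN hi]

theorem fwdY_eq {s : FS L} {N : ℕ} (hN : ∀ i ≥ N, s.1 i = 0) {i : ℕ} (hi : N < i) :
    fr.fwdY s i = fr.j (fr.fwdX s) := by
  obtain ⟨i, rfl⟩ := Nat.exists_eq_succ_of_ne_zero (by omega : i ≠ 0)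
  rw [Nat.succ_eq_add_one, fwdY, hN _ (by omega), smul_zero, add_zero,
    fr.fwdX_eq hN (i := i) (by omega)]

/-- The remainder sequence of the orbit. -/
noncomputable def fwdS (s : FS L) : FS L :=
  FS.mk (fun i => (2:ℝ) ^ i • (fr.fwdY s i - fr.j (fr.r (fr.fwdY s (i + 1))))) <| by
    obtain ⟨N, hN⟩ := s.exists_bound
    refine ⟨N + 1, fun i hi => ?_⟩
    rw [fr.fwdY_eq hN (by omega), fr.fwdY_eq hN (by omega), fr.r_j, sub_self, smul_zero]

theorem fwdY_eq_add (s : FS L) (i : ℕ) :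
    fr.fwdY s i = fr.j (fr.r (fr.fwdY s (i + 1))) + (1/2 : ℝ) ^ i • (fr.fwdS s).1 i := by
  rw [fwdS, FS.mk_apply, smul_smul, mul_comm, two_pow_mul_half_pow, one_smul]; abel

theorem norm_fwd_step (s : FS L) (i : ℕ) :
    ‖fr.j (fr.r (fr.fwdY s (i + 1))) - fr.j (fr.r (fr.fwdY s i))‖ ≤
      30 * ((1/2) ^ (i + 1) * ‖s.1 (i + 1)‖) := by
  have h := fr.control (fr.r (fr.fwdY s i)) (fr.fwdY s (i + 1))
  refine h.trans (le_of_eq ?_)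
  rw [fwdY, add_sub_cancel_left, norm_smul, norm_pow]
  norm_num

theorem norm_fwdS_le (s : FS L) (i : ℕ) (hi : 1 ≤ i) :
    ‖(fr.fwdS s).1 i‖ ≤ 31 * (‖s.1 (i - 1)‖ + ‖s.1 i‖ + ‖s.1 (i + 1)‖) := by
  obtain ⟨i, rfl⟩ := Nat.exists_eq_succ_of_ne_zero (by omega : i ≠ 0)
  simp only [Nat.succ_eq_add_one, Nat.add_sub_cancel]
  have h1 := fr.norm_fwd_step s i
  have h2 := fr.norm_fwd_step s (i + 1)
  have h3 : ‖fr.fwdY s (i + 1) - fr.j (fr.r (fr.fwdY s i))‖ = (1/2) ^ (i + 1) * ‖s.1 (i + 1)‖ := by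
    rw [fwdY, add_sub_cancel_left, norm_smul, norm_pow]; norm_num
  have h4 : ‖fr.fwdY s (i + 1) - fr.j (fr.r (fr.fwdY s (i + 1 + 1)))‖ ≤
      (1/2) ^ (i + 1) * (31 * ‖s.1 (i + 1)‖ + 15 * ‖s.1 (i + 1 + 1)‖) := by
    rw [norm_sub_rev] at h1 h2
    have := norm_sub_le_norm_sub_add_norm_sub (fr.fwdY s (i + 1)) (fr.j (fr.r (fr.fwdY s i)))
      (fr.j (fr.r (fr.fwdY s (i + 1 + 1))))
    have := norm_sub_le_norm_sub_add_norm_sub (fr.j (fr.r (fr.fwdY s i)))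
      (fr.j (fr.r (fr.fwdY s (i + 1)))) (fr.j (fr.r (fr.fwdY s (i + 1 + 1))))
    rw [pow_succ _ (i + 1)] at h2
    linarith
  rw [fwdS, FS.mk_apply, norm_smul, norm_pow, Real.norm_ofNat]
  have h5 := mul_le_mul_of_nonneg_left h4 (by positivity : (0:ℝ) ≤ 2 ^ (i + 1))
  rw [← mul_assoc, two_pow_mul_half_pow, one_mul] at h5
  linarith [norm_nonneg (s.1 i), norm_nonneg (s.1 (i + 1)), norm_nonneg (s.1 (i + 1 + 1))]

theorem continuous_fwdS : Continuous fr.fwdS :=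
  continuous_iff_continuousAt.2 fun s₀ =>
    FS.continuousAt_of_neighbors (g := id) (by norm_num)
      (fun i => (((fr.continuous_fwdY i).sub (fr.continuous_j.comp (fr.continuous_r.comp
        (fr.continuous_fwdY (i + 1))))).fun_const_smul _).continuousAt)
      continuousAt_id fr.norm_fwdS_le

theorem continuous_fwdX : Continuous fr.fwdX := by
  refine continuous_iff_continuousAt.2 fun s₀ => fr.tendsto_of_tendsto_j ?_
  obtain ⟨N, hN⟩ := s₀.exists_bound
  have hb : ∀ s k, ‖fr.j (fr.r (fr.fwdY s (N + k))) - fr.j (fr.r (fr.fwdY s N))‖ ≤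
      30 * ‖s - s₀‖ * (1 - (1/2) ^ k) := by
    intro s k
    induction k with
    | zero => simp
    | succ k ih =>
      have h1 := fr.norm_fwd_step s (N + k)
      have h2 : ‖s.1 (N + k + 1)‖ ≤ ‖s - s₀‖ := by
        have := FS.norm_apply_le (s - s₀) (N + k + 1)
        rwa [FS.sub_apply, hN _ (by omega), sub_zero] at this
      have h3 : (1/2 : ℝ) ^ (N + k + 1) ≤ (1/2) ^ (k + 1) :=
        pow_le_pow_of_le_one (by norm_num) (by norm_num) (by omega)
      have h4 : (1/2 : ℝ) ^ (N + k + 1) * ‖s.1 (N + k + 1)‖ ≤ (1/2) ^ (k + 1) * ‖s - s₀‖ :=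
        mul_le_mul h3 h2 (norm_nonneg _) (by positivity)
      have h5 := norm_sub_le_norm_sub_add_norm_sub (fr.j (fr.r (fr.fwdY s (N + (k + 1)))))
        (fr.j (fr.r (fr.fwdY s (N + k)))) (fr.j (fr.r (fr.fwdY s N)))
      rw [← add_assoc] at h5 ⊢
      rw [pow_succ _ k] at h4 ⊢
      nlinarith
  have hb' : ∀ s, ‖fr.j (fr.fwdX s) - fr.j (fr.r (fr.fwdY s N))‖ ≤ 30 * ‖s - s₀‖ := by
    intro s
    obtain ⟨K, hK⟩ := s.exists_bound
    rw [fr.fwdX_eq hK (Nat.le_add_left K N)]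
    refine (hb s K).trans ?_
    have : (0:ℝ) ≤ (1/2) ^ K := by positivity
    nlinarith [norm_nonneg (s - s₀)]
  have h1 : Tendsto (fun s => fr.j (fr.r (fr.fwdY s N))) (𝓝 s₀) (𝓝 (fr.j (fr.fwdX s₀))) := by
    rw [fr.fwdX_eq hN le_rfl]
    exact (fr.continuous_j.comp (fr.continuous_r.comp (fr.continuous_fwdY N))).tendsto _
  have h2 : Tendsto (fun s => fr.j (fr.fwdX s) - fr.j (fr.r (fr.fwdY s N))) (𝓝 s₀) (𝓝 0) := by
    refine squeeze_zero_norm hb' ?_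
    have : Tendsto (fun s : FS L => 30 * ‖s - s₀‖) (𝓝 s₀) (𝓝 (30 * ‖s₀ - s₀‖)) :=
      Continuous.tendsto (by fun_prop) _
    simpa using this
  simpa using h2.add h1

/-- Finite backward orbits. -/
noncomputable def bwdAux (a : Y × FS L) : ℕ → ℕ → L
  | 0, _ => fr.j a.1
  | k + 1, i => fr.j (fr.r (bwdAux a k (i + 1))) + (1/2 : ℝ) ^ i • a.2.1 i

theorem bwdAux_succ {a : Y × FS L} {N : ℕ} (hN : ∀ i ≥ N, a.2.1 i = 0) (k i : ℕ)
    (h : N ≤ k + i) : fr.bwdAux a (k + 1) i = fr.bwdAux a k i := by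
  induction k generalizing i with
  | zero =>
    change fr.j (fr.r (fr.j a.1)) + (1/2 : ℝ) ^ i • a.2.1 i = fr.j a.1
    rw [fr.r_j, hN i (by omega), smul_zero, add_zero]
  | succ k ih => rw [bwdAux, ih (i + 1) (by omega), ← bwdAux]

theorem bwdAux_add {a : Y × FS L} {N : ℕ} (hN : ∀ i ≥ N, a.2.1 i = 0) (k i : ℕ)
    (h : N ≤ k + i) (l : ℕ) : fr.bwdAux a (k + l) i = fr.bwdAux a k i := by
  induction l with
  | zero => rfl
  | succ l ih => rw [← add_assoc, fr.bwdAux_succ hN _ _ (by omega), ih]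

/-- The backward orbit. -/
noncomputable def bwdY (a : Y × FS L) (i : ℕ) : L := fr.bwdAux a a.2.exists_bound.choose i

theorem bwdY_eq_aux {a : Y × FS L} {N : ℕ} (hN : ∀ i ≥ N, a.2.1 i = 0) {k i : ℕ}
    (h : N ≤ k + i) : fr.bwdY a i = fr.bwdAux a k i := by
  rw [bwdY, ← fr.bwdAux_add a.2.exists_bound.choose_spec _ i (by omega) k, add_comm _ k,
    fr.bwdAux_add hN k i h]

theorem bwdY_eq {a : Y × FS L} {N : ℕ} (hN : ∀ i ≥ N, a.2.1 i = 0) {i : ℕ}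
    (h : N ≤ i) : fr.bwdY a i = fr.j a.1 := by
  rw [fr.bwdY_eq_aux hN (k := 0) (by omega), bwdAux]

theorem bwdY_eq_add (a : Y × FS L) (i : ℕ) :
    fr.bwdY a i = fr.j (fr.r (fr.bwdY a (i + 1))) + (1/2 : ℝ) ^ i • a.2.1 i := by
  obtain ⟨N, hN⟩ := a.2.exists_bound
  rw [fr.bwdY_eq_aux hN (k := N + 1) (by omega), fr.bwdY_eq_aux hN (k := N) (by omega), bwdAux]

theorem bwdY_unique {a : Y × FS L} {y : ℕ → L}
    (h : ∀ i, y i = fr.j (fr.r (y (i + 1))) + (1/2 : ℝ) ^ i • a.2.1 i)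
    (hN : ∃ N, ∀ i ≥ N, y i = fr.j a.1) : fr.bwdY a = y := by
  obtain ⟨N, hN⟩ := hN
  obtain ⟨K, hK⟩ := a.2.exists_bound
  have : ∀ k i, max N K ≤ i + k → fr.bwdY a i = y i := by
    intro k
    induction k with
    | zero => intro i hi; rw [hN i (by omega), fr.bwdY_eq hK (by omega)]
    | succ k ih => intro i hi; rw [h, fr.bwdY_eq_add, ih (i + 1) (by omega)]
  exact funext fun i => this (max N K) i (by omega)

/-- The sequence whose forward orbit is the given backward orbit. -/
noncomputable def bwdS (a : Y × FS L) : FS L :=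
  FS.mk (fun i => if i = 0 then fr.bwdY a 0 else
    (2:ℝ) ^ i • (fr.bwdY a i - fr.j (fr.r (fr.bwdY a (i - 1))))) <| by
    obtain ⟨N, hN⟩ := a.2.exists_bound
    refine ⟨N + 1, fun i hi => ?_⟩
    rw [if_neg (by omega), fr.bwdY_eq hN (by omega), fr.bwdY_eq hN (by omega), fr.r_j,
      sub_self, smul_zero]

theorem bwdS_zero (a : Y × FS L) : (fr.bwdS a).1 0 = fr.bwdY a 0 := by simp [bwdS]

theorem bwdS_succ (a : Y × FS L) (i : ℕ) : (fr.bwdS a).1 (i + 1) =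
    (2:ℝ) ^ (i + 1) • (fr.bwdY a (i + 1) - fr.j (fr.r (fr.bwdY a i))) := by
  simp [bwdS]

theorem fwdY_bwdS (a : Y × FS L) (i : ℕ) : fr.fwdY (fr.bwdS a) i = fr.bwdY a i := by
  induction i with
  | zero => rw [fwdY, bwdS_zero]
  | succ i ih =>
    rw [fwdY, ih, bwdS_succ, smul_smul, mul_comm, two_pow_mul_half_pow, one_smul]; abel

theorem fwdX_bwdS (a : Y × FS L) : fr.fwdX (fr.bwdS a) = a.1 := by
  obtain ⟨N, hN⟩ := a.2.exists_bound
  obtain ⟨K, hK⟩ := (fr.bwdS a).exists_bound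
  rw [fr.fwdX_eq hK (Nat.le_add_left K N), fr.fwdY_bwdS, fr.bwdY_eq hN (by omega), fr.r_j]

theorem fwdS_bwdS (a : Y × FS L) : fr.fwdS (fr.bwdS a) = a.2 := FS.ext' fun i => by
  have h := fr.bwdY_eq_add a i
  rw [fwdS, FS.mk_apply, fr.fwdY_bwdS, fr.fwdY_bwdS, h, add_sub_cancel_left, smul_smul,
    two_pow_mul_half_pow, one_smul]

theorem bwdY_fwd (s : FS L) : fr.bwdY (fr.fwdX s, fr.fwdS s) = fr.fwdY s :=
  fr.bwdY_unique (fr.fwdY_eq_add s) <| by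
    obtain ⟨N, hN⟩ := s.exists_bound
    exact ⟨N + 1, fun i hi => fr.fwdY_eq hN (by omega)⟩

theorem bwdS_fwd (s : FS L) : fr.bwdS (fr.fwdX s, fr.fwdS s) = s := FS.ext' fun i => by
  cases i with
  | zero => rw [bwdS_zero, bwdY_fwd, fwdY]
  | succ i =>
    rw [bwdS_succ, bwdY_fwd, fwdY, add_sub_cancel_left, smul_smul, two_pow_mul_half_pow, one_smul]

theorem norm_bwd_step (a : Y × FS L) (i : ℕ) :
    ‖fr.j (fr.r (fr.bwdY a i)) - fr.j (fr.r (fr.bwdY a (i + 1)))‖ ≤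
      30 * ((1/2) ^ i * ‖a.2.1 i‖) := by
  have h := fr.control (fr.r (fr.bwdY a (i + 1))) (fr.bwdY a i)
  refine h.trans (le_of_eq ?_)
  rw [fr.bwdY_eq_add a i, add_sub_cancel_left, norm_smul, norm_pow]
  norm_num

theorem norm_bwdS_le (a : Y × FS L) (i : ℕ) (hi : 1 ≤ i) :
    ‖(fr.bwdS a).1 i‖ ≤ 60 * (‖a.2.1 (i - 1)‖ + ‖a.2.1 i‖ + ‖a.2.1 (i + 1)‖) := by
  obtain ⟨i, rfl⟩ := Nat.exists_eq_succ_of_ne_zero (by omega : i ≠ 0)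
  simp only [Nat.succ_eq_add_one, Nat.add_sub_cancel]
  have h1 := fr.norm_bwd_step a i
  have h2 := fr.norm_bwd_step a (i + 1)
  have h3 : ‖fr.bwdY a (i + 1) - fr.j (fr.r (fr.bwdY a (i + 1 + 1)))‖ =
      (1/2) ^ (i + 1) * ‖a.2.1 (i + 1)‖ := by
    rw [fr.bwdY_eq_add a (i + 1), add_sub_cancel_left, norm_smul, norm_pow]; norm_num
  have h4 : ‖fr.bwdY a (i + 1) - fr.j (fr.r (fr.bwdY a i))‖ ≤
      (1/2) ^ (i + 1) * (31 * ‖a.2.1 (i + 1)‖ + 60 * ‖a.2.1 i‖) := by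
    rw [norm_sub_rev] at h1 h2
    have := norm_sub_le_norm_sub_add_norm_sub (fr.bwdY a (i + 1))
      (fr.j (fr.r (fr.bwdY a (i + 1 + 1)))) (fr.j (fr.r (fr.bwdY a i)))
    have := norm_sub_le_norm_sub_add_norm_sub (fr.j (fr.r (fr.bwdY a (i + 1 + 1))))
      (fr.j (fr.r (fr.bwdY a (i + 1)))) (fr.j (fr.r (fr.bwdY a i)))
    rw [pow_succ] at *
    linarith
  rw [bwdS_succ, norm_smul, norm_pow, Real.norm_ofNat]
  have h5 := mul_le_mul_of_nonneg_left h4 (by positivity : (0:ℝ) ≤ 2 ^ (i + 1))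
  rw [← mul_assoc, two_pow_mul_half_pow, one_mul] at h5
  linarith [norm_nonneg (a.2.1 i), norm_nonneg (a.2.1 (i + 1)), norm_nonneg (a.2.1 (i + 1 + 1))]

theorem continuous_bwdY (i : ℕ) : Continuous fun a => fr.bwdY a i := by
  refine continuous_iff_continuousAt.2 fun a₀ => ?_
  obtain ⟨N, hN⟩ := a₀.2.exists_bound
  have hd : ∀ (a : Y × FS L) i, N ≤ i → ‖a.2.1 i‖ ≤ ‖a.2 - a₀.2‖ := by
    intro a i hi
    have := FS.norm_apply_le (a.2 - a₀.2) i
    rwa [FS.sub_apply, hN _ hi, sub_zero] at this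
  have hb : ∀ (a : Y × FS L) i, N ≤ i →
      ‖fr.j (fr.r (fr.bwdY a i)) - fr.j a.1‖ ≤ 60 * ((1/2) ^ i * ‖a.2 - a₀.2‖) := by
    intro a
    obtain ⟨K, hK⟩ := a.2.exists_bound
    have : ∀ k i, K ≤ i + k → N ≤ i →
        ‖fr.j (fr.r (fr.bwdY a i)) - fr.j a.1‖ ≤ 60 * ((1/2) ^ i * ‖a.2 - a₀.2‖) := by
      intro k
      induction k with
      | zero =>
        intro i hi _
        rw [fr.bwdY_eq hK (by omega), fr.r_j, sub_self, norm_zero]; positivity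
      | succ k ih =>
        intro i hi hNi
        have h1 := ih (i + 1) (by omega) (by omega)
        have h2 := fr.norm_bwd_step a i
        have h3 := mul_le_mul_of_nonneg_left (hd a i hNi) (by positivity : (0:ℝ) ≤ (1/2) ^ i)
        have := norm_sub_le_norm_sub_add_norm_sub (fr.j (fr.r (fr.bwdY a i)))
          (fr.j (fr.r (fr.bwdY a (i + 1)))) (fr.j a.1)
        rw [pow_succ] at h1
        linarith
    exact fun i => this K i (by omega)
  have htail : ∀ i ≥ N, ContinuousAt (fun a => fr.bwdY a i) a₀ := by
    intro i hi
    have hb' : ∀ a : Y × FS L, ‖fr.bwdY a i - fr.j a.1‖ ≤ 61 * ‖a.2 - a₀.2‖ := by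
      intro a
      have h1 := hb a (i + 1) (by omega)
      have h2 := hd a i hi
      have h3 := norm_add_le (fr.j (fr.r (fr.bwdY a (i + 1))) - fr.j a.1)
        ((1/2 : ℝ) ^ i • a.2.1 i)
      rw [norm_smul, norm_pow, show ‖(1/2 : ℝ)‖ = 1/2 by norm_num] at h3
      have h4 : fr.bwdY a i - fr.j a.1 =
          fr.j (fr.r (fr.bwdY a (i + 1))) - fr.j a.1 + (1/2 : ℝ) ^ i • a.2.1 i := by
        rw [fr.bwdY_eq_add a i]; abel
      have h5 : (1/2 : ℝ) ^ i ≤ 1 := pow_le_one₀ (by norm_num) (by norm_num)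
      have h6 : (1/2 : ℝ) ^ (i + 1) ≤ 1 := pow_le_one₀ (by norm_num) (by norm_num)
      rw [h4]
      nlinarith [norm_nonneg (a.2.1 i), norm_nonneg (a.2 - a₀.2)]
    have h2 : Tendsto (fun a => fr.bwdY a i - fr.j a.1) (𝓝 a₀) (𝓝 0) := by
      refine squeeze_zero_norm hb' ?_
      have : Tendsto (fun a : Y × FS L => 61 * ‖a.2 - a₀.2‖) (𝓝 a₀) (𝓝 (61 * ‖a₀.2 - a₀.2‖)) :=
        Continuous.tendsto (by fun_prop) _
      simpa using this
    have h3 : Tendsto (fun a : Y × FS L => fr.j a.1) (𝓝 a₀) (𝓝 (fr.j a₀.1)) :=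
      (fr.continuous_j.comp continuous_fst).tendsto _
    have h4 := h2.add h3
    rw [ContinuousAt, fr.bwdY_eq hN hi]
    simpa using h4
  have : ∀ k i, N ≤ i + k → ContinuousAt (fun a => fr.bwdY a i) a₀ := by
    intro k
    induction k with
    | zero => exact fun i hi => htail i hi
    | succ k ih =>
      intro i hi
      have h1 := ih (i + 1) (by omega)
      have h2 : ContinuousAt (fun a => fr.j (fr.r (fr.bwdY a (i + 1))) +
          (1/2 : ℝ) ^ i • a.2.1 i) a₀ :=
        ((fr.continuous_j.comp fr.continuous_r).continuousAt.comp
          (f := fun a => fr.bwdY a (i + 1)) h1).add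
          (((FS.continuous_coord i).comp continuous_snd).fun_const_smul _).continuousAt
      refine h2.congr (Eventually.of_forall fun a => (fr.bwdY_eq_add a i).symm)
  exact this N i (by omega)

theorem continuous_bwdS : Continuous fr.bwdS := by
  refine continuous_iff_continuousAt.2 fun a₀ =>
    FS.continuousAt_of_neighbors (g := fun a : Y × FS L => a.2) (C := 60) (by norm_num) ?_
      continuous_snd.continuousAt fr.norm_bwdS_le
  intro i
  cases i with
  | zero => exact (fr.continuous_bwdY 0).continuousAt
  | succ i =>
    exact (((fr.continuous_bwdY (i + 1)).sub (fr.continuous_j.comp (fr.continuous_r.comp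
        (fr.continuous_bwdY i)))).fun_const_smul _).continuousAt

/-- The space of finitely supported sequences absorbs the retract `Y` as a factor. -/
noncomputable def factorHomeomorph : FS L ≃ₜ Y × FS L where
  toFun s := (fr.fwdX s, fr.fwdS s)
  invFun := fr.bwdS
  left_inv := fr.bwdS_fwd
  right_inv a := Prod.ext (fr.fwdX_bwdS a) (fr.fwdS_bwdS a)
  continuous_toFun := fr.continuous_fwdX.prodMk fr.continuous_fwdS
  continuous_invFun := fr.continuous_bwdS

theorem exists_pointed_factor (fr : HilbertFrame Y L) (b : Y) :
    ∃ h : FS L ≃ₜ Y × FS L, h 0 = (b, 0) := by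
  refine ⟨(Homeomorph.addRight (fr.factorHomeomorph.symm (b, 0))).trans fr.factorHomeomorph, ?_⟩
  simp

end HilbertFrame

section Coding

variable {Y : Type} [TopologicalSpace Y] {b : Y} (ω : WeakProd Y b ≃ₜ Y)

open Classical in
/-- The sequence `y` with all entries from index `N` on replaced by the base point. -/
noncomputable def weakTrunc (b : Y) (N : ℕ) (y : ℕ → Y) : WeakProd Y b :=
  ⟨fun i => if i < N then y i else b, (finite_lt_nat N).subset fun i hi => by
    by_contra h
    exact hi (if_neg h)⟩

/-- Coding of the first `N` terms of a sequence by a single point. -/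
noncomputable def encodeSeq (N : ℕ) (y : ℕ → Y) : Y := ω (weakTrunc b N y)

/-- Decoding of a point as a sequence. -/
def decodeSeq (y : Y) (i : ℕ) : Y := (ω.symm y).1 i

theorem decodeSeq_encodeSeq {N i : ℕ} (h : i < N) (y : ℕ → Y) :
    decodeSeq ω (encodeSeq ω N y) i = y i := by
  rw [decodeSeq, encodeSeq, ω.symm_apply_apply, weakTrunc]
  exact if_pos h

theorem continuous_decodeSeq (i : ℕ) : Continuous fun y => decodeSeq ω y i :=
  (continuous_apply i).comp (continuous_subtype_val.comp ω.symm.continuous)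

theorem continuous_encodeSeq {A : Type*} [TopologicalSpace A] (N : ℕ) {f : A → ℕ → Y}
    (hf : ∀ i < N, Continuous fun a => f a i) : Continuous fun a => encodeSeq ω N (f a) := by
  refine ω.continuous.comp (Continuous.subtype_mk (continuous_pi fun i => ?_) _)
  by_cases h : i < N
  · simpa [h] using hf i h
  · simpa [h] using continuous_const

end Coding

/-- `M` is a countable union of sets on each of which the identity factors through `Y`, with both
factors globally defined and continuous. -/
def IsSliced (Y M : Type) [TopologicalSpace Y] [TopologicalSpace M] : Prop :=
  ∃ (v : ℕ → M → Y) (ψ : ℕ → Y → M), (∀ i, Continuous (v i)) ∧ (∀ i, Continuous (ψ i)) ∧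
    ∀ m, ∃ i, ψ i (v i m) = m

theorem IsSliced.of_countable {Y M ι : Type} [TopologicalSpace Y] [TopologicalSpace M]
    [Countable ι] [Nonempty ι] {v : ι → M → Y} {ψ : ι → Y → M} (hv : ∀ i, Continuous (v i))
    (hψ : ∀ i, Continuous (ψ i)) (h : ∀ m, ∃ i, ψ i (v i m) = m) : IsSliced Y M := by
  obtain ⟨f, hf⟩ := exists_surjective_nat ι
  refine ⟨fun i => v (f i), fun i => ψ (f i), fun i => hv _, fun i => hψ _, fun m => ?_⟩
  obtain ⟨i, hi⟩ := h m
  obtain ⟨n, rfl⟩ := hf i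
  exact ⟨n, hi⟩

theorem IsSliced.finSupp {Y M : Type} [TopologicalSpace Y] [NormedAddCommGroup M]
    [InnerProductSpace ℝ M] {b : Y} (ω : WeakProd Y b ≃ₜ Y) (h : IsSliced Y M) :
    IsSliced Y (FS M) := by
  obtain ⟨v, ψ, hv, hψ, hs⟩ := h
  refine IsSliced.of_countable (ι := List ℕ)
    (v := fun l s => encodeSeq ω l.length fun i => v (l.getD i 0) (s.1 i))
    (ψ := fun l y => ∑ i ∈ Finset.range l.length,
      FS.single i (ψ (l.getD i 0) (decodeSeq ω y i))) ?_ ?_ ?_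
  · exact fun l => continuous_encodeSeq ω _ fun i _ => (hv _).comp (FS.continuous_coord i)
  · exact fun l => continuous_finsetSum _ fun i _ =>
      (FS.continuous_single i).comp ((hψ _).comp (continuous_decodeSeq ω i))
  · intro s
    obtain ⟨N, hN⟩ := s.exists_bound
    choose c hc using fun i => hs (s.1 i)
    refine ⟨(List.range N).map c, ?_⟩
    have h1 : ∑ i ∈ Finset.range ((List.range N).map c).length,
        FS.single i (ψ (((List.range N).map c).getD i 0) (decodeSeq ω
          (encodeSeq ω ((List.range N).map c).length
            fun i => v (((List.range N).map c).getD i 0) (s.1 i)) i)) = FS.trunc N s := by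
      have hl : ((List.range N).map c).length = N := by simp
      rw [FS.trunc, hl]
      refine Finset.sum_congr rfl fun i hi => ?_
      have hi' : i < N := Finset.mem_range.1 hi
      rw [decodeSeq_encodeSeq ω hi']
      have : ((List.range N).map c).getD i 0 = c i := by simp [hi']
      rw [this, hc]
    rw [h1]
    refine FS.ext' fun i => ?_
    rw [FS.trunc_apply]
    split_ifs with hi
    · rfl
    · exact (hN i (not_lt.1 hi)).symm

/-- A Stone-type decomposition: points can be labelled by a linearly ordered set, with nearby
labels only for nearby points, so that the labelling is uniformly locally constant on each member
of an increasing closed cover. -/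
theorem exists_stone_labelling (Y : Type) [MetricSpace Y] {ε : ℝ} (hε : 0 < ε) :
    ∃ (T : Type) (_ : LinearOrder T) (t : Y → T) (B : ℕ → Set Y),
      (∀ x y, t x = t y → dist x y < ε) ∧ (∀ n, IsClosed (B n)) ∧ Monotone B ∧
      (∀ x, ∃ n, x ∈ B n) ∧
      ∀ n, ∀ x ∈ B n, ∃ δ > 0, ∀ y ∈ B n, dist x y < δ → t x = t y := by
  obtain ⟨lo, wf⟩ := exists_wellFoundedLT Y
  have hne : ∀ x : Y, {i : Y | dist i x < ε / 2}.Nonempty := fun x =>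
    ⟨x, by change dist x x < ε / 2; rw [dist_self]; positivity⟩
  let t : Y → Y := fun x => wellFounded_lt.min {i : Y | dist i x < ε / 2} (hne x)
  have ht : ∀ x, dist (t x) x < ε / 2 := fun x => wellFounded_lt.min_mem _ (hne x)
  have hle : ∀ x i, dist i x < ε / 2 → t x ≤ i := fun x i hi =>
    not_lt.1 (WellFounded.not_lt_min (wellFounded_lt (α := Y)) (s := {i : Y | dist i x < ε / 2}) hi)
  let B : ℕ → Set Y := fun n =>
    {x | Metric.ball x (1 / (n + 1 : ℝ)) ⊆ Metric.ball (t x) (ε / 2)}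
  have hpos : ∀ n : ℕ, (0:ℝ) < 1 / (n + 1 : ℝ) := fun n => Nat.one_div_pos_of_nat
  have hloc : ∀ n, ∀ x ∈ B n, ∀ y, dist x y < 1 / (n + 1 : ℝ) → t y ≤ t x := by
    intro n x hx y hxy
    have : y ∈ Metric.ball (t x) (ε / 2) := hx (by rwa [Metric.mem_ball, dist_comm])
    rw [Metric.mem_ball, dist_comm] at this
    exact hle _ _ this
  refine ⟨Y, lo, t, B, ?_, ?_, ?_, ?_, ?_⟩
  · intro x y hxy
    have h1 := ht x
    have h2 := ht y
    rw [← hxy] at h2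
    linarith [dist_triangle_left x y (t x)]
  · intro n
    refine isClosed_of_closure_subset fun x hx y hy => ?_
    rw [Metric.mem_ball] at hy ⊢
    obtain ⟨x', hx', hd⟩ := Metric.mem_closure_iff.1 hx
      (min (1 / (n + 1 : ℝ) - dist y x) (ε / 2 - dist (t x) x))
      (lt_min (by linarith) (by linarith [ht x]))
    have hd1 := hd.trans_le (min_le_left _ _)
    have hd2 := hd.trans_le (min_le_right _ _)
    have e1 : t x' ≤ t x := hle _ _ (by linarith [dist_triangle (t x) x x'])
    have e2 : t x ≤ t x' := hloc n x' hx' x (by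
      rw [dist_comm]; linarith [dist_nonneg (x := y) (y := x)])
    have e3 : y ∈ Metric.ball (t x') (ε / 2) := hx' (by
      rw [Metric.mem_ball]; linarith [dist_triangle y x x'])
    rwa [le_antisymm e1 e2, Metric.mem_ball] at e3
  · intro n m hnm x hx
    refine (Metric.ball_subset_ball ?_).trans hx
    exact one_div_le_one_div_of_le (by positivity) (by exact_mod_cast Nat.succ_le_succ hnm)
  · intro x
    obtain ⟨n, hn⟩ := exists_nat_one_div_lt (sub_pos.2 (ht x))
    refine ⟨n, fun y hy => ?_⟩
    rw [Metric.mem_ball] at hy ⊢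
    rw [dist_comm] at hn
    linarith [dist_triangle y x (t x), dist_comm x (t x)]
  · exact fun n x hx => ⟨_, hpos n, fun y hy hxy =>
      le_antisymm (hloc n y hy x (by rwa [dist_comm])) (hloc n x hx y hxy)⟩

namespace HilbertFrame

variable {Y L : Type} [MetricSpace Y] [NormedAddCommGroup L] [InnerProductSpace ℝ L]

/-- The combination of frame vectors with given coefficients. -/
noncomputable def comb (fr : HilbertFrame Y L) (N : ℕ) (p : (Fin N → ℝ) × (Fin N → Y)) : L :=
  ∑ i, p.1 i • fr.j (p.2 i)

theorem continuous_comb (fr : HilbertFrame Y L) (N : ℕ) : Continuous (fr.comb N) :=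
  continuous_finsetSum _ fun i _ => ((continuous_apply i).comp continuous_fst).smul
    (fr.continuous_j.comp ((continuous_apply i).comp continuous_snd))

/-- Coefficients bounded away from zero and infinity, and separated points in increasing order of
their labels. -/
def pieceDom {T : Type} [LinearOrder T] (t : Y → T) (B : Set Y) (N k : ℕ) :
    Set ((Fin N → ℝ) × (Fin N → Y)) :=
  {p | (∀ i, (1/2) ^ k ≤ |p.1 i| ∧ |p.1 i| ≤ 2 ^ k) ∧ (∀ i, p.2 i ∈ B) ∧
    (∀ i l, i < l → t (p.2 i) < t (p.2 l)) ∧ ∀ i l, i ≠ l → (1/2) ^ k ≤ dist (p.2 i) (p.2 l)}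

variable {T : Type} [LinearOrder T] {t : Y → T} {B : Set Y} {N k : ℕ}

theorem isClosed_pieceDom (hB : IsClosed B)
    (ht : ∀ x ∈ B, ∃ δ > 0, ∀ y ∈ B, dist x y < δ → t x = t y) :
    IsClosed (pieceDom t B N k) := by
  have c1 : ∀ i : Fin N, Continuous fun p : (Fin N → ℝ) × (Fin N → Y) => |p.1 i| := fun i =>
    ((continuous_apply i).comp continuous_fst).abs
  have c2 : ∀ i : Fin N, Continuous fun p : (Fin N → ℝ) × (Fin N → Y) => p.2 i := fun i =>
    (continuous_apply i).comp continuous_snd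
  refine isClosed_of_closure_subset fun p hp => ?_
  have hcl : ∀ {S : Set ((Fin N → ℝ) × (Fin N → Y))}, IsClosed S → pieceDom t B N k ⊆ S → p ∈ S :=
    fun hS h => closure_minimal h hS hp
  have hpB : ∀ i, p.2 i ∈ B := fun i =>
    hcl (hB.preimage (c2 i)) fun q hq => hq.2.1 i
  refine ⟨fun i => ⟨?_, ?_⟩, hpB, ?_, fun i l hil => ?_⟩
  · exact hcl (isClosed_le continuous_const (c1 i)) fun q hq => (hq.1 i).1
  · exact hcl (isClosed_le (c1 i) continuous_const) fun q hq => (hq.1 i).2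
  · choose δ hδ hδt using fun i => ht _ (hpB i)
    have hU : ∀ᶠ q in 𝓝 p, ∀ i, dist (p.2 i) (q.2 i) < δ i :=
      eventually_all.2 fun i => ((continuous_const.dist (c2 i)).tendsto p).eventually_lt_const
        (by rw [dist_self]; exact hδ i)
    obtain ⟨q, hqU, hq⟩ := mem_closure_iff_nhds.1 hp _ hU
    intro i l hil
    have hqU : ∀ i, dist (p.2 i) (q.2 i) < δ i := hqU
    rw [hδt i _ (hq.2.1 i) (hqU i), hδt l _ (hq.2.1 l) (hqU l)]
    exact hq.2.2.1 i l hil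
  · exact hcl (isClosed_le continuous_const ((c2 i).dist (c2 l))) fun q hq => hq.2.2.2 i l hil

theorem Φ_comb (fr : HilbertFrame Y L) {p : (Fin N → ℝ) × (Fin N → Y)}
    (hp : p ∈ pieceDom t B N k) {m : ℕ} (hm : k ≤ m) (i : Fin N) :
    fr.Φ m (p.2 i) (fr.comb N p) = p.1 i * (1/2) ^ m := by
  rw [comb, map_sum, Finset.sum_eq_single i]
  · rw [map_smul, fr.Φ_self, smul_eq_mul]
  · intro l _ hl
    rw [map_smul, fr.Φ_far, smul_zero]
    exact (pow_le_pow_of_le_one (by norm_num) (by norm_num) hm).trans (hp.2.2.2 i l hl.symm)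
  · simp

theorem exists_pow_le_of_pos {ι : Type*} [Finite ι] {f : ι → ℝ} (hf : ∀ i, 0 < f i) (k : ℕ) :
    ∃ m ≥ k, ∀ i, (1/2 : ℝ) ^ m ≤ f i := by
  have h : ∀ᶠ m : ℕ in atTop, ∀ i, (1/2 : ℝ) ^ m ≤ f i := eventually_all.2 fun i =>
    ((tendsto_pow_atTop_nhds_zero_of_lt_one (by norm_num) (by norm_num)).eventually_lt_const
      (hf i)).mono fun _ h => h.le
  obtain ⟨m, hm⟩ := (h.and (eventually_ge_atTop k)).exists
  exact ⟨m, hm.2, hm.1⟩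

theorem injOn_comb (fr : HilbertFrame Y L) : InjOn (fr.comb N) (pieceDom t B N k) := by
  have key : ∀ p ∈ pieceDom t B N k, ∀ p' ∈ pieceDom t B N k, fr.comb N p = fr.comb N p' →
      ∀ i, ∃ l, p.2 i = p'.2 l := by
    intro p hp p' hp' h i
    by_contra! hne
    obtain ⟨m, hm, hml⟩ := exists_pow_le_of_pos (fun l => dist_pos.2 (hne l)) k
    have h1 := fr.Φ_comb hp hm i
    rw [h, comb, map_sum, Finset.sum_eq_zero fun l _ => by
      rw [map_smul, fr.Φ_far _ _ _ (hml l), smul_zero]] at h1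
    rcases mul_eq_zero.1 h1.symm with h2 | h2
    · have := (hp.1 i).1
      rw [h2, abs_zero] at this
      exact absurd this (not_le.2 (by positivity))
    · exact absurd h2 (by positivity)
  intro p hp p' hp' h
  have hr : range (t ∘ p.2) = range (t ∘ p'.2) := by
    refine Subset.antisymm ?_ ?_
    · rintro _ ⟨i, rfl⟩
      obtain ⟨l, hl⟩ := key p hp p' hp' h i
      exact ⟨l, by simp [hl]⟩
    · rintro _ ⟨i, rfl⟩
      obtain ⟨l, hl⟩ := key p' hp' p hp h.symm i
      exact ⟨l, by simp [hl]⟩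
  have hm : StrictMono (t ∘ p.2) := fun i l hil => hp.2.2.1 i l hil
  have hm' : StrictMono (t ∘ p'.2) := fun i l hil => hp'.2.2.1 i l hil
  have ht := hm.range_inj hm' |>.1 hr
  have hx : p.2 = p'.2 := by
    funext i
    obtain ⟨l, hl⟩ := key p hp p' hp' h i
    have h1 : t (p.2 i) = t (p'.2 i) := congrFun ht i
    rw [hl] at h1
    rw [hl, hm'.injective h1]
  refine Prod.ext (funext fun i => ?_) hx
  have h1 := fr.Φ_comb hp le_rfl i
  have h2 := fr.Φ_comb hp' le_rfl i
  rw [hx, h, h2] at h1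
  exact (mul_right_cancel₀ (by positivity) h1).symm

theorem isClosedEmbedding_comb (fr : HilbertFrame Y L) (hcl : IsClosed (pieceDom t B N k)) :
    IsClosedEmbedding fun p : pieceDom t B N k => fr.comb N p := by
  have hc : Continuous fun p : pieceDom t B N k => fr.comb N p :=
    (fr.continuous_comb N).comp continuous_subtype_val
  refine IsClosedEmbedding.of_continuous_injective_isClosedMap hc
    (fun p q h => Subtype.ext (fr.injOn_comb p.2 q.2 h)) (IsProperMap.isClosedMap ?_)
  refine isProperMap_iff_ultrafilter.2 ⟨hc, fun U z hz => ?_⟩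
  obtain ⟨S, hS⟩ : ∃ S : Finset Y, z ∈ Submodule.span ℝ (fr.j '' S) := by
    have hz : z ∈ Submodule.span ℝ (range fr.j) := by rw [fr.span_j]; trivial
    obtain ⟨V, hV, hzV⟩ := Submodule.mem_span_finite_of_mem_span hz
    classical
    rw [← image_univ] at hV
    obtain ⟨S, -, rfl⟩ := Finset.subset_set_image_iff.1 hV
    exact ⟨S, by rwa [Finset.coe_image] at hzV⟩
  have ha : ∀ i, ∃ α, Tendsto (fun p : pieceDom t B N k => p.1.1 i) U (𝓝 α) := by
    intro i
    have h1 : Ultrafilter.map (fun p : pieceDom t B N k => p.1.1 i) U ≤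
        𝓟 (Icc (-(2:ℝ) ^ k) (2 ^ k)) := by
      rw [le_principal_iff]
      exact Filter.univ_mem' (f := U.1) fun p : pieceDom t B N k => abs_le.1 (p.2.1 i).2
    obtain ⟨α, -, hα⟩ := isCompact_Icc.ultrafilter_le_nhds _ h1
    exact ⟨α, hα⟩
  have hx : ∀ i, ∃ y, Tendsto (fun p : pieceDom t B N k => p.1.2 i) U (𝓝 y) := by
    intro i
    by_contra! hne
    have h1 : ∀ y : S, ∃ ε > 0, ∀ᶠ p : pieceDom t B N k in U, ε ≤ dist (p.1.2 i) y := by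
      intro y
      have := hne y
      rw [Metric.tendsto_nhds] at this
      push Not at this
      obtain ⟨ε, hε, h⟩ := this
      exact ⟨ε, hε, h⟩
    choose ε hε hεd using h1
    obtain ⟨m, hm, hml⟩ := exists_pow_le_of_pos hε k
    have h2 : ∀ᶠ p : pieceDom t B N k in U, (1/2 : ℝ) ^ k * (1/2) ^ m ≤ ‖fr.comb N p - z‖ := by
      filter_upwards [eventually_all.2 hεd] with p hp
      have h3 : fr.Φ m (p.1.2 i) z = 0 := by
        have : Submodule.span ℝ (fr.j '' S) ≤ LinearMap.ker (fr.Φ m (p.1.2 i) : L →ₗ[ℝ] ℝ) := by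
          refine Submodule.span_le.2 ?_
          rintro _ ⟨y, hy, rfl⟩
          exact fr.Φ_far _ _ _ ((hml ⟨y, hy⟩).trans (hp ⟨y, hy⟩))
        exact this hS
      have h4 := fr.Φ_le m (p.1.2 i) (fr.comb N p - z)
      rw [map_sub, h3, sub_zero, fr.Φ_comb p.2 hm, abs_mul, abs_of_nonneg (by positivity :
        (0:ℝ) ≤ (1/2) ^ m)] at h4
      exact (mul_le_mul_of_nonneg_right (p.2.1 i).1 (by positivity)).trans h4
    have h3 : Tendsto (fun p : pieceDom t B N k => ‖fr.comb N p - z‖) U (𝓝 0) :=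
      tendsto_iff_norm_sub_tendsto_zero.1 hz
    have h4 := ge_of_tendsto h3 h2
    exact absurd h4 (not_le.2 (by positivity))
  choose α hα using ha
  choose y hy using hx
  have hlim : Tendsto (fun p : pieceDom t B N k => (p : (Fin N → ℝ) × (Fin N → Y))) U
      (𝓝 (α, y)) := (tendsto_pi_nhds.2 hα).prodMk_nhds (tendsto_pi_nhds.2 hy)
  have hmem : (α, y) ∈ pieceDom t B N k :=
    hcl.mem_of_tendsto hlim (Eventually.of_forall fun p => p.2)
  have hU : (U : Filter _) ≤ 𝓝 (⟨(α, y), hmem⟩ : pieceDom t B N k) := by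
    rw [nhds_subtype, ← tendsto_iff_comap]
    exact hlim
  refine ⟨⟨(α, y), hmem⟩, ?_, hU⟩
  exact tendsto_nhds_unique ((hc.tendsto _).comp hU) hz

end HilbertFrame

theorem exists_pair_coding {Y : Type} [TopologicalSpace Y] {b : Y} (ω : WeakProd Y b ≃ₜ Y)
    {σ : ℝ → Y} {f : Y → ℝ} (hσ : Continuous σ) (hf : Continuous f)
    (hfσ : ∀ t ∈ Icc (0:ℝ) 1, f (σ t) = t) (N k : ℕ) :
    ∃ (c : (Fin N → ℝ) × (Fin N → Y) → Y) (d : Y → (Fin N → ℝ) × (Fin N → Y)),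
      Continuous c ∧ Continuous d ∧ ∀ p, (∀ i, |p.1 i| ≤ 2 ^ k) → d (c p) = p := by
  refine ⟨fun p => encodeSeq ω (N + N) fun i =>
      if h : i < N then σ ((p.1 ⟨i, h⟩ / 2 ^ k + 1) / 2) else
        if h' : i - N < N then p.2 ⟨i - N, h'⟩ else b,
    fun y => (fun i => 2 ^ k * (2 * f (decodeSeq ω y i) - 1), fun i => decodeSeq ω y (N + i)),
    ?_, ?_, ?_⟩
  · refine continuous_encodeSeq ω _ fun i _ => ?_
    by_cases h : i < N
    · simp only [h, dite_true]
      refine hσ.comp (((Continuous.div_const ?_ _).add continuous_const).div_const _)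
      exact (continuous_apply _).comp continuous_fst
    · by_cases h' : i - N < N
      · simp only [h, h', dite_true, dite_false]
        exact (continuous_apply _).comp continuous_snd
      · simp only [h, h', dite_false]
        exact continuous_const
  · refine (continuous_pi fun i => ?_).prodMk (continuous_pi fun i => continuous_decodeSeq ω _)
    exact continuous_const.mul ((continuous_const.mul (hf.comp
      (continuous_decodeSeq ω i))).sub continuous_const)
  · intro p hp
    refine Prod.ext (funext fun i => ?_) (funext fun i => ?_)
    · have hi := abs_le.1 (hp i)
      have h2 : (0:ℝ) < 2 ^ k := by positivity
      have h3 : -1 ≤ p.1 i / 2 ^ k := by rw [le_div_iff₀ h2]; linarith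
      have h4 : p.1 i / 2 ^ k ≤ 1 := by rw [div_le_iff₀ h2]; linarith
      simp only [decodeSeq_encodeSeq ω (show (i : ℕ) < N + N by omega), i.2, dite_true]
      rw [hfσ _ ⟨by linarith, by linarith⟩]
      field_simp
      ring
    · simp [decodeSeq_encodeSeq ω (show N + (i : ℕ) < N + N by omega)]

theorem HilbertFrame.exists_mem_pieceDom {Y L : Type} [MetricSpace Y] [NormedAddCommGroup L]
    [InnerProductSpace ℝ L] (fr : HilbertFrame Y L) {T : ℕ → Type}
    [∀ k, LinearOrder (T k)] {t : ∀ k, Y → T k} {B : ℕ → ℕ → Set Y}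
    (ht : ∀ k x y, t k x = t k y → dist x y < (1/2) ^ k) (hmono : ∀ k, Monotone (B k))
    (hcov : ∀ k x, ∃ n, x ∈ B k n) (z : L) :
    ∃ N k n, z ∈ fr.comb N '' pieceDom (t k) (B k n) N k := by
  classical
  have hz : z ∈ Submodule.span ℝ (range fr.j) := by rw [fr.span_j]; trivial
  obtain ⟨c, hc⟩ := Finsupp.mem_span_range_iff_exists_finsupp.1 hz
  let S := c.support
  obtain ⟨k₁, -, hk₁⟩ := exists_pow_le_of_pos (f := fun x : S => |c x|)
    (fun x => abs_pos.2 (Finsupp.mem_support_iff.1 x.2)) 0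
  obtain ⟨k₂, hk₁₂, hk₂⟩ := exists_pow_le_of_pos (f := fun x : S => |c x|⁻¹)
    (fun x => inv_pos.2 (abs_pos.2 (Finsupp.mem_support_iff.1 x.2))) k₁
  obtain ⟨k, hk₂₃, hk⟩ := exists_pow_le_of_pos
    (f := fun x : {x : S × S // x.1 ≠ x.2} => dist (x.1.1 : Y) x.1.2)
    (fun x => dist_pos.2 fun h => x.2 (Subtype.ext h)) k₂
  have hmp : ∀ {a c : ℕ}, a ≤ c → (1/2 : ℝ) ^ c ≤ (1/2) ^ a := fun h =>
    pow_le_pow_of_le_one (by norm_num) (by norm_num) h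
  have hinj : InjOn (t k) S := by
    intro x hx y hy hxy
    by_contra hne
    have h1 := hk ⟨(⟨x, hx⟩, ⟨y, hy⟩), fun h => hne (congrArg Subtype.val h)⟩
    exact absurd (ht k x y hxy) (not_lt.2 h1)
  obtain ⟨n, hn⟩ : ∃ n, ∀ x ∈ S, x ∈ B k n := by
    choose n hn using hcov k
    exact ⟨S.sup n, fun x hx => hmono k (Finset.le_sup hx) (hn x)⟩
  let N := (S.image (t k)).card
  let e := (S.image (t k)).orderEmbOfFin rfl
  have he : ∀ i : Fin N, ∃ x ∈ S, t k x = e i := fun i =>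
    Finset.mem_image.1 (Finset.orderEmbOfFin_mem _ rfl i)
  choose x hxS hxe using he
  have hxinj : Function.Injective x := fun i l h => e.injective (by rw [← hxe, ← hxe, h])
  have hsurj : ∀ y ∈ S, ∃ i, x i = y := by
    intro y hy
    have : t k y ∈ range e := by
      rw [Finset.range_orderEmbOfFin]
      exact Finset.mem_coe.2 (Finset.mem_image_of_mem _ hy)
    obtain ⟨i, hi⟩ := this
    exact ⟨i, hinj (hxS i) hy (by rw [hxe, hi])⟩
  refine ⟨N, k, n, (fun i => c (x i), x), ⟨fun i => ⟨?_, ?_⟩, fun i => hn _ (hxS i), ?_, ?_⟩, ?_⟩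
  · exact (hmp (hk₁₂.trans hk₂₃)).trans (hk₁ ⟨x i, hxS i⟩)
  · have h1 := (hmp hk₂₃).trans (hk₂ ⟨x i, hxS i⟩)
    have h2 := inv_anti₀ (by positivity) h1
    rw [inv_inv, one_div, inv_pow, inv_inv] at h2
    exact h2
  · intro i l hil
    change t k (x i) < t k (x l)
    rw [hxe, hxe]
    exact e.strictMono hil
  · intro i l hil
    exact hk ⟨(⟨x i, hxS i⟩, ⟨x l, hxS l⟩), fun h => hil (hxinj (congrArg Subtype.val h))⟩
  · rw [← hc, HilbertFrame.comb, Finsupp.sum]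
    refine Finset.sum_bij (fun i _ => x i) (fun i _ => hxS i) (fun i _ l _ h => hxinj h) ?_
      fun _ _ => rfl
    exact fun y hy => (hsurj y hy).imp fun i hi => ⟨Finset.mem_univ _, hi⟩

theorem HilbertFrame.isSliced {Y L : Type} [MetricSpace Y] [NormedAddCommGroup L]
    [InnerProductSpace ℝ L] (fr : HilbertFrame Y L) (hY : IsAbsoluteRetract Y) {b : Y}
    (ω : WeakProd Y b ≃ₜ Y) {σ : ℝ → Y} {f : Y → ℝ} (hσ : Continuous σ) (hf : Continuous f)
    (hfσ : ∀ t ∈ Icc (0:ℝ) 1, f (σ t) = t) : IsSliced Y L := by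
  have hlab := fun k : ℕ => exists_stone_labelling Y (show (0:ℝ) < (1/2) ^ k by positivity)
  choose T lo t B ht hB hmono hcov hloc using hlab
  have hpiece : ∀ q : ℕ × ℕ × ℕ, ∃ (v : L → Y) (ψ : Y → L), Continuous v ∧ Continuous ψ ∧
      ∀ z ∈ fr.comb q.1 '' pieceDom (t q.2.1) (B q.2.1 q.2.2) q.1 q.2.1, ψ (v z) = z := by
    rintro ⟨N, k, n⟩
    obtain ⟨c, d, hc, hd, hdc⟩ := exists_pair_coding ω hσ hf hfσ N k
    have he := fr.isClosedEmbedding_comb (N := N) (k := k)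
      (isClosed_pieceDom (hB k n) (hloc k n))
    let g := he.isEmbedding.toHomeomorph
    obtain ⟨v, hv, hvg⟩ := hY.2 L inferInstance inferInstance _ he.isClosed_range
      (fun z => c (g.symm z).1) (hc.comp (continuous_subtype_val.comp g.symm.continuous))
    refine ⟨v, fun y => fr.comb N (d y), hv, (fr.continuous_comb N).comp hd, ?_⟩
    rintro _ ⟨p, hp, rfl⟩
    have h1 := hvg (g ⟨p, hp⟩)
    rw [g.symm_apply_apply] at h1
    change v (fr.comb N p) = c p at h1
    change fr.comb N (d (v (fr.comb N p))) = fr.comb N p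
    rw [h1, hdc p fun i => (hp.1 i).2]
  choose v ψ hv hψ h using hpiece
  refine IsSliced.of_countable hv hψ fun z => ?_
  obtain ⟨N, k, n, hz⟩ := fr.exists_mem_pieceDom ht hmono hcov z
  exact ⟨(N, k, n), h _ z hz⟩

section Spiral

variable {L : Type} [NormedAddCommGroup L] [InnerProductSpace ℝ L]

/-- The coordinates of a Lipschitz curve which has no limit at `0`. -/
noncomputable def spiralCoeff (t : ℝ) (n : ℕ) : ℝ := (1/4) * (1/2) ^ n * max 0 ((1/2) ^ n - t)

theorem spiralCoeff_eventually {t : ℝ} (ht : 0 < t) (u : L) :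
    ∃ N, ∀ n ≥ N, spiralCoeff t n • u = 0 := by
  have h : ∀ᶠ n : ℕ in atTop, (1/2 : ℝ) ^ n < t :=
    (tendsto_pow_atTop_nhds_zero_of_lt_one (by norm_num) (by norm_num)).eventually_lt_const ht
  obtain ⟨N, hN⟩ := eventually_atTop.1 h
  refine ⟨N, fun n hn => ?_⟩
  rw [spiralCoeff, max_eq_left (by linarith [hN n hn]), mul_zero, zero_smul]

/-- A Lipschitz curve in `FS L`, defined for positive times, which has no limit at `0`. -/
noncomputable def spiral (u : L) (t : ℝ) : FS L :=
  if ht : 0 < t then FS.mk (fun n => spiralCoeff t n • u) (spiralCoeff_eventually ht u) else 0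

theorem spiral_apply (u : L) {t : ℝ} (ht : 0 < t) (n : ℕ) :
    (spiral u t).1 n = spiralCoeff t n • u := by
  rw [spiral, dif_pos ht, FS.mk_apply]

theorem FS.norm_le_of_geometric (s : FS L) {C : ℝ} (hC : 0 ≤ C)
    (h : ∀ n, ‖s.1 n‖ ≤ (1/4) * (1/2) ^ n * C) : ‖s‖ ≤ 1/2 * C := by
  obtain ⟨N, hN⟩ := s.exists_bound
  have h1 := s.norm_sq hN
  have h2 : ∑ n ∈ Finset.range N, ‖s.1 n‖ ^ 2 ≤
      ∑ n ∈ Finset.range N, (1/16) * C ^ 2 * (1/2 : ℝ) ^ n := by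
    refine Finset.sum_le_sum fun n _ => ?_
    have h3 := pow_le_pow_left₀ (norm_nonneg _) (h n) 2
    have h4 : ((1/2 : ℝ) ^ n) ^ 2 ≤ (1/2) ^ n := by
      have h5 : (1/2 : ℝ) ^ n ≤ 1 := pow_le_one₀ (by norm_num) (by norm_num)
      have h6 : (0:ℝ) ≤ (1/2) ^ n := by positivity
      nlinarith
    rw [mul_pow, mul_pow] at h3
    nlinarith [sq_nonneg C]
  have h3 : ∑ n ∈ Finset.range N, (1/2 : ℝ) ^ n ≤ 2 := sum_geometric_two_le N
  rw [← Finset.mul_sum] at h2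
  refine abs_le_of_sq_le_sq' ?_ (by positivity) |>.2
  nlinarith [sq_nonneg C]

theorem norm_spiral_sub_le {u : L} (hu : ‖u‖ = 1) {t t' : ℝ} (ht : 0 < t) (ht' : 0 < t') :
    ‖spiral u t - spiral u t'‖ ≤ 1/2 * |t - t'| := by
  refine FS.norm_le_of_geometric _ (abs_nonneg _) fun n => ?_
  rw [FS.sub_apply, spiral_apply u ht, spiral_apply u ht', ← sub_smul, norm_smul, hu, mul_one,
    spiralCoeff, spiralCoeff, ← mul_sub, norm_mul, Real.norm_of_nonneg (by positivity),
    Real.norm_eq_abs]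
  refine mul_le_mul_of_nonneg_left ?_ (by positivity)
  refine (abs_max_sub_max_le_max _ _ _ _).trans ?_
  rw [sub_self, abs_zero, max_eq_right (abs_nonneg _), abs_sub_comm]
  exact le_of_eq (by congr 1; ring)

theorem spiral_eq_zero (u : L) {t : ℝ} (ht : 1 ≤ t) : spiral u t = 0 := FS.ext' fun n => by
  have h : (1/2 : ℝ) ^ n ≤ 1 := pow_le_one₀ (by norm_num) (by norm_num)
  rw [spiral_apply u (by linarith), spiralCoeff, max_eq_left (by linarith), mul_zero, zero_smul]
  rfl

theorem norm_spiral_le {u : L} (hu : ‖u‖ = 1) (t : ℝ) : ‖spiral u t‖ ≤ 1/2 := by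
  by_cases ht : 0 < t
  · have := FS.norm_le_of_geometric (spiral u t) (C := 1) (by norm_num) fun n => ?_
    · linarith
    rw [spiral_apply u ht, norm_smul, hu, mul_one, spiralCoeff, norm_mul,
      Real.norm_of_nonneg (by positivity), Real.norm_of_nonneg (le_max_left _ _)]
    refine mul_le_mul_of_nonneg_left (max_le (by norm_num) ?_) (by positivity)
    have h : (1/2 : ℝ) ^ n ≤ 1 := pow_le_one₀ (by norm_num) (by norm_num)
    linarith
  · rw [spiral, dif_neg ht, norm_zero]; norm_num

theorem continuousOn_spiral {u : L} (hu : ‖u‖ = 1) : ContinuousOn (spiral u) (Ioi 0) := by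
  refine (LipschitzOnWith.of_dist_le_mul (K := 1/2) fun t ht t' ht' => ?_).continuousOn
  rw [dist_eq_norm, Real.dist_eq]
  exact (norm_spiral_sub_le hu ht ht').trans (by norm_num)

theorem not_tendsto_spiral {u : L} (hu : ‖u‖ = 1) (z : FS L) :
    ¬ Tendsto (spiral u) (𝓝[>] 0) (𝓝 z) := by
  intro h
  obtain ⟨N, hN⟩ := z.exists_bound
  have h1 := ((FS.continuous_coord N).tendsto z).comp h
  rw [hN N le_rfl] at h1
  have h2 : Tendsto (fun t => spiralCoeff t N • u) (𝓝[>] 0) (𝓝 (spiralCoeff 0 N • u)) := by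
    refine (Continuous.tendsto ?_ _).mono_left nhdsWithin_le_nhds
    unfold spiralCoeff
    fun_prop
  have h3 : Tendsto (fun t => spiralCoeff t N • u) (𝓝[>] 0) (𝓝 0) :=
    h1.congr' (eventually_nhdsWithin_of_forall fun t ht => spiral_apply u ht N)
  have h4 := tendsto_nhds_unique h2 h3
  rcases smul_eq_zero.1 h4 with h5 | h5
  · rw [spiralCoeff, sub_zero, max_eq_right (by positivity)] at h5
    exact absurd h5 (by positivity)
  · rw [h5, norm_zero] at hu; norm_num at hu

theorem exists_spiral_time {u : L} (hu : ‖u‖ = 1) (z : FS (FS L)) :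
    ∃ t > 0, ‖z - FS.single 0 (spiral u t)‖ = t := by
  obtain ⟨t₀, ht₀, h₀⟩ : ∃ t₀ > 0, t₀ ≤ ‖z - FS.single 0 (spiral u t₀)‖ := by
    by_contra! hc
    refine not_tendsto_spiral hu (z.1 0) ?_
    rw [tendsto_iff_norm_sub_tendsto_zero]
    refine squeeze_zero' (g := fun t => t) (Eventually.of_forall fun _ => norm_nonneg _) ?_
      (tendsto_id.mono_left nhdsWithin_le_nhds)
    refine eventually_nhdsWithin_of_forall fun t ht => ?_
    have h1 := FS.norm_apply_le (z - FS.single 0 (spiral u t)) 0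
    rw [FS.sub_apply, FS.single_same, norm_sub_rev] at h1
    exact h1.trans (hc t ht).le
  let t₁ := max t₀ (‖z‖ + 1)
  have h₁ : ‖z - FS.single 0 (spiral u t₁)‖ ≤ t₁ := by
    have h1 : (1:ℝ) ≤ t₁ := le_max_of_le_right (by linarith [norm_nonneg z])
    rw [spiral_eq_zero u h1, FS.single_zero, sub_zero]
    exact le_max_of_le_right (by linarith)
  have hc : ContinuousOn (fun t => ‖z - FS.single 0 (spiral u t)‖) (Icc t₀ t₁) :=
    (continuousOn_const.sub ((FS.continuous_single 0).comp_continuousOn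
      ((continuousOn_spiral hu).mono fun t ht => ht₀.trans_le ht.1))).norm
  obtain ⟨t, ht, h⟩ := isPreconnected_Icc.intermediate_value₂
    (left_mem_Icc.2 (le_max_left _ _)) (right_mem_Icc.2 (le_max_left _ _)) continuousOn_id hc h₀ h₁
  exact ⟨t, ht₀.trans_le ht.1, h.symm⟩

theorem abs_sub_spiral_time_le {u : L} (hu : ‖u‖ = 1) {z z' : FS (FS L)} {t t' : ℝ}
    (ht : 0 < t) (ht' : 0 < t') (h : ‖z - FS.single 0 (spiral u t)‖ = t)
    (h' : ‖z' - FS.single 0 (spiral u t')‖ = t') : |t - t'| ≤ 2 * ‖z - z'‖ := by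
  have h1 := abs_norm_sub_norm_le (z - FS.single 0 (spiral u t)) (z' - FS.single 0 (spiral u t'))
  rw [h, h'] at h1
  have h2 : z - FS.single 0 (spiral u t) - (z' - FS.single 0 (spiral u t')) =
      (z - z') - FS.single 0 (spiral u t - spiral u t') := by rw [FS.single_sub]; abel
  rw [h2] at h1
  have h3 := norm_sub_le (z - z') (FS.single 0 (spiral u t - spiral u t'))
  rw [FS.norm_single] at h3
  linarith [norm_spiral_sub_le hu ht ht']

/-- A continuous involution exchanging a neighbourhood of infinity with a bounded set. -/
theorem exists_involution {u : L} (hu : ‖u‖ = 1) : ∃ m : FS (FS L) → FS (FS L), Continuous m ∧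
    (∀ s, m (m s) = s) ∧ (∀ s, ∀ i ≥ 1, (m s).1 i = 0 ↔ s.1 i = 0) ∧
    ∀ s, 2 ≤ ‖s‖ → ‖m s‖ ≤ 1 := by
  choose τ hτ hτz using fun z => exists_spiral_time hu z
  have huniq : ∀ z t, 0 < t → ‖z - FS.single 0 (spiral u t)‖ = t → τ z = t := by
    intro z t ht h
    have := abs_sub_spiral_time_le hu (hτ z) ht (hτz z) h
    rw [sub_self, norm_zero, mul_zero] at this
    linarith [abs_nonpos_iff.1 this]
  have hτc : Continuous τ := by
    refine (LipschitzWith.of_dist_le_mul (K := 2) fun z z' => ?_).continuous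
    rw [Real.dist_eq, dist_eq_norm]
    exact abs_sub_spiral_time_le hu (hτ z) (hτ z') (hτz z) (hτz z')
  have hcomp : ∀ {f : FS (FS L) → ℝ}, Continuous f → (∀ z, 0 < f z) →
      Continuous fun z => FS.single 0 (spiral u (f z)) := fun hf h =>
    (FS.continuous_single 0).comp ((continuousOn_spiral hu).comp_continuous hf h)
  let m : FS (FS L) → FS (FS L) := fun z =>
    (τ z ^ 2)⁻¹ • (z - FS.single 0 (spiral u (τ z))) + FS.single 0 (spiral u (τ z)⁻¹)
  have hm1 : ∀ z, ‖m z - FS.single 0 (spiral u (τ z)⁻¹)‖ = (τ z)⁻¹ := by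
    intro z
    have := hτ z
    rw [add_sub_cancel_right, norm_smul, hτz, Real.norm_of_nonneg (by positivity)]
    field_simp
  have hm2 : ∀ z, τ (m z) = (τ z)⁻¹ := fun z => huniq _ _ (inv_pos.2 (hτ z)) (hm1 z)
  have hmi : ∀ z, ∀ i ≥ 1, (m z).1 i = (τ z ^ 2)⁻¹ • z.1 i := by
    intro z i hi
    simp only [m, FS.add_apply, FS.smul_apply, FS.sub_apply]
    rw [FS.single_ne (by omega), FS.single_ne (by omega), sub_zero, add_zero]
  refine ⟨m, ?_, fun z => ?_, fun z i hi => ?_, fun z hz => ?_⟩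
  · exact (((hτc.pow 2).inv₀ fun z => (pow_pos (hτ z) 2).ne').smul
      (continuous_id.sub (hcomp hτc hτ))).add
      (hcomp (hτc.inv₀ fun z => (hτ z).ne') fun z => inv_pos.2 (hτ z))
  · have h0 := (hτ z).ne'
    change (τ (m z) ^ 2)⁻¹ • (m z - FS.single 0 (spiral u (τ (m z)))) +
      FS.single 0 (spiral u (τ (m z))⁻¹) = z
    rw [hm2, inv_inv, add_sub_cancel_right, smul_smul]
    have : ((τ z)⁻¹ ^ 2)⁻¹ * (τ z ^ 2)⁻¹ = 1 := by field_simp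
    rw [this, one_smul, sub_add_cancel]
  · rw [hmi z i hi, smul_eq_zero]
    have : (τ z ^ 2)⁻¹ ≠ 0 := inv_ne_zero (pow_ne_zero 2 (hτ z).ne')
    simp [this]
  · have h1 : 1 ≤ τ z := by
      have h2 := norm_sub_norm_le z (FS.single 0 (spiral u (τ z)))
      rw [hτz, FS.norm_single] at h2
      linarith [norm_spiral_le hu (τ z)]
    have h2 := hτz z
    rw [spiral_eq_zero u h1, FS.single_zero, sub_zero] at h2
    have h3 := norm_add_le (m z - FS.single 0 (spiral u (τ z)⁻¹)) (FS.single 0 (spiral u (τ z)⁻¹))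
    rw [sub_add_cancel, hm1, FS.norm_single] at h3
    have h4 : (τ z)⁻¹ ≤ 2⁻¹ := inv_anti₀ (by norm_num) (by linarith)
    linarith [norm_spiral_le hu (τ z)⁻¹]

end Spiral

section Margin

variable {Y F : Type} [TopologicalSpace Y] [NormedAddCommGroup F] [InnerProductSpace ℝ F]

/-- A factorisation of `F` applied to one coordinate of a finitely supported sequence. -/
noncomputable def coordFactor (h : F ≃ₜ Y × F) (n : ℕ) : FS F ≃ₜ Y × FS F where
  toFun s := ((h (s.1 n)).1, s + FS.single n ((h (s.1 n)).2 - s.1 n))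
  invFun a := a.2 + FS.single n (h.symm (a.1, a.2.1 n) - a.2.1 n)
  left_inv s := by
    have h1 : (s + FS.single n ((h (s.1 n)).2 - s.1 n)).1 n = (h (s.1 n)).2 := by simp
    simp only [h1]
    rw [Prod.mk.eta, h.symm_apply_apply, add_assoc, ← FS.single_add]
    simp
  right_inv a := by
    have h1 : (a.2 + FS.single n (h.symm (a.1, a.2.1 n) - a.2.1 n)).1 n =
      h.symm (a.1, a.2.1 n) := by simp
    simp only [h1, h.apply_symm_apply]
    rw [add_assoc, ← FS.single_add]
    simp
  continuous_toFun := by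
    have hc := FS.continuous_coord (M := F) n
    exact (continuous_fst.comp (h.continuous.comp hc)).prodMk (continuous_id.add
      ((FS.continuous_single n).comp ((continuous_snd.comp (h.continuous.comp hc)).sub hc)))
  continuous_invFun := by
    have hc := (FS.continuous_coord (M := F) n).comp (continuous_snd (X := Y))
    exact continuous_snd.add ((FS.continuous_single n).comp
      ((h.symm.continuous.comp (continuous_fst.prodMk hc)).sub hc))

theorem coordFactor_snd_apply (h : F ≃ₜ Y × F) {n i : ℕ} (hi : i ≠ n) (s : FS F) :
    (coordFactor h n s).2.1 i = s.1 i := by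
  change (s + FS.single n ((h (s.1 n)).2 - s.1 n)).1 i = _
  rw [FS.add_apply, FS.single_ne hi, add_zero]

theorem coordFactor_fst (h : F ≃ₜ Y × F) (n : ℕ) (s : FS F) :
    (coordFactor h n s).1 = (h (s.1 n)).1 := rfl

theorem coordFactor_zero {h : F ≃ₜ Y × F} {b : Y} (h0 : h 0 = (b, 0)) (n : ℕ) :
    coordFactor h n 0 = (b, 0) := by
  refine Prod.ext ?_ ?_
  · rw [coordFactor_fst, FS.zero_apply, h0]
  · change (0 : FS F) + FS.single n ((h ((0 : FS F).1 n)).2 - (0 : FS F).1 n) = 0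
    rw [FS.zero_apply, h0]
    simp

theorem exists_margin {L : Type} [T2Space Y] [NormedAddCommGroup L]
    [InnerProductSpace ℝ L] {u : L} (hu : ‖u‖ = 1) {b y₁ : Y} (hb : y₁ ≠ b)
    (h : FS L ≃ₜ Y × FS L) (h0 : h 0 = (b, 0)) :
    ∃ (Λ : FS (FS L) ≃ₜ Y × FS (FS L)) (O : Set Y), Λ 0 = (b, 0) ∧ O ∈ 𝓝 b ∧
      (∀ s, (Λ s).1 ∈ O → ‖s‖ < 1) ∧ ∀ s, ∀ i ≥ 1, (Λ s).2.1 i = 0 ↔ s.1 i = 0 := by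
  obtain ⟨m, hm, hmm, hmi, hmn⟩ := exists_involution hu
  let mh : FS (FS L) ≃ₜ FS (FS L) := ⟨⟨m, m, hmm, hmm⟩, hm, hm⟩
  let p := h.symm (y₁, 0)
  have hp : p ≠ 0 := by
    intro hp
    have h1 : h p = (y₁, 0) := h.apply_symm_apply _
    rw [hp, h0] at h1
    exact hb (congrArg Prod.fst h1).symm
  obtain ⟨V, O, hV, hO, hyV, hbO, hVO⟩ := t2_separation hb
  have hV' : {z | (h z).1 ∈ V} ∈ 𝓝 p := by
    refine (hV.preimage (continuous_fst.comp h.continuous)).mem_nhds ?_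
    change (h p).1 ∈ V
    rwa [show h p = (y₁, 0) from h.apply_symm_apply _]
  obtain ⟨r, hr, hrV⟩ := Metric.nhds_basis_closedBall.mem_iff.1 hV'
  let ρ := min r (‖p‖ / 2)
  have hρ : 0 < ρ := lt_min hr (half_pos (norm_pos_iff.2 hp))
  let P : FS (FS L) := FS.single 0 p
  let s₀ := m (-(ρ⁻¹ • P))
  have hs₀ : ‖s₀‖ ≤ 1 := by
    refine hmn _ ?_
    rw [norm_neg, norm_smul, FS.norm_single, Real.norm_of_nonneg (inv_pos.2 hρ).le,
      inv_mul_eq_div, le_div_iff₀ hρ]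
    linarith [min_le_right r (‖p‖ / 2)]
  have hs₀i : ∀ i ≥ 1, s₀.1 i = 0 := by
    intro i hi
    refine (hmi _ i hi).2 ?_
    rw [FS.neg_apply, FS.smul_apply, FS.single_ne (by omega), smul_zero, neg_zero]
  let Λ : FS (FS L) ≃ₜ Y × FS (FS L) :=
    ((((Homeomorph.smulOfNeZero (4:ℝ) (by norm_num)).trans (Homeomorph.addLeft s₀)).trans mh).trans
      ((Homeomorph.smulOfNeZero ρ hρ.ne').trans (Homeomorph.addLeft P))).trans (coordFactor h 0)
  have hΛ : ∀ s, Λ s = coordFactor h 0 (P + ρ • m (s₀ + (4:ℝ) • s)) := fun s => rfl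
  refine ⟨Λ, O, ?_, hO.mem_nhds hbO, fun s hs => ?_, fun s i hi => ?_⟩
  · rw [hΛ, smul_zero, add_zero, hmm, smul_neg, smul_smul, mul_inv_cancel₀ hρ.ne', one_smul,
      add_neg_cancel, coordFactor_zero h0]
  · by_contra hc
    rw [not_lt] at hc
    have h1 : ‖m (s₀ + (4:ℝ) • s)‖ ≤ 1 := by
      refine hmn _ ?_
      have h2 := norm_sub_norm_le ((4:ℝ) • s) (-s₀)
      rw [sub_neg_eq_add, add_comm _ s₀, norm_neg, norm_smul, Real.norm_ofNat] at h2
      linarith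
    rw [hΛ, coordFactor_fst] at hs
    refine hVO.notMem_of_mem_left (a := (h _).1) (hrV ?_) hs
    rw [mem_closedBall_iff_norm, FS.add_apply, FS.single_same, add_sub_cancel_left, FS.smul_apply,
      norm_smul, Real.norm_of_nonneg hρ.le]
    have h2 := (FS.norm_apply_le (m (s₀ + (4:ℝ) • s)) 0).trans h1
    have h3 := min_le_left r (‖p‖ / 2)
    change ρ * _ ≤ r
    nlinarith [norm_nonneg ((m (s₀ + (4:ℝ) • s)).1 0)]
  · rw [hΛ, coordFactor_snd_apply h (by omega), FS.add_apply, FS.single_ne (by omega), zero_add,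
      FS.smul_apply, smul_eq_zero, or_iff_right hρ.ne', hmi _ i hi, FS.add_apply, hs₀i i hi,
      zero_add, FS.smul_apply, smul_eq_zero, or_iff_right (by norm_num)]

end Margin

/-- Radial retraction onto the closed ball of radius `r`. -/
noncomputable def radialClamp {E : Type} [NormedAddCommGroup E] [NormedSpace ℝ E] (r : ℝ) (x : E) :
    E := (r / max r ‖x‖) • x

section RadialClamp

variable {E : Type} [NormedAddCommGroup E] [NormedSpace ℝ E] {r : ℝ}

theorem continuous_radialClamp (hr : 0 < r) : Continuous (radialClamp r : E → E) :=
  (continuous_const.div (continuous_const.max continuous_norm) fun _ =>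
    (lt_max_of_lt_left hr).ne').smul continuous_id

theorem radialClamp_eq (hr : 0 < r) {x : E} (hx : ‖x‖ ≤ r) : radialClamp r x = x := by
  rw [radialClamp, max_eq_left hx, div_self hr.ne', one_smul]

theorem norm_radialClamp_le (hr : 0 < r) (x : E) : ‖radialClamp r x‖ ≤ r := by
  have h : 0 < max r ‖x‖ := lt_max_of_lt_left hr
  rw [radialClamp, norm_smul, Real.norm_of_nonneg (by positivity), div_mul_eq_mul_div,
    div_le_iff₀ h]
  exact mul_le_mul_of_nonneg_left (le_max_right _ _) hr.le

end RadialClamp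

/-- A bump function equal to `1` on `[1, 2]` and to `0` outside `(1/2, 4)`. -/
noncomputable def dyadicBump (x : ℝ) : ℝ := max 0 (min 1 (min (2 * x - 1) (2 - x / 2)))

theorem continuous_dyadicBump : Continuous dyadicBump := by unfold dyadicBump; fun_prop

theorem dyadicBump_eq_one {x : ℝ} (h1 : 1 ≤ x) (h2 : x ≤ 2) : dyadicBump x = 1 := by
  rw [dyadicBump, min_eq_left (le_min (by linarith) (by linarith)), max_eq_right zero_le_one]

theorem dyadicBump_eq_zero_of_le {x : ℝ} (h : x ≤ 1/2) : dyadicBump x = 0 :=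
  max_eq_left (min_le_of_right_le (min_le_of_left_le (by linarith)))

theorem dyadicBump_eq_zero_of_ge {x : ℝ} (h : 4 ≤ x) : dyadicBump x = 0 :=
  max_eq_left (min_le_of_right_le (min_le_of_right_le (by linarith)))

theorem dyadicBump_nonneg (x : ℝ) : 0 ≤ dyadicBump x := le_max_left _ _

theorem sum_mul_prod_one_sub (l : ℕ → ℝ) (K : ℕ) :
    ∑ m ∈ Finset.range K, l m * ∏ i ∈ Finset.range m, (1 - l i) =
      1 - ∏ i ∈ Finset.range K, (1 - l i) := by
  induction K with
  | zero => simp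
  | succ K ih => rw [Finset.sum_range_succ, ih, Finset.prod_range_succ]; ring

/-- Pointwise eventually finite sums of continuous functions with summable tails are continuous. -/
theorem exists_continuous_sum {A E : Type*} [TopologicalSpace A] [NormedAddCommGroup E]
    {g : ℕ → A → E} (hg : ∀ m, Continuous (g m)) (hfin : ∀ a, ∃ K, ∀ m ≥ K, g m a = 0)
    {N : ℕ} {C : ℝ} (hbd : ∀ m ≥ N, ∀ a, ‖g m a‖ ≤ C * (1/2) ^ m) :
    ∃ ψ : A → E, Continuous ψ ∧ ∀ a, ∃ K₀, ∀ K ≥ K₀, ψ a = ∑ m ∈ Finset.range K, g m a := by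
  choose K hK using hfin
  have hst : ∀ a, ∀ k ≥ K a, ∑ m ∈ Finset.range (K a), g m a = ∑ m ∈ Finset.range k, g m a := by
    intro a k hk
    refine Finset.sum_subset (Finset.range_mono hk) fun m _ hm => hK a m ?_
    simpa using hm
  refine ⟨fun a => ∑ m ∈ Finset.range (K a), g m a, ?_, fun a => ⟨K a, hst a⟩⟩
  have hC : ∀ a : A, 0 ≤ C := fun a =>
    nonneg_of_mul_nonneg_left ((norm_nonneg _).trans (hbd N le_rfl a)) (by positivity)
  have hdiff : ∀ n ≥ N, ∀ a, ∀ k, ‖∑ m ∈ Finset.range (n + k), g m a -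
      ∑ m ∈ Finset.range n, g m a‖ ≤ C * (1/2) ^ n * 2 := by
    intro n hn a k
    rw [Finset.sum_range_add_sub_sum_range]
    refine (norm_sum_le_of_le _ fun i _ => hbd (n + i) (by omega) a).trans ?_
    simp_rw [pow_add, ← mul_assoc]
    rw [← Finset.mul_sum]
    exact mul_le_mul_of_nonneg_left (sum_geometric_two_le k)
      (mul_nonneg (hC a) (by positivity))
  refine TendstoUniformly.continuous (F := fun n a => ∑ m ∈ Finset.range n, g m a) (p := atTop) ?_
    (Frequently.of_forall fun n => continuous_finsetSum _ fun m _ => hg m)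
  rw [Metric.tendstoUniformly_iff]
  intro ε hε
  have h1 : Tendsto (fun n : ℕ => C * (1/2 : ℝ) ^ n * 2) atTop (𝓝 (C * 0 * 2)) :=
    ((tendsto_pow_atTop_nhds_zero_of_lt_one (by norm_num) (by norm_num)).const_mul C).mul_const 2
  rw [mul_zero, zero_mul] at h1
  filter_upwards [h1.eventually_lt_const hε, eventually_ge_atTop N] with n hn hnN a
  rw [dist_eq_norm, hst a (n + K a) (by omega)]
  exact (hdiff n hnN a _).trans_lt hn

theorem exists_label {Y : Type} [MetricSpace Y] {b y₁ : Y} (hb : y₁ ≠ b) :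
    ∃ l : Y → ℝ, Continuous l ∧ (∀ y, 0 ≤ l y) ∧ (∀ y, l y ≤ 1) ∧ l y₁ = 1 ∧ l b = 0 ∧
      ∀ᶠ y in 𝓝 b, l y = 0 := by
  have hD : 0 < dist y₁ b := dist_pos.2 hb
  have h0 : ∀ y, dist y b < dist y₁ b / 2 →
      max 0 (min 1 (2 * (dist y b / dist y₁ b) - 1)) = (0:ℝ) := by
    intro y hy
    refine max_eq_left (min_le_of_right_le ?_)
    have : dist y b / dist y₁ b < 1/2 := by rw [div_lt_iff₀ hD]; linarith
    linarith
  refine ⟨fun y => max 0 (min 1 (2 * (dist y b / dist y₁ b) - 1)), by fun_prop,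
    fun y => le_max_left _ _, fun y => max_le zero_le_one (min_le_left _ _), ?_, ?_, ?_⟩
  · simp only [div_self hD.ne']; norm_num
  · exact h0 b (by rw [dist_self]; positivity)
  · filter_upwards [Metric.ball_mem_nhds b (half_pos hD)] with y hy
    exact h0 y hy

theorem exists_dyadic_scale {δ : ℝ} (h0 : 0 < δ) (h1 : δ ≤ 1) :
    ∃ m : ℕ, 1 ≤ 2 ^ m * δ ∧ 2 ^ m * δ ≤ 2 := by
  obtain ⟨n, hn1, hn2⟩ := exists_nat_pow_near_of_lt_one h0 h1 (by norm_num : (0:ℝ) < 1/2)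
    (by norm_num)
  have h2 : (0:ℝ) < 2 ^ (n + 1) := by positivity
  refine ⟨n + 1, ?_, ?_⟩
  · rw [← two_pow_mul_half_pow (n + 1)]
    exact mul_le_mul_of_nonneg_left hn1.le h2.le
  · have h3 := mul_le_mul_of_nonneg_left hn2 h2.le
    have h4 := two_pow_mul_half_pow n
    rw [pow_succ] at h3 ⊢
    linarith

theorem exists_absorbing_pair {P Y E : Type} [TopologicalSpace P] [MetricSpace Y]
    [NormedAddCommGroup E] [NormedSpace ℝ E] {b y₁ : Y} (hb : y₁ ≠ b) (ω : WeakProd Y b ≃ₜ Y)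
    (hω : ω (weakBase b) = b) {c : ℝ × Y → Y} (hc : Continuous c) (hc0 : ∀ y, c (0, y) = b)
    (hc1 : ∀ y, c (1, y) = y) {v₀ : P × E → Y} (hv₀ : Continuous v₀) {ψ₀ : Y → E}
    (hψ₀ : Continuous ψ₀) :
    ∃ (v : P × E → Y) (ψ : Y → E), Continuous v ∧ Continuous ψ ∧ (∀ p, v (p, 0) = b) ∧
      ψ b = 0 ∧ ∀ a, ψ₀ (v₀ a) = a.2 → ψ (v a) = a.2 := by
  obtain ⟨l, hl, hl0, hl1, hly, hlb, hlb'⟩ := exists_label hb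
  obtain ⟨η, hη, hηl⟩ : ∃ η > 0, ∀ β : ℝ, 0 ≤ β → β < η → l (c (β, y₁)) = 0 := by
    have h1 : Tendsto (fun β : ℝ => c (β, y₁)) (𝓝 0) (𝓝 b) := by
      have : Continuous fun β : ℝ => c (β, y₁) := by fun_prop
      simpa [hc0] using this.tendsto 0
    obtain ⟨η, hη, h⟩ := Metric.eventually_nhds_iff.1 (h1.eventually hlb')
    exact ⟨η, hη, fun β hβ0 hβ => h (by rwa [Real.dist_eq, sub_zero, abs_of_nonneg hβ0])⟩
  let β : ℕ → E → ℝ := fun m s => dyadicBump (2 ^ m * min ‖s‖ 1)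
  have hβc : ∀ m, Continuous (β m) := fun m => continuous_dyadicBump.comp (by fun_prop)
  have hβ0 : ∀ m, β m 0 = 0 := fun m => dyadicBump_eq_zero_of_le (by simp)
  let w : P × E → ℕ → Y := fun a i =>
    if i % 2 = 0 then c (β (i / 2) a.2, y₁) else c (min 1 (β (i / 2) a.2 / η), v₀ a)
  have hw0 : ∀ a i, β (i / 2) a.2 = 0 → w a i = b := by
    intro a i h
    simp only [w, h, zero_div, hc0]
    rw [min_eq_right zero_le_one, hc0, ite_self]
  have hwfin : ∀ a, w a ∈ WeakProd Y b := by
    intro a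
    rcases eq_or_ne a.2 0 with h | h
    · refine finite_empty.subset fun i hi => hi (hw0 a i ?_)
      rw [h, hβ0]
    · have hδ : 0 < min ‖a.2‖ 1 := lt_min (norm_pos_iff.2 h) one_pos
      obtain ⟨N, hN⟩ := pow_unbounded_of_one_lt (4 / min ‖a.2‖ 1) (by norm_num : (1:ℝ) < 2)
      refine (finite_lt_nat (2 * N)).subset fun i hi => ?_
      by_contra hc
      refine hi (hw0 a i (dyadicBump_eq_zero_of_ge ?_))
      have h2 : (2:ℝ) ^ N ≤ 2 ^ (i / 2) :=
        pow_le_pow_right₀ (by norm_num) (by have : ¬ i < 2 * N := hc; omega)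
      rw [← div_le_iff₀ hδ]
      exact hN.le.trans h2
  have hwc : ∀ i, Continuous fun a => w a i := by
    intro i
    have := (hβc (i / 2)).comp (continuous_snd (X := P))
    by_cases hi : i % 2 = 0
    · simp only [w, hi, if_true]
      exact hc.comp (this.prodMk continuous_const)
    · simp only [w, hi, if_false]
      exact hc.comp ((continuous_const.min (this.div_const _)).prodMk hv₀)
  let κ : ℕ → E → E := fun m => if m < 2 then id else radialClamp (4 * (1/2) ^ m)
  have hκc : ∀ m, Continuous (κ m) := by
    intro m
    by_cases hm : m < 2
    · simp only [κ, hm, if_true]; exact continuous_id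
    · simp only [κ, hm, if_false]; exact continuous_radialClamp (by positivity)
  let g : ℕ → Y → E := fun m y =>
    (l (decodeSeq ω y (2 * m)) * ∏ i ∈ Finset.range m, (1 - l (decodeSeq ω y (2 * i)))) •
      κ m (ψ₀ (decodeSeq ω y (2 * m + 1)))
  have hlc : ∀ m, Continuous fun y => l (decodeSeq ω y (2 * m)) := fun m =>
    hl.comp (continuous_decodeSeq ω _)
  have hgc : ∀ m, Continuous (g m) := fun m =>
    ((hlc m).mul (continuous_finsetProd _ fun i _ => continuous_const.sub (hlc i))).smul
      ((hκc m).comp (hψ₀.comp (continuous_decodeSeq ω _)))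
  have hgfin : ∀ y, ∃ K, ∀ m ≥ K, g m y = 0 := by
    intro y
    obtain ⟨K, hK⟩ := (ω.symm y).2.bddAbove
    refine ⟨K + 1, fun m hm => ?_⟩
    have : decodeSeq ω y (2 * m) = b := by
      by_contra h
      have := hK h
      omega
    simp only [g, this, hlb, zero_mul, zero_smul]
  have hgb : ∀ m ≥ 2, ∀ y, ‖g m y‖ ≤ 4 * (1/2) ^ m := by
    intro m hm y
    have hp0 : 0 ≤ ∏ i ∈ Finset.range m, (1 - l (decodeSeq ω y (2 * i))) :=
      Finset.prod_nonneg fun i _ => sub_nonneg.2 (hl1 _)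
    have hp1 : ∏ i ∈ Finset.range m, (1 - l (decodeSeq ω y (2 * i))) ≤ 1 :=
      Finset.prod_le_one (fun i _ => sub_nonneg.2 (hl1 _)) fun i _ => by
        linarith [hl0 (decodeSeq ω y (2 * i))]
    simp only [g]
    rw [norm_smul, Real.norm_of_nonneg (mul_nonneg (hl0 _) hp0)]
    have h1 : ‖κ m (ψ₀ (decodeSeq ω y (2 * m + 1)))‖ ≤ 4 * (1/2) ^ m := by
      simp only [κ, not_lt.2 hm, if_false]
      exact norm_radialClamp_le (by positivity) _
    exact (mul_le_of_le_one_left (norm_nonneg _) (mul_le_one₀ (hl1 _) hp0 hp1)).trans h1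
  obtain ⟨ψ, hψ, hψs⟩ := exists_continuous_sum hgc hgfin hgb
  refine ⟨fun a => ω ⟨w a, hwfin a⟩, ψ, ω.continuous.comp
    (Continuous.subtype_mk (continuous_pi hwc) _), hψ, fun p => ?_, ?_, fun a ha => ?_⟩
  · exact (congrArg ω (Subtype.ext (funext fun i => hw0 (p, 0) i (hβ0 _)))).trans hω
  · obtain ⟨K, hK⟩ := hψs b
    rw [hK K le_rfl]
    refine Finset.sum_eq_zero fun m _ => ?_
    have : decodeSeq ω b (2 * m) = b :=
      congrArg (fun z : WeakProd Y b => z.1 (2 * m)) ((ω.symm_apply_eq).2 hω.symm)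
    simp only [g, this, hlb, zero_mul, zero_smul]
  · have hdec : ∀ i, decodeSeq ω (ω ⟨w a, hwfin a⟩) i = w a i := fun i => by
      rw [decodeSeq, ω.symm_apply_apply]
    obtain ⟨K₀, hK⟩ := hψs (ω ⟨w a, hwfin a⟩)
    have hw2 : ∀ m, w a (2 * m) = c (β m a.2, y₁) := fun m => by simp [w]
    have hw3 : ∀ m, w a (2 * m + 1) = c (min 1 (β m a.2 / η), v₀ a) := fun m => by
      have h1 : (2 * m + 1) % 2 = 1 := by omega
      have h2 : (2 * m + 1) / 2 = m := by omega
      simp [w, h1, h2]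
    have hterm : ∀ m, g m (ω ⟨w a, hwfin a⟩) =
        (l (w a (2 * m)) * ∏ i ∈ Finset.range m, (1 - l (w a (2 * i)))) • a.2 := by
      intro m
      simp only [g, hdec]
      by_cases hβη : β m a.2 < η
      · rw [hw2, hηl _ (dyadicBump_nonneg _) hβη, zero_mul, zero_smul, zero_smul]
      · rw [not_lt] at hβη
        have h1 : w a (2 * m + 1) = v₀ a := by
          rw [hw3, min_eq_left ((one_le_div hη).2 hβη), hc1]
        rw [h1, ha]
        congr 1
        by_cases hm : m < 2
        · simp only [κ, hm, if_true, id]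
        · simp only [κ, hm, if_false]
          refine radialClamp_eq (by positivity) ?_
          have h2 : (2:ℝ) ^ m * min ‖a.2‖ 1 < 4 := by
            by_contra hc
            have : β m a.2 = 0 := dyadicBump_eq_zero_of_ge (not_lt.1 hc)
            linarith
          have h3 : (4:ℝ) ≤ 2 ^ m := by
            calc (4:ℝ) = 2 ^ 2 := by norm_num
              _ ≤ 2 ^ m := pow_le_pow_right₀ (by norm_num) (by omega)
          have h4 : ‖a.2‖ < 1 := by
            by_contra hc
            rw [min_eq_right (not_lt.1 hc)] at h2
            linarith
          rw [min_eq_left h4.le] at h2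
          have h5 := mul_le_mul_of_nonneg_right h2.le (by positivity : (0:ℝ) ≤ (1/2) ^ m)
          rwa [mul_right_comm, two_pow_mul_half_pow, one_mul] at h5
    rcases eq_or_ne a.2 0 with h | h
    · rw [hK K₀ le_rfl, Finset.sum_eq_zero fun m _ => by rw [hterm, h, smul_zero], h]
    · obtain ⟨m, hm1, hm2⟩ := exists_dyadic_scale (lt_min (norm_pos_iff.2 h) one_pos)
        (min_le_right ‖a.2‖ 1)
      have h1 : l (w a (2 * m)) = 1 := by
        rw [hw2, show β m a.2 = 1 from dyadicBump_eq_one hm1 hm2, hc1, hly]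
      rw [hK (max K₀ (m + 1)) (le_max_left _ _), Finset.sum_congr rfl fun m _ => hterm m,
        ← Finset.sum_smul, sum_mul_prod_one_sub fun m => l (w a (2 * m)),
        Finset.prod_eq_zero (i := m) (Finset.mem_range.2 (by omega)) (by rw [h1, sub_self]),
        sub_zero, one_smul]

namespace FS

variable {M : Type} [NormedAddCommGroup M] [InnerProductSpace ℝ M]

/-- All coordinates of `s` from index `n` on vanish. -/
def SuppLT (n : ℕ) (s : FS M) : Prop := ∀ i ≥ n, s.1 i = 0

theorem SuppLT.trunc_eq {n : ℕ} {s : FS M} (h : SuppLT n s) : trunc n s = s := ext' fun i => by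
  rw [trunc_apply]
  split_ifs with hi
  · rfl
  · exact (h i (not_lt.1 hi)).symm

theorem trunc_congr {n : ℕ} {s t : FS M} (h : ∀ i < n, s.1 i = t.1 i) : trunc n s = trunc n t :=
  ext' fun i => by
    rw [trunc_apply, trunc_apply]
    split_ifs with hi
    · exact h i hi
    · rfl

end FS

section Absorb

variable {P Y F : Type} [TopologicalSpace P] [TopologicalSpace Y] [NormedAddCommGroup F]
  [InnerProductSpace ℝ F] {b : Y}

/-- A continuous family of homeomorphisms `FS F ≃ₜ Y × FS F` sending to `0` in the second factor
all points supported in the first `n` coordinates on which the identity factors through `Y`. -/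
theorem exists_absorb {h : F ≃ₜ Y × F} (h0 : h 0 = (b, 0)) (n : ℕ) {v : P × FS F → Y}
    {ψ : Y → FS F} (hv : Continuous v) (hψ : Continuous ψ) (hv0 : ∀ p, v (p, 0) = b)
    (hψ0 : ψ b = 0) :
    ∃ (T : P × FS F → Y × FS F) (B : P × (Y × FS F) → FS F), Continuous T ∧ Continuous B ∧
      (∀ p z, T (p, B (p, z)) = z) ∧ (∀ p s, B (p, T (p, s)) = s) ∧ (∀ p, T (p, 0) = (b, 0)) ∧
      (∀ p s, FS.SuppLT n s → ψ (v (p, s)) = s → (T (p, s)).2 = 0) ∧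
      ∀ m ≥ n + 1, ∀ p s, FS.SuppLT m (T (p, s)).2 ↔ FS.SuppLT m s := by
  let Z : P × FS F → Y × F := fun a => h (a.2.1 n + h.symm (v (a.1, FS.trunc n a.2), 0))
  let T : P × FS F → Y × FS F := fun a =>
    ((Z a).1, a.2 + FS.single n ((Z a).2 - a.2.1 n) - FS.trunc n (ψ (Z a).1))
  let B : P × (Y × FS F) → FS F := fun a =>
    a.2.2 + FS.trunc n (ψ a.2.1) + FS.single n (h.symm (a.2.1, a.2.2.1 n) -
      h.symm (v (a.1, FS.trunc n (a.2.2 + ψ a.2.1)), 0) - a.2.2.1 n)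
  have hT : ∀ p s i, (T (p, s)).2.1 i = if i < n then s.1 i - (ψ (Z (p, s)).1).1 i else
      if i = n then (Z (p, s)).2 else s.1 i := by
    intro p s i
    simp only [T, FS.sub_apply, FS.add_apply, FS.trunc_apply]
    rcases lt_trichotomy i n with hi | hi | hi
    · rw [FS.single_ne hi.ne, if_pos hi, if_pos hi, add_zero]
    · subst hi; simp
    · rw [FS.single_ne hi.ne', if_neg hi.not_gt, if_neg hi.not_gt, if_neg hi.ne', add_zero,
        sub_zero]
  have hB : ∀ p y s i, (B (p, y, s)).1 i = if i < n then s.1 i + (ψ y).1 i else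
      if i = n then h.symm (y, s.1 n) - h.symm (v (p, FS.trunc n (s + ψ y)), 0) else s.1 i := by
    intro p y s i
    simp only [B, FS.add_apply, FS.trunc_apply]
    rcases lt_trichotomy i n with hi | hi | hi
    · rw [FS.single_ne hi.ne, if_pos hi, if_pos hi, add_zero]
    · subst hi; simp
    · rw [FS.single_ne hi.ne', if_neg hi.not_gt, if_neg hi.not_gt, if_neg hi.ne', add_zero,
        add_zero]
  have hsymm : h.symm (b, 0) = 0 := (h.symm_apply_eq).2 h0.symm
  have hZB : ∀ p y s, Z (p, B (p, y, s)) = (y, s.1 n) := by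
    intro p y s
    have h1 : FS.trunc n (B (p, y, s)) = FS.trunc n (s + ψ y) := FS.trunc_congr fun i hi => by
      rw [hB, if_pos hi]; rfl
    simp only [Z]
    rw [hB, if_neg (lt_irrefl n), if_pos rfl, h1, sub_add_cancel, h.apply_symm_apply]
  have hZc : Continuous Z := h.continuous.comp
    (((FS.continuous_coord n).comp continuous_snd).add (h.symm.continuous.comp
      ((hv.comp (continuous_fst.prodMk ((FS.continuous_trunc n).comp continuous_snd))).prodMk
        continuous_const)))
  have hab : ∀ p s, FS.SuppLT n s → ψ (v (p, s)) = s → T (p, s) = (v (p, s), 0) := by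
    intro p s hs hψs
    have h1 : Z (p, s) = (v (p, s), 0) := by
      simp only [Z]
      rw [hs.trunc_eq, hs n le_rfl, zero_add, h.apply_symm_apply]
    have h2 : (T (p, s)).1 = v (p, s) := congrArg Prod.fst h1
    refine Prod.ext h2 (FS.ext' fun i => ?_)
    rw [hT, h1]
    rcases lt_trichotomy i n with hi | hi | hi
    · rw [if_pos hi]
      simp only [hψs, sub_self]
      rfl
    · rw [if_neg hi.not_lt, if_pos hi]; rfl
    · rw [if_neg hi.not_gt, if_neg hi.ne', hs i hi.le]; rfl
  refine ⟨T, B, ?_, ?_, ?_, ?_, ?_, fun p s hs hψs => by rw [hab p s hs hψs], ?_⟩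
  · exact (continuous_fst.comp hZc).prodMk ((continuous_snd.add ((FS.continuous_single n).comp
      ((continuous_snd.comp hZc).sub ((FS.continuous_coord n).comp continuous_snd)))).sub
      ((FS.continuous_trunc n).comp (hψ.comp (continuous_fst.comp hZc))))
  · have c1 : Continuous fun a : P × (Y × FS F) => a.2.1 := by fun_prop
    have c2 : Continuous fun a : P × (Y × FS F) => a.2.2 := by fun_prop
    have c3 := (FS.continuous_coord n).comp c2
    have c4 := hψ.comp c1
    exact (c2.add ((FS.continuous_trunc n).comp c4)).add ((FS.continuous_single n).comp
      (((h.symm.continuous.comp (c1.prodMk c3)).sub (h.symm.continuous.comp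
        ((hv.comp (continuous_fst.prodMk ((FS.continuous_trunc n).comp (c2.add c4)))).prodMk
          continuous_const))).sub c3))
  · rintro p ⟨y, s⟩
    have h1 : (T (p, B (p, y, s))).1 = y := congrArg Prod.fst (hZB p y s)
    refine Prod.ext h1 (FS.ext' fun i => ?_)
    rw [hT, hZB, hB]
    split_ifs with hi hi'
    · exact add_sub_cancel_right _ _
    · rw [hi']
    · rfl
  · intro p s
    have h1 : T (p, s) = ((Z (p, s)).1, (T (p, s)).2) := rfl
    rw [h1]
    refine FS.ext' fun i => ?_
    have h2 : FS.trunc n ((T (p, s)).2 + ψ (Z (p, s)).1) = FS.trunc n s :=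
      FS.trunc_congr fun i hi => by rw [FS.add_apply, hT, if_pos hi, sub_add_cancel]
    rw [hB, h2]
    split_ifs with hi hi'
    · rw [hT, if_pos hi, sub_add_cancel]
    · rw [hT, if_neg (lt_irrefl n), if_pos rfl, Prod.mk.eta]
      simp only [Z]
      rw [h.symm_apply_apply, add_sub_cancel_right, hi']
    · rw [hT, if_neg hi, if_neg hi']
  · intro p
    rw [hab p 0 (fun _ _ => rfl) (by rw [hv0, hψ0]), hv0]
  · intro m hm p s
    refine forall₂_congr fun i hi => ?_
    have hi' : n < i := by omega
    rw [hT, if_neg hi'.not_gt, if_neg hi'.ne']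

end Absorb

section Stage

/-- The sequence `p` with all entries from index `j` on replaced by `b`. -/
def seqTrunc {Y : Type} (b : Y) (j : ℕ) (p : ℕ → Y) (i : ℕ) : Y := if i < j then p i else b

theorem continuous_seqTrunc {Y : Type} [TopologicalSpace Y] (b : Y) (j : ℕ) :
    Continuous (seqTrunc b j) := by
  refine continuous_pi fun i => ?_
  by_cases h : i < j
  · simpa [seqTrunc, h] using continuous_apply i
  · simpa [seqTrunc, h] using continuous_const

theorem seqTrunc_seqTrunc {Y : Type} (b : Y) (j : ℕ) (p : ℕ → Y) :
    seqTrunc b j (seqTrunc b j p) = seqTrunc b j p := by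
  funext i
  simp only [seqTrunc]
  split_ifs <;> rfl

/-- A homeomorphism `FS F ≃ₜ Y ^ j × FS F` that preserves the subspaces of sequences supported in
the first `n` coordinates for `n > j`. -/
structure FactorStage (Y F : Type) [TopologicalSpace Y] [NormedAddCommGroup F]
    [InnerProductSpace ℝ F] (b : Y) (j : ℕ) where
  out : FS F → ℕ → Y
  rest : FS F → FS F
  inv : (ℕ → Y) × FS F → FS F
  continuous_out : Continuous out
  continuous_rest : Continuous rest
  continuous_inv : Continuous inv
  inv_self : ∀ y, inv (out y, rest y) = y
  out_inv : ∀ p s, out (inv (p, s)) = seqTrunc b j p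
  rest_inv : ∀ p s, rest (inv (p, s)) = s
  supp_iff : ∀ n ≥ j + 1, ∀ y, FS.SuppLT n (rest y) ↔ FS.SuppLT n y

variable {Y F : Type} [TopologicalSpace Y] [NormedAddCommGroup F] [InnerProductSpace ℝ F]

namespace FactorStage

variable {b : Y} {j : ℕ}

/-- The trivial stage. -/
def zero (F : Type) [NormedAddCommGroup F] [InnerProductSpace ℝ F] (b : Y) :
    FactorStage Y F b 0 where
  out _ _ := b
  rest y := y
  inv a := a.2
  continuous_out := continuous_const
  continuous_rest := continuous_id
  continuous_inv := continuous_snd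
  inv_self _ := rfl
  out_inv _ _ := rfl
  rest_inv _ _ := rfl
  supp_iff _ _ _ := Iff.rfl

theorem seqTrunc_out (S : FactorStage Y F b j) (y : FS F) : seqTrunc b j (S.out y) = S.out y := by
  rw [← S.out_inv (S.out y) (S.rest y), S.inv_self]

theorem inv_seqTrunc (S : FactorStage Y F b j) (p : ℕ → Y) (s : FS F) :
    S.inv (seqTrunc b j p, s) = S.inv (p, s) := by
  have h := S.inv_self (S.inv (p, s))
  rwa [S.out_inv, S.rest_inv] at h

/-- Factoring one more copy of `Y` out of a stage. -/
def extend (S : FactorStage Y F b j) {T : (ℕ → Y) × FS F → Y × FS F}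
    {B : (ℕ → Y) × (Y × FS F) → FS F} (hT : Continuous T) (hB : Continuous B)
    (hTB : ∀ p z, T (p, B (p, z)) = z) (hBT : ∀ p s, B (p, T (p, s)) = s)
    (hs : ∀ m ≥ j + 2, ∀ p s, FS.SuppLT m (T (p, s)).2 ↔ FS.SuppLT m s) :
    FactorStage Y F b (j + 1) where
  out y := Function.update (S.out y) j (T (S.out y, S.rest y)).1
  rest y := (T (S.out y, S.rest y)).2
  inv a := S.inv (seqTrunc b j a.1, B (seqTrunc b j a.1, (a.1 j, a.2)))
  continuous_out := S.continuous_out.update j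
    (continuous_fst.comp (hT.comp (S.continuous_out.prodMk S.continuous_rest)))
  continuous_rest := continuous_snd.comp (hT.comp (S.continuous_out.prodMk S.continuous_rest))
  continuous_inv := by
    have h1 := (continuous_seqTrunc b j).comp (continuous_fst (X := ℕ → Y) (Y := FS F))
    exact S.continuous_inv.comp (h1.prodMk (hB.comp (h1.prodMk
      (((continuous_apply j).comp continuous_fst).prodMk continuous_snd))))
  inv_self y := by
    have h1 : seqTrunc b j (Function.update (S.out y) j (T (S.out y, S.rest y)).1) = S.out y := by
      refine Eq.trans (funext fun i => ?_) (S.seqTrunc_out y)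
      simp only [seqTrunc]
      split_ifs with hi
      · rw [Function.update_of_ne hi.ne]
      · rfl
    simp only [h1]
    rw [Function.update_self, Prod.mk.eta, hBT, S.inv_self]
  out_inv p s := by
    simp only [S.out_inv, S.rest_inv]
    rw [seqTrunc_seqTrunc, hTB]
    funext i
    rcases lt_trichotomy i j with hi | hi | hi
    · rw [Function.update_of_ne hi.ne, seqTrunc, seqTrunc, if_pos hi, if_pos (by omega)]
    · subst hi; rw [Function.update_self, seqTrunc, if_pos (by omega)]
    · rw [Function.update_of_ne hi.ne', seqTrunc, seqTrunc, if_neg (by omega), if_neg (by omega)]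
  rest_inv p s := by
    simp only [S.out_inv, S.rest_inv]
    rw [seqTrunc_seqTrunc, hTB]
  supp_iff n hn y := (hs n hn _ _).trans (S.supp_iff n (by omega) y)

/-- `S'` factors one more copy of `Y` out of `S`, sending `0` to the base point. -/
def Extends (S : FactorStage Y F b j) (S' : FactorStage Y F b (j + 1)) : Prop :=
  (∀ y, ∀ i < j, S'.out y i = S.out y i) ∧ ∀ y, S.rest y = 0 → S'.rest y = 0 ∧ S'.out y j = b

theorem extends_extend (S : FactorStage Y F b j) {T : (ℕ → Y) × FS F → Y × FS F}
    {B : (ℕ → Y) × (Y × FS F) → FS F} (hT : Continuous T) (hB : Continuous B)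
    (hTB : ∀ p z, T (p, B (p, z)) = z) (hBT : ∀ p s, B (p, T (p, s)) = s)
    (hs : ∀ m ≥ j + 2, ∀ p s, FS.SuppLT m (T (p, s)).2 ↔ FS.SuppLT m s)
    (h0 : ∀ p, T (p, 0) = (b, 0)) : S.Extends (S.extend hT hB hTB hBT hs) := by
  refine ⟨fun y i hi => Function.update_of_ne hi.ne _ _, fun y hy => ⟨?_, ?_⟩⟩
  · simp only [extend, hy, h0]
  · simp only [extend, hy, h0, Function.update_self]

end FactorStage

end Stage

theorem exists_uniform_radius {P E : Type} [TopologicalSpace P] [TopologicalSpace.MetrizableSpace P]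
    [NormedAddCommGroup E] {f : P × E → E} (hf : Continuous f) {η : ℝ} (hη : 0 < η) :
    ∃ ε : P → ℝ, Continuous ε ∧ (∀ p, 0 < ε p) ∧
      ∀ p s, ‖s‖ < ε p → dist (f (p, s)) (f (p, 0)) < η := by
  let _ := TopologicalSpace.metrizableSpaceMetric P
  let C : Set (P × E) := {a | η ≤ dist (f a) (f (a.1, 0))}
  have hC : IsClosed C := isClosed_le continuous_const (by fun_prop)
  rcases C.eq_empty_or_nonempty with h | h
  · refine ⟨fun _ => 1, continuous_const, fun _ => one_pos, fun p s _ => ?_⟩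
    by_contra hc
    have : (p, s) ∈ C := not_lt.1 hc
    rw [h] at this
    exact this
  · refine ⟨fun p => Metric.infDist (p, 0) C,
      (Metric.continuous_infDist_pt C).comp (continuous_id.prodMk continuous_const), fun p => ?_,
      fun p s hs => ?_⟩
    · refine (hC.notMem_iff_infDist_pos h).1 fun hp => ?_
      have : η ≤ dist (f (p, 0)) (f (p, 0)) := hp
      rw [dist_self] at this
      linarith
    · by_contra hc
      have h1 : (p, s) ∈ C := not_lt.1 hc
      have h2 := Metric.infDist_le_dist_of_mem (x := (p, (0 : E))) h1
      rw [Prod.dist_eq, dist_self, dist_zero_left, max_eq_right (norm_nonneg s)] at h2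
      linarith

namespace FactorStage

variable {Y F : Type} [NormedAddCommGroup F] [InnerProductSpace ℝ F]

theorem exists_margin_extension [TopologicalSpace Y] [TopologicalSpace.MetrizableSpace Y]
    {b : Y} {j : ℕ} (S : FactorStage Y F b j) {Λ : FS F ≃ₜ Y × FS F} {O : Set Y} (h0 : Λ 0 = (b, 0))
    (hO : ∀ s, (Λ s).1 ∈ O → ‖s‖ < 1) (hs : ∀ s, ∀ i ≥ 1, (Λ s).2.1 i = 0 ↔ s.1 i = 0)
    {η : ℝ} (hη : 0 < η) : ∃ S' : FactorStage Y F b (j + 1), S.Extends S' ∧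
      ∀ y, S'.out y j ∈ O → dist y (S.inv (S.out y, 0)) < η := by
  have := metrizableSpace_nat_pi Y
  obtain ⟨ε, hεc, hε, hεη⟩ := exists_uniform_radius S.continuous_inv hη
  have h1 : Continuous fun a : (ℕ → Y) × FS F => Λ ((ε a.1)⁻¹ • a.2) := Λ.continuous.comp
    (((hεc.comp continuous_fst).inv₀ fun a => (hε _).ne').smul continuous_snd)
  have h2 : Continuous fun a : (ℕ → Y) × (Y × FS F) => ε a.1 • Λ.symm a.2 :=
    (hεc.comp continuous_fst).smul (Λ.symm.continuous.comp continuous_snd)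
  have h3 : ∀ p z, Λ ((ε p)⁻¹ • ε p • Λ.symm z) = z := fun p z => by
    rw [inv_smul_smul₀ (hε p).ne', Λ.apply_symm_apply]
  have h4 : ∀ p s, ε p • Λ.symm (Λ ((ε p)⁻¹ • s)) = s := fun p s => by
    rw [Λ.symm_apply_apply, smul_inv_smul₀ (hε p).ne']
  have h5 : ∀ m ≥ j + 2, ∀ p s, FS.SuppLT m (Λ ((ε p)⁻¹ • s)).2 ↔ FS.SuppLT m s := by
    intro m hm p s
    refine forall₂_congr fun i hi => ?_
    rw [hs _ i (by omega), FS.smul_apply, smul_eq_zero, or_iff_right (inv_ne_zero (hε p).ne')]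
  refine ⟨S.extend h1 h2 h3 h4 h5, S.extends_extend h1 h2 h3 h4 h5 fun p => ?_, fun y hy => ?_⟩
  · simp only [smul_zero, h0]
  · simp only [extend, Function.update_self] at hy
    have h6 := hO _ hy
    rw [norm_smul, norm_inv, Real.norm_of_nonneg (hε _).le, inv_mul_lt_one₀ (hε _)] at h6
    have h7 := hεη _ _ h6
    rwa [S.inv_self] at h7

theorem exists_absorbing_extension [MetricSpace Y] {b y₁ : Y} (hb : y₁ ≠ b)
    (ω : WeakProd Y b ≃ₜ Y) (hω : ω (weakBase b) = b) {c : ℝ × Y → Y} (hc : Continuous c)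
    (hc0 : ∀ y, c (0, y) = b) (hc1 : ∀ y, c (1, y) = y) {h : F ≃ₜ Y × F} (h0 : h 0 = (b, 0))
    {j : ℕ} (S : FactorStage Y F b j) {v : FS F → Y} (hv : Continuous v) {ψ : Y → FS F}
    (hψ : Continuous ψ) : ∃ S' : FactorStage Y F b (j + 1), S.Extends S' ∧
      ∀ y, FS.SuppLT (j + 1) y → ψ (v y) = y → S'.rest y = 0 := by
  obtain ⟨v', ψ', hv', hψ', hv0, hψ0, hvψ⟩ := exists_absorbing_pair hb ω hω hc hc0 hc1
    (hv.comp S.continuous_inv) (S.continuous_rest.comp hψ)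
  obtain ⟨T, B, h1, h2, h3, h4, hT0, hT, h5⟩ := exists_absorb h0 (j + 1) hv' hψ' hv0 hψ0
  refine ⟨S.extend h1 h2 h3 h4 h5, S.extends_extend h1 h2 h3 h4 h5 hT0, fun y hy hy' => ?_⟩
  simp only [extend]
  refine hT _ _ ((S.supp_iff _ le_rfl y).2 hy) (hvψ _ ?_)
  simp only [Function.comp_apply, S.inv_self, hy']

end FactorStage

/-- A finitely supported Hilbert sum splitting off a copy of `Y` is a weak product of `Y`. -/
theorem nonempty_homeomorph_weakProd {Y F : Type} [MetricSpace Y] [NormedAddCommGroup F]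
    [InnerProductSpace ℝ F] {b y₁ : Y} (hb : y₁ ≠ b)
    (ω : WeakProd Y b ≃ₜ Y) (hω : ω (weakBase b) = b) {c : ℝ × Y → Y} (hc : Continuous c)
    (hc0 : ∀ y, c (0, y) = b) (hc1 : ∀ y, c (1, y) = y) {h : F ≃ₜ Y × F} (h0 : h 0 = (b, 0))
    {Λ : FS F ≃ₜ Y × FS F} {O : Set Y} (hΛ0 : Λ 0 = (b, 0)) (hOb : O ∈ 𝓝 b)
    (hO : ∀ s, (Λ s).1 ∈ O → ‖s‖ < 1) (hΛ : ∀ s, ∀ i ≥ 1, (Λ s).2.1 i = 0 ↔ s.1 i = 0)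
    (hsl : IsSliced Y (FS F)) : Nonempty (FS F ≃ₜ WeakProd Y b) := by
  obtain ⟨v, ψ, hv, hψ, hvψ⟩ := hsl
  have hnext : ∀ (j : ℕ) (S : FactorStage Y F b j), ∃ S' : FactorStage Y F b (j + 1),
      S.Extends S' ∧ (j % 2 = 0 → ∀ y, S'.out y j ∈ O →
        dist y (S.inv (S.out y, 0)) < 1 / ((j : ℝ) + 1)) ∧
      (j % 2 = 1 → ∀ y, FS.SuppLT (j + 1) y →
        ψ (j / 2).unpair.1 (v (j / 2).unpair.1 y) = y → S'.rest y = 0) := by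
    intro j S
    rcases Nat.mod_two_eq_zero_or_one j with hj | hj
    · obtain ⟨S', h1, h2⟩ := S.exists_margin_extension hΛ0 hO hΛ
        (η := 1 / ((j : ℝ) + 1)) (by positivity)
      exact ⟨S', h1, fun _ => h2, fun hj' => by omega⟩
    · obtain ⟨S', h1, h2⟩ := S.exists_absorbing_extension hb ω hω hc hc0 hc1 h0
        (hv (j / 2).unpair.1) (hψ (j / 2).unpair.1)
      exact ⟨S', h1, fun hj' => by omega, fun _ => h2⟩
  choose next hext hmargin habs using hnext
  let S : ∀ j, FactorStage Y F b j := fun j => Nat.rec (FactorStage.zero F b) next j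
  have hS : ∀ j, S (j + 1) = next j (S j) := fun j => rfl
  let γ : FS F → ℕ → Y := fun y i => (S (i + 1)).out y i
  have hout : ∀ j y, (S j).out y = seqTrunc b j (γ y) := by
    intro j
    induction j with
    | zero => intro y; exact ((S 0).seqTrunc_out y).symm
    | succ j ih =>
      intro y
      rw [← (S (j + 1)).seqTrunc_out y]
      funext i
      simp only [seqTrunc]
      split_ifs with hi
      · rcases Nat.lt_succ_iff_lt_or_eq.1 hi with hi' | rfl
        · rw [hS, (hext j (S j)).1 y i hi', ih, seqTrunc, if_pos hi']
        · rfl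
      · rfl
  have hrest : ∀ y j, (S j).rest y = 0 → ∀ k, (S (j + k)).rest y = 0 := by
    intro y j hy k
    induction k with
    | zero => exact hy
    | succ k ih => exact ((hext _ _).2 y ih).1
  have hγb : ∀ y j, (S j).rest y = 0 → ∀ i ≥ j, γ y i = b := by
    intro y j hy i hi
    obtain ⟨k, rfl⟩ := Nat.exists_eq_add_of_le hi
    exact ((hext _ _).2 y (hrest y j hy k)).2
  have habsorbed : ∀ y, ∃ j, (S j).rest y = 0 := by
    intro y
    obtain ⟨N, hN⟩ := y.exists_bound
    obtain ⟨i, hi⟩ := hvψ y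
    have h1 : (2 * Nat.pair i N + 1) / 2 = Nat.pair i N := by omega
    have h2 := Nat.right_le_pair i N
    refine ⟨2 * Nat.pair i N + 1 + 1, habs _ (S _) (by omega) y (fun k hk => hN k (by omega)) ?_⟩
    rw [h1, Nat.unpair_pair]
    exact hi
  have hinv : ∀ y j, (S j).rest y = 0 → (S j).inv (γ y, 0) = y := by
    intro y j hy
    rw [← FactorStage.inv_seqTrunc, ← hout, ← hy, (S j).inv_self]
  have hγW : ∀ y, γ y ∈ WeakProd Y b := by
    intro y
    obtain ⟨j, hj⟩ := habsorbed y
    refine (finite_lt_nat j).subset fun i hi => ?_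
    by_contra hc
    exact hi (hγb y j hj i (not_lt.1 hc))
  let Γ : FS F → WeakProd Y b := fun y => ⟨γ y, hγW y⟩
  have hΓc : Continuous Γ := Continuous.subtype_mk
    (continuous_pi fun i => (continuous_apply i).comp (S (i + 1)).continuous_out) _
  have hΓi : Function.Injective Γ := by
    intro y z hyz
    have h1 : γ y = γ z := congrArg Subtype.val hyz
    obtain ⟨j, hj⟩ := habsorbed y
    obtain ⟨k, hk⟩ := habsorbed z
    have h2 := hinv y (j + k) (hrest y j hj k)
    rw [h1, hinv z (j + k) (add_comm k j ▸ hrest z k hk j)] at h2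
    exact h2.symm
  have hΓs : Function.Surjective Γ := by
    intro w
    obtain ⟨N, hN⟩ := w.2.bddAbove
    have hw : ∀ i ≥ N + 1, w.1 i = b := fun i hi => by
      by_contra hc
      have := hN hc
      omega
    have h1 : (S (N + 1)).rest ((S (N + 1)).inv (w.1, 0)) = 0 := (S (N + 1)).rest_inv _ _
    refine ⟨(S (N + 1)).inv (w.1, 0), Subtype.ext (funext fun i => ?_)⟩
    change γ _ i = w.1 i
    rcases lt_or_ge i (N + 1) with hi | hi
    · have h2 := congrFun (hout (N + 1) ((S (N + 1)).inv (w.1, 0))) i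
      rw [FactorStage.out_inv, seqTrunc, seqTrunc, if_pos hi, if_pos hi] at h2
      exact h2.symm
    · rw [hγb _ _ h1 i hi, hw i hi]
  refine ⟨(Equiv.ofBijective Γ ⟨hΓi, hΓs⟩).toHomeomorphOfIsInducing
    (isInducing_iff_nhds.2 fun y => le_antisymm (hΓc.tendsto y).le_comap ?_)⟩
  change comap Γ (𝓝 (Γ y)) ≤ 𝓝 y
  rw [Metric.nhds_basis_ball.ge_iff]
  intro δ hδ
  obtain ⟨j, hj⟩ := habsorbed y
  obtain ⟨n, hn⟩ := exists_nat_one_div_lt (half_pos hδ)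
  let i := 2 * (n + j)
  have h1 : (S i).rest y = 0 := by
    have := hrest y j hj (2 * n + j)
    rwa [show j + (2 * n + j) = i by omega] at this
  have h2 : γ y i = b := hγb y i h1 i le_rfl
  have h3 : ∀ᶠ w in 𝓝 (Γ y), w.1 i ∈ O := by
    have h4 : Tendsto (fun w : WeakProd Y b => w.1 i) (𝓝 (Γ y)) (𝓝 (γ y i)) :=
      ((continuous_apply i).comp continuous_subtype_val).tendsto _
    rw [h2] at h4
    exact h4 hOb
  have h4 : ∀ᶠ w in 𝓝 (Γ y), dist ((S i).inv (w.1, 0)) y < δ / 2 := by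
    have h5 : Tendsto (fun w : WeakProd Y b => (S i).inv (w.1, 0)) (𝓝 (Γ y))
        (𝓝 ((S i).inv (γ y, 0))) :=
      ((S i).continuous_inv.comp (continuous_subtype_val.prodMk continuous_const)).tendsto _
    rw [hinv y i h1] at h5
    exact h5 (Metric.ball_mem_nhds y (half_pos hδ))
  refine mem_comap.2 ⟨_, h3.and h4, fun z hz => ?_⟩
  have h5 := hmargin i (S i) (by omega) z hz.1
  rw [hout, FactorStage.inv_seqTrunc] at h5
  have h6 : 1 / ((i : ℝ) + 1) ≤ 1 / ((n : ℝ) + 1) := by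
    refine one_div_le_one_div_of_le (by positivity) ?_
    have : n ≤ i := by omega
    have : (n : ℝ) ≤ i := by exact_mod_cast this
    linarith
  have h7 : dist ((S i).inv (γ z, 0)) y < δ / 2 := hz.2
  rw [Metric.mem_ball]
  linarith [dist_triangle z ((S i).inv (γ z, 0)) y]

theorem exists_preHilbert_homeomorph {Y : Type} [MetricSpace Y] (hY : IsAbsoluteRetract Y)
    {b y₁ : Y} (hb : y₁ ≠ b) (ω : WeakProd Y b ≃ₜ Y) (hω : ω (weakBase b) = b) :
    ∃ (E : Type) (_ : NormedAddCommGroup E) (_ : InnerProductSpace ℝ E), Nonempty (Y ≃ₜ E) := by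
  have : Nonempty Y := ⟨b⟩
  obtain ⟨c, hc, hc0, hc1⟩ := hY.exists_contraction b
  obtain ⟨L, _, _, ⟨fr⟩⟩ := exists_hilbertFrame hY
  obtain ⟨σ, f, hσ, hf, hfσ⟩ := exists_arc (γ := fun t => c (t, y₁)) (by fun_prop)
    (by simpa only [hc0, hc1] using hb.symm)
  have hj : fr.j b ≠ 0 := fun h => by
    have h1 := fr.Φ_self 0 b
    rw [h, map_zero, pow_zero] at h1
    exact zero_ne_one h1
  have hu : ‖‖fr.j b‖⁻¹ • fr.j b‖ = 1 := norm_smul_inv_norm (𝕜 := ℝ) hj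
  obtain ⟨h, h0⟩ := fr.exists_pointed_factor b
  obtain ⟨Λ, O, hΛ0, hOb, hO, hΛ⟩ := exists_margin hu hb h h0
  obtain ⟨γ⟩ := nonempty_homeomorph_weakProd hb ω hω hc hc0 hc1 h0 hΛ0 hOb hO hΛ
    (((fr.isSliced hY ω hσ hf hfσ).finSupp ω).finSupp ω)
  exact ⟨FS (FS L), inferInstance, inferInstance, ⟨(γ.trans ω).symm⟩⟩

theorem homeomorph_sigmaSub {Y E : Type} [TopologicalSpace Y] [NormedAddCommGroup E] {b : Y}
    (ω : WeakProd Y b ≃ₜ Y) (g : Y ≃ₜ E) : Nonempty (E ≃ₜ SigmaSub E) := by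
  have h0 : (g.trans (Homeomorph.addRight (-g b))) b = 0 := add_neg_cancel _
  exact ⟨(g.symm.trans ω.symm).trans (weakProdCongr _ h0)⟩

/-- For an arbitrary AR `X` with basepoint, the weak product `W(X,*)` is homeomorphic to
a real pre-Hilbert space `E` (a real inner product space with its norm topology) such
that `E ≅ ΣE`. -/
theorem weakProd_homeomorph_preHilbert {X : Type} [TopologicalSpace X]
    (hAR : IsAbsoluteRetract X) (x₀ : X) :
    ∃ (E : Type) (_ : NormedAddCommGroup E) (_ : InnerProductSpace ℝ E),
      Nonempty ((WeakProd X x₀) ≃ₜ E) ∧ Nonempty (E ≃ₜ (SigmaSub E)) := by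
  suffices h : ∃ (E : Type) (_ : NormedAddCommGroup E) (_ : InnerProductSpace ℝ E),
      Nonempty ((WeakProd X x₀) ≃ₜ E) by
    obtain ⟨E, _, _, ⟨g⟩⟩ := h
    exact ⟨E, inferInstance, inferInstance, ⟨g⟩, homeomorph_sigmaSub (weakProdFlatten x₀) g⟩
  rcases subsingleton_or_nontrivial (WeakProd X x₀) with h | h
  · have : Unique (WeakProd X x₀) := ⟨⟨weakBase x₀⟩, fun _ => Subsingleton.elim _ _⟩
    exact ⟨EuclideanSpace ℝ (Fin 0), inferInstance, inferInstance,
      ⟨Homeomorph.homeomorphOfUnique _ _⟩⟩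
  · obtain ⟨y₁, hy₁⟩ := exists_ne (weakBase x₀)
    have hY := hAR.weakProd x₀
    have := hY.1
    let _ := TopologicalSpace.metrizableSpaceMetric (WeakProd X x₀)
    exact exists_preHilbert_homeomorph hY hy₁ (weakProdFlatten x₀) (weakProdFlatten_base x₀)
end

section
/- Let X be an AR and let Y be a metrizable space which is the union of two closed subsets Y₁ and Y₂, each of which admits a closed embedding into X. Then Y admits a closed embedding into X × X × [-1,1]. -/
open Metric in
/-- Two closed sets of a metrizable space admit a continuous `[-1,1]`-valued function which takes
distinct values at any point of `A \ B` and any point of `B \ A`. -/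
theorem exists_continuous_Icc_separating_diff {Y : Type*} [TopologicalSpace Y]
    [TopologicalSpace.MetrizableSpace Y] {A B : Set Y} (hA : IsClosed A) (hB : IsClosed B) :
    ∃ h : Y → Set.Icc (-1 : ℝ) 1, Continuous h ∧
      ∀ x ∈ A \ B, ∀ y ∈ B \ A, h x ≠ h y := by
  let _ := TopologicalSpace.metrizableSpaceMetric Y
  have hmem (y : Y) : min 1 (infDist y B) - min 1 (infDist y A) ∈ Set.Icc (-1 : ℝ) 1 := by
    have hminA := le_min zero_le_one (infDist_nonneg (x := y) (s := A))
    have hminB := le_min zero_le_one (infDist_nonneg (x := y) (s := B))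
    have hleA := min_le_left 1 (infDist y A)
    have hleB := min_le_left 1 (infDist y B)
    constructor <;> linarith
  refine ⟨fun y => ⟨_, hmem y⟩, ?_, ?_⟩
  · refine Continuous.subtype_mk ?_ _
    exact (continuous_const.min (continuous_infDist_pt B)).sub
      (continuous_const.min (continuous_infDist_pt A))
  · intro x hx y hy hxy
    have hxy := congrArg Subtype.val hxy
    have hxB := (hB.notMem_iff_infDist_pos ⟨y, hy.1⟩).1 hx.2
    have hyA := (hA.notMem_iff_infDist_pos ⟨x, hx.1⟩).1 hy.2
    simp only [infDist_zero_of_mem hx.1, infDist_zero_of_mem hy.1] at hxy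
    have hposB := lt_min zero_lt_one hxB
    have hposA := lt_min zero_lt_one hyA
    have hzero : min (1 : ℝ) 0 = 0 := by norm_num
    linarith

/-- A map whose restrictions to two sets covering the domain are closed is closed. -/
theorem isClosedMap_of_union_eq_univ {Y Z : Type*} [TopologicalSpace Y] [TopologicalSpace Z]
    {A B : Set Y} (hcover : A ∪ B = Set.univ) {g : Y → Z} (hgA : IsClosedMap (A.domRestrict g))
    (hgB : IsClosedMap (B.domRestrict g)) : IsClosedMap g := by
  intro C hC
  have h : g '' C =
      A.domRestrict g '' (Subtype.val ⁻¹' C) ∪ B.domRestrict g '' (Subtype.val ⁻¹' C) := by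
    rw [Set.domRestrict_eq, Set.domRestrict_eq, Set.image_comp, Set.image_comp,
      Subtype.image_preimage_coe, Subtype.image_preimage_coe, ← Set.image_union,
      ← Set.union_inter_distrib_right, hcover, Set.univ_inter]
  rw [h]
  exact (hgA _ (hC.preimage continuous_subtype_val)).union
    (hgB _ (hC.preimage continuous_subtype_val))

/-- If `X` is an AR and the metrizable space `Y` is the union of two closed subsets, each
closed embeddable in `X`, then `Y` admits a closed embedding into `X × X × [-1,1]`. -/
theorem closedEmbedding_union_of_two {X : Type} [TopologicalSpace X]
    (hAR : IsAbsoluteRetract X)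
    {Y : Type} [TopologicalSpace Y] [TopologicalSpace.MetrizableSpace Y]
    (Y₁ Y₂ : Set Y) (hY₁ : IsClosed Y₁) (hY₂ : IsClosed Y₂) (hcover : Y₁ ∪ Y₂ = Set.univ)
    (h₁ : ∃ e : Y₁ → X, Topology.IsClosedEmbedding e)
    (h₂ : ∃ e : Y₂ → X, Topology.IsClosedEmbedding e) :
    ∃ g : Y → X × X × (Set.Icc (-1 : ℝ) 1), Topology.IsClosedEmbedding g := by
  obtain ⟨hX, hext⟩ := hAR
  obtain ⟨e₁, he₁⟩ := h₁
  obtain ⟨e₂, he₂⟩ := h₂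
  obtain ⟨f₁, hf₁, hfe₁⟩ := hext Y _ inferInstance Y₁ hY₁ e₁ he₁.continuous
  obtain ⟨f₂, hf₂, hfe₂⟩ := hext Y _ inferInstance Y₂ hY₂ e₂ he₂.continuous
  obtain ⟨h, hh, hsep⟩ := exists_continuous_Icc_separating_diff hY₁ hY₂
  have hg : Continuous fun y => (f₁ y, f₂ y, h y) := hf₁.prodMk (hf₂.prodMk hh)
  refine ⟨fun y => (f₁ y, f₂ y, h y), .of_continuous_injective_isClosedMap hg ?_ ?_⟩
  · intro x y hxy
    simp only [Prod.mk.injEq] at hxy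
    obtain ⟨hxy₁, hxy₂, hxyh⟩ := hxy
    have inj₁ (hx : x ∈ Y₁) (hy : y ∈ Y₁) : x = y := by
      have := he₁.injective (a₁ := ⟨x, hx⟩) (a₂ := ⟨y, hy⟩) (by rw [← hfe₁, ← hfe₁, hxy₁])
      exact congrArg Subtype.val this
    have inj₂ (hx : x ∈ Y₂) (hy : y ∈ Y₂) : x = y := by
      have := he₂.injective (a₁ := ⟨x, hx⟩) (a₂ := ⟨y, hy⟩) (by rw [← hfe₂, ← hfe₂, hxy₂])
      exact congrArg Subtype.val this
    have hx : x ∈ Y₁ ∪ Y₂ := hcover ▸ Set.mem_univ x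
    have hy : y ∈ Y₁ ∪ Y₂ := hcover ▸ Set.mem_univ y
    by_contra hne
    rcases hx with hx | hx <;> rcases hy with hy | hy
    · exact hne (inj₁ hx hy)
    · exact hsep x ⟨hx, fun hx' => hne (inj₂ hx' hy)⟩ y ⟨hy, fun hy' => hne (inj₁ hx hy')⟩ hxyh
    · exact hsep y ⟨hy, fun hy' => hne (inj₂ hx hy')⟩ x ⟨hx, fun hx' => hne (inj₁ hx' hy)⟩ hxyh.symm
    · exact hne (inj₂ hx hy)
  · refine isClosedMap_of_union_eq_univ hcover ?_ ?_
    · refine (isProperMap_of_comp_of_t2 (hg.comp continuous_subtype_val)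
        continuous_fst ?_).isClosedMap
      exact (funext hfe₁ : f₁ ∘ Subtype.val = e₁) ▸ he₁.isProperMap
    · refine (isProperMap_of_comp_of_t2 (hg.comp continuous_subtype_val)
        (continuous_fst.comp continuous_snd) ?_).isClosedMap
      exact (funext hfe₂ : f₂ ∘ Subtype.val = e₂) ▸ he₂.isProperMap
end
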